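/- (Existence theorem.) Let V be a ℤ/2-graded K-vector space, 1∈V an even vector, 𝐓=(T,T̄) an even pair of commuting operators on V with T1=T̄1=0, and S⊆F(V) a set of homogeneous fields that is weakly creative, translation covariant (for 1 and 𝐓) and multiply local (respectively uniformly local), such that V = span{a¹_{𝐧₁}⋯aʳ_{𝐧ᵣ}1 : a^i(𝐳)∈S, 𝐧_i∈K², r∈ℕ}. Then there exists a unique structure Y of a multiply local (respectively uniformly local) OPE-algebra on V such that 1 is a weak right identity and Y(s_1 a(𝐳)) = a(𝐳) for every a(𝐳)∈S; moreover F_Y = ⌊S⌋, the closure of S∪{1(z)} under the products of fields. -/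

import Mathlib

open scoped BigOperators Classical

noncomputable section

namespace OPEA

variable (K : Type*) [Field K] [CharZero K]

/-- index pairs 𝐧 = (n, n̄) ∈ K² -/
abbrev Idx := K × K

def IsInt (x : K) : Prop := ∃ k : ℤ, (k : K) = x

def IsNegInt (x : K) : Prop := ∃ k : ℤ, k < 0 ∧ (k : K) = x

/-- 𝕂̄ = {𝐧 ∈ K² | n − n̄ ∈ ℤ} -/
def Kbar (n : Idx K) : Prop := IsInt K (n.1 - n.2)

def IsIntPair (n : Idx K) : Prop := IsInt K n.1 ∧ IsInt K n.2

/-- generalized binomial coefficient C(x,k) -/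
def gchoose (x : K) (k : ℕ) : K :=
  (∏ i ∈ Finset.range k, (x - (i : K))) / (k.factorial : K)

/-- (−1)^x for x an integer image in K (and 1 otherwise) -/
def negOnePow (x : K) : K :=
  if h : ∃ k : ℤ, (k : K) = x then (-1 : K) ^ h.choose else 1

variable (M : Type*) [AddCommGroup M] [Module K M]

/-- M-valued distribution in one variable pair -/
abbrev Dist1 := Idx K → M

/-- M-valued distribution in two variable pairs -/
abbrev Dist2 := Idx K → Idx K → M

/-- M-valued distribution in r variable pairs -/
abbrev DistN (r : ℕ) := (Fin r → Idx K) → M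

/-- membership in M[[𝐳]] -/
def IsPow1 (a : Dist1 K M) : Prop := ∀ n, a n ≠ 0 → IsNegInt K n.1 ∧ IsNegInt K n.2

/-- membership in M⌊𝐳⌋ -/
def InLat1 (a : Dist1 K M) : Prop :=
  ∃ S : Finset (Idx K), ∀ n, a n ≠ 0 →
    ∃ m ∈ S, IsNegInt K (n.1 - m.1) ∧ IsNegInt K (n.2 - m.2)

/-- membership in M[[𝐳,𝐰]] -/
def IsPow2 (a : Dist2 K M) : Prop :=
  ∀ n k, a n k ≠ 0 →
    (IsNegInt K n.1 ∧ IsNegInt K n.2) ∧ (IsNegInt K k.1 ∧ IsNegInt K k.2)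

/-- membership in M⌊𝐳,𝐰⌋ -/
def InLat2 (a : Dist2 K M) : Prop :=
  ∃ S : Finset (Idx K × Idx K), ∀ n k, a n k ≠ 0 →
    ∃ m ∈ S, (IsNegInt K (n.1 - m.1.1) ∧ IsNegInt K (n.2 - m.1.2)) ∧
      (IsNegInt K (k.1 - m.2.1) ∧ IsNegInt K (k.2 - m.2.2))

/-- membership in M[[𝐳₁,…,𝐳ᵣ]] -/
def IsPowN {r : ℕ} (a : DistN K M r) : Prop :=
  ∀ n, a n ≠ 0 → ∀ i, IsNegInt K (n i).1 ∧ IsNegInt K (n i).2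

/-- membership in M⌊𝐳₁,…,𝐳ᵣ⌋ -/
def InLatN {r : ℕ} (a : DistN K M r) : Prop :=
  ∃ S : Finset (Fin r → Idx K), ∀ n, a n ≠ 0 →
    ∃ m ∈ S, ∀ i, IsNegInt K ((n i).1 - (m i).1) ∧ IsNegInt K ((n i).2 - (m i).2)

/-- ∂_z -/
def dz (a : Dist1 K M) : Dist1 K M := fun n => (-n.1) • a (n.1 - 1, n.2)

/-- ∂_z̄ -/
def dzb (a : Dist1 K M) : Dist1 K M := fun n => (-n.2) • a (n.1, n.2 - 1)

/-- ∂ in the first variable pair of a two-variable distribution (z-component) -/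
def d1z (c : Dist2 K M) : Dist2 K M := fun n k => (-n.1) • c (n.1 - 1, n.2) k

/-- ∂ in the first variable pair of a two-variable distribution (z̄-component) -/
def d1zb (c : Dist2 K M) : Dist2 K M := fun n k => (-n.2) • c (n.1, n.2 - 1) k

/-- divided power d^{(x)} of an operator d, for a K-valued exponent x
(zero unless x ∈ ℕ) -/
def dPow {A : Type*} [AddCommGroup A] [Module K A] (d : A → A) (x : K) (a : A) : A :=
  if h : ∃ j : ℕ, (j : K) = x then ((h.choose.factorial : K))⁻¹ • d^[h.choose] a else 0

/-- ∂_z^{(e_1)} ∂_z̄^{(e_2)} in the first variable pair -/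
def ddPow2 (e : Idx K) (c : Dist2 K M) : Dist2 K M :=
  dPow K (d1z K M) e.1 (dPow K (d1zb K M) e.2 c)

/-- the diagonal map c(𝐳,𝐰) ↦ c(𝐰,𝐰) -/
def diag (c : Dist2 K M) : Dist1 K M :=
  fun n => ∑ᶠ m : Idx K, c m (n.1 - m.1 - 1, n.2 - m.2 - 1)

/-- multiplication by (𝐳−𝐰)^h (expansion in z>w), on coefficients;
first index is 𝐳, second is 𝐰 -/
def zwPow (h : Idx K) (c : Dist2 K M) : Dist2 K M :=
  fun m k => ∑ᶠ i : ℕ × ℕ,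
    ((-1 : K) ^ (i.1 + i.2) * gchoose K h.1 i.1 * gchoose K h.2 i.2) •
      c (m.1 + h.1 - i.1, m.2 + h.2 - i.2) (k.1 + i.1, k.2 + i.2)

/-- multiplication by ((𝐳−𝐰)_{w>z})^h = (−1)^h (𝐰−𝐳)^h (expansion in w>z) -/
def zwPowW (h : Idx K) (c : Dist2 K M) : Dist2 K M :=
  fun m k => ∑ᶠ i : ℕ × ℕ,
    (negOnePow K (h.1 - h.2) * (-1 : K) ^ (i.1 + i.2) *
        gchoose K h.1 i.1 * gchoose K h.2 i.2) •
      c (m.1 + i.1, m.2 + i.2) (k.1 + h.1 - i.1, k.2 + h.2 - i.2)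

/-- multiplication by (𝐱+𝐰)^N of a distribution d(𝐰,𝐱) (first index 𝐰, second 𝐱);
the result is indexed by (x-index, w-index) -/
def xwPow (N : Idx K) (d : Dist2 K M) : Dist2 K M :=
  fun m k => ∑ᶠ i : ℕ × ℕ, (gchoose K N.1 i.1 * gchoose K N.2 i.2) •
    d (k.1 + i.1, k.2 + i.2) (m.1 + N.1 - i.1, m.2 + N.2 - i.2)

/-- multiplication by (𝐰+𝐱)^N of a distribution d(𝐰,𝐱) (first index 𝐰, second 𝐱);
the result is indexed by (x-index, w-index) -/
def wxPow (N : Idx K) (d : Dist2 K M) : Dist2 K M :=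
  fun m k => ∑ᶠ i : ℕ × ℕ, (gchoose K N.1 i.1 * gchoose K N.2 i.2) •
    d (k.1 + N.1 - i.1, k.2 + N.2 - i.2) (m.1 + i.1, m.2 + i.2)

/-- multiplication by 𝐱^A 𝐰^B (𝐱+𝐰)^N of p(𝐰,𝐱); result indexed (x-index, w-index) -/
def tripleXW (A B N : Idx K) (p : Dist2 K M) : Dist2 K M :=
  fun m k => ∑ᶠ l : ℕ × ℕ, (gchoose K N.1 l.1 * gchoose K N.2 l.2) •
    p (k.1 + B.1 + l.1, k.2 + B.2 + l.2) (m.1 + A.1 + N.1 - l.1, m.2 + A.2 + N.2 - l.2)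

/-- multiplication by 𝐱^A 𝐰^B (𝐰+𝐱)^N of p(𝐰,𝐱); result indexed (x-index, w-index) -/
def tripleWX (A B N : Idx K) (p : Dist2 K M) : Dist2 K M :=
  fun m k => ∑ᶠ l : ℕ × ℕ, (gchoose K N.1 l.1 * gchoose K N.2 l.2) •
    p (k.1 + B.1 + N.1 - l.1, k.2 + B.2 + N.2 - l.2) (m.1 + A.1 + l.1, m.2 + A.2 + l.2)

variable (E : Type*) [AddCommGroup E] [Module K E]

/-- End(E)-valued distributions in one variable pair -/
abbrev EDist1 := Dist1 K (Module.End K E)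

/-- End(E)-valued distributions in two variable pairs -/
abbrev EDist2 := Dist2 K (Module.End K E)

/-- End(E)-valued distributions in r variable pairs -/
abbrev EDistN (r : ℕ) := DistN K (Module.End K E) r

def ev1 (a : EDist1 K E) (v : E) : Dist1 K E := fun n => a n v

def ev2 (c : EDist2 K E) (v : E) : Dist2 K E := fun n k => c n k v

def evN {r : ℕ} (c : EDistN K E r) (v : E) : DistN K E r := fun n => c n v

/-- a(𝐳) is a field -/
def IsFieldD (a : EDist1 K E) : Prop := ∀ v, InLat1 K E (ev1 K E a v)

/-- a field in two variable pairs -/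
def IsField2D (c : EDist2 K E) : Prop := ∀ v, InLat2 K E (ev2 K E c v)

/-- the Koszul sign (−1)^{pq} -/
def koszul (p q : ZMod 2) : K := if p = 1 ∧ q = 1 then (-1 : K) else 1

/-- the data (c^i, 𝐡_i) is an OPE of the homogeneous distributions a(𝐳), b(𝐳)
of parities pa, pb (all identities to be read applied to each vector of E) -/
def IsOPE (pa pb : ZMod 2) (a b : EDist1 K E) {r : ℕ}
    (c : Fin r → EDist2 K E) (h : Fin r → Idx K) : Prop :=
  (∀ i, Kbar K (h i)) ∧ (∀ i, IsField2D K E (c i)) ∧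
  (∀ v m k, a m (b k v) = ∑ i, zwPow K E (-(h i)) (ev2 K E (c i) v) m k) ∧
  (∀ v m k, koszul K pa pb • (b k (a m v)) =
      ∑ i, zwPowW K E (-(h i)) (ev2 K E (c i) v) m k)

/-- a(𝐳), b(𝐳) (homogeneous of parities pa, pb) are local -/
def IsLocal (pa pb : ZMod 2) (a b : EDist1 K E) : Prop :=
  ∃ (r : ℕ) (c : Fin r → EDist2 K E) (h : Fin r → Idx K), IsOPE K E pa pb a b c h

/-- the exponents of an OPE are reduced: 𝐡_i ∉ 𝐡_j + ℤ² for i ≠ j -/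
def ReducedExp {r : ℕ} (h : Fin r → Idx K) : Prop :=
  ∀ i j, i ≠ j → ¬ IsIntPair K (h i - h j)

/-- the product field a(𝐰)_{(𝐧)}b(𝐰) built from an OPE (c,h), applied to a vector v -/
def prodAt {r : ℕ} (c : Fin r → EDist2 K E) (h : Fin r → Idx K) (n : Idx K)
    (v : E) : Dist1 K E :=
  fun m => ∑ i, diag K E
    (ddPow2 K E ((h i).1 - 1 - n.1, (h i).2 - 1 - n.2) (ev2 K E (c i) v)) m

/-- s₁ : a(𝐳) ↦ a_{(−1,−1)}1 -/
def s1 (one : E) (a : EDist1 K E) : E := a ((-1 : K), (-1 : K)) one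

/-- the distribution d (to be thought of as a(𝐳)1) equals
Σ_{𝐢∈ℕ²} T^{(i)} T̄^{(ī)} (d_{(−1,−1)}) 𝐳^𝐢, i.e. a(𝐳) is creative -/
def CreativeD (T Tb : Module.End K E) (d : Dist1 K E) : Prop :=
  (∀ i : ℕ × ℕ, d (-(i.1 : K) - 1, -(i.2 : K) - 1) =
      ((i.1.factorial : K)⁻¹ * (i.2.factorial : K)⁻¹) •
        ((T ^ i.1) * (Tb ^ i.2)) (d ((-1 : K), (-1 : K)))) ∧
  (∀ n : Idx K, (¬ ∃ i : ℕ × ℕ, n = (-(i.1 : K) - 1, -(i.2 : K) - 1)) → d n = 0)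

/-- a(𝐳) is translation covariant for (T, T̄) -/
def TransCov (T Tb : Module.End K E) (a : EDist1 K E) : Prop :=
  (∀ n : Idx K, T * a n - a n * T = (-n.1) • a (n.1 - 1, n.2)) ∧
  (∀ n : Idx K, Tb * a n - a n * Tb = (-n.2) • a (n.1, n.2 - 1))

/-- translation covariance of a product field, per vector -/
def TransCovAt (T Tb : Module.End K E) (P : E → Dist1 K E) : Prop :=
  (∀ v (m : Idx K), T (P v m) - P (T v) m = (-m.1) • P v (m.1 - 1, m.2)) ∧
  (∀ v (m : Idx K), Tb (P v m) - P (Tb v) m = (-m.2) • P v (m.1, m.2 - 1))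

/-- the identity field 1(z) = id_E -/
def idField : EDist1 K E :=
  fun n => if n = ((-1 : K), (-1 : K)) then (1 : Module.End K E) else 0

/-- pairs i < j in [r] -/
abbrev Pairs (r : ℕ) := {p : Fin r × Fin r // p.1 < p.2}

/-- the index shift of the i-th variable produced by the monomial of a binomial
expansion of ((𝐳_{p₁} − 𝐳_{p₂})_σ)^h belonging to 𝐤 ∈ ℕ² -/
def pairShift {r : ℕ} (p : Pairs r) (h : Idx K) (flip : Bool) (kk : ℕ × ℕ)
    (i : Fin r) : Idx K :=
  if i = p.1.1 then
    (if flip then ((kk.1 : K), (kk.2 : K)) else (h.1 - kk.1, h.2 - kk.2))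
  else if i = p.1.2 then
    (if flip then (h.1 - kk.1, h.2 - kk.2) else ((kk.1 : K), (kk.2 : K)))
  else 0

/-- the coefficient of a binomial expansion of ((𝐳_{p₁} − 𝐳_{p₂})_σ)^h
belonging to 𝐤 ∈ ℕ² -/
def pairCoef (h : Idx K) (flip : Bool) (kk : ℕ × ℕ) : K :=
  (if flip then negOnePow K (h.1 - h.2) else 1) * (-1 : K) ^ (kk.1 + kk.2) *
    gchoose K h.1 kk.1 * gchoose K h.2 kk.2

def flipOf {r : ℕ} (σ : Equiv.Perm (Fin r)) (p : Pairs r) : Bool :=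
  decide (σ.symm p.1.2 < σ.symm p.1.1)

/-- multiplication by Π_{i<j} ((𝐳_i − 𝐳_j)_σ)^{h_{ij}} on an r-variable distribution -/
def permMul {r : ℕ} (σ : Equiv.Perm (Fin r)) (hs : Pairs r → Idx K)
    (c : DistN K M r) : DistN K M r :=
  fun m => ∑ᶠ κ : Pairs r → ℕ × ℕ,
    (∏ p : Pairs r, pairCoef K (hs p) (flipOf σ p) (κ p)) •
      c (fun i => m i + ∑ p : Pairs r, pairShift K p (hs p) (flipOf σ p) (κ p) i)

/-- the Koszul sign ζ' produced by reordering a¹,…,aʳ into a^{σ1},…,a^{σr} -/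
def koszulPerm {r : ℕ} (ps : Fin r → ZMod 2) (σ : Equiv.Perm (Fin r)) : K :=
  ∏ p : Pairs r,
    if σ.symm p.1.2 < σ.symm p.1.1 ∧ ps p.1.1 = 1 ∧ ps p.1.2 = 1 then (-1 : K) else 1

/-- the composition a^{σ1}(𝐳_{σ1})_{m_{σ1}} ∘ ⋯ ∘ a^{σr}(𝐳_{σr})_{m_{σr}} applied to v -/
def compSeq {r : ℕ} (a : Fin r → EDist1 K E) (σ : Equiv.Perm (Fin r))
    (m : Fin r → Idx K) (v : E) : E :=
  (List.ofFn fun j : Fin r => σ j).foldr (fun i acc => a i (m i) acc) v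

/-- the data (c^α, 𝐡_{ij}^k) is a (multiple) OPE of the homogeneous distributions
a¹(𝐳),…,aʳ(𝐳) of parities ps -/
def IsMultOPE {r : ℕ} (a : Fin r → EDist1 K E) (ps : Fin r → ZMod 2)
    (rij : Fin r → Fin r → ℕ) (hs : ∀ i j : Fin r, Fin (rij i j) → Idx K)
    (c : ((p : Pairs r) → Fin (rij p.1.1 p.1.2)) → EDistN K E r) : Prop :=
  (∀ i j k, Kbar K (hs i j k)) ∧
  (∀ α v, InLatN K E (evN K E (c α) v)) ∧
  (∀ σ : Equiv.Perm (Fin r), ∀ v m,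
    koszulPerm K ps σ • compSeq K E a σ m v =
      ∑ α : (p : Pairs r) → Fin (rij p.1.1 p.1.2),
        permMul K E σ (fun p => -(hs p.1.1 p.1.2 (α p))) (evN K E (c α) v) m)

/-- a¹(𝐳),…,aʳ(𝐳) are multiply local -/
def MultiplyLocal {r : ℕ} (a : Fin r → EDist1 K E) (ps : Fin r → ZMod 2) : Prop :=
  ∃ (rij : Fin r → Fin r → ℕ) (hs : ∀ i j : Fin r, Fin (rij i j) → Idx K)
    (c : ((p : Pairs r) → Fin (rij p.1.1 p.1.2)) → EDistN K E r),
      IsMultOPE K E a ps rij hs c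

/-- a set of homogeneous fields (with parities pF) is multiply local -/
def MultLocalSet (F : Set (EDist1 K E)) (pF : EDist1 K E → ZMod 2) : Prop :=
  ∀ (r : ℕ) (f : Fin r → EDist1 K E), (∀ i, f i ∈ F) →
    MultiplyLocal K E f (fun i => pF (f i))

/-- a set of homogeneous fields (with parities pF) is uniformly local -/
def UnifLocalSet (F : Set (EDist1 K E)) (pF : EDist1 K E → ZMod 2) (one : E) : Prop :=
  ∃ (rr : EDist1 K E → EDist1 K E → ℕ)
    (hh : ∀ d e : EDist1 K E, Fin (rr d e) → Idx K),
    ∀ (r : ℕ) (f : Fin r → EDist1 K E), (∀ i, f i ∈ F) →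
      ∃ c, IsMultOPE K E f (fun i => pF (f i)) (fun i j => rr (f i) (f j))
          (fun i j => hh (f i) (f j)) c ∧
        ∀ α, IsPowN K E (evN K E (c α) one)

/-- a ∈ V is homogeneous of parity p w.r.t. the grading (ev, od) -/
def memPar {V : Type*} [AddCommGroup V] [Module K V] (ev od : Submodule K V)
    (a : V) (p : ZMod 2) : Prop :=
  (p = 0 ∧ a ∈ ev) ∨ (p = 1 ∧ a ∈ od)

/-- an endomorphism is homogeneous of parity p w.r.t. the grading (ev, od) -/
def EndPar {V : Type*} [AddCommGroup V] [Module K V] (ev od : Submodule K V)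
    (f : Module.End K V) (p : ZMod 2) : Prop :=
  if p = 0 then (∀ v ∈ ev, f v ∈ ev) ∧ (∀ v ∈ od, f v ∈ od)
  else (∀ v ∈ ev, f v ∈ od) ∧ (∀ v ∈ od, f v ∈ ev)

/-- a distribution is homogeneous of parity p -/
def EDistPar {V : Type*} [AddCommGroup V] [Module K V] (ev od : Submodule K V)
    (a : EDist1 K V) (p : ZMod 2) : Prop :=
  ∀ n, EndPar K ev od (a n) p

end OPEA

namespace OPEA

/-- an OPE-algebra -/
structure OPEAlg (K : Type*) [Field K] [CharZero K]
    (V : Type*) [AddCommGroup V] [Module K V] where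
  ev : Submodule K V
  od : Submodule K V
  compl : IsCompl ev od
  Y : V →ₗ[K] EDist1 K V
  Y_par : ∀ a p, memPar K ev od a p → ∀ (n : Idx K) b q, memPar K ev od b q →
    memPar K ev od (Y a n b) (p + q)
  one : V
  one_ev : one ∈ ev
  T : Module.End K V
  Tb : Module.End K V
  T_ev : EndPar K ev od T 0
  Tb_ev : EndPar K ev od Tb 0
  commTTb : T * Tb = Tb * T
  T_one : T one = 0
  Tb_one : Tb one = 0
  wcre : ∀ a, IsPow1 K V (ev1 K V (Y a) one)
  rid : ∀ a, Y a ((-1 : K), (-1 : K)) one = a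
  tcov : ∀ a, TransCov K V T Tb (Y a)
  loc : ∀ a b pa pb, memPar K ev od a pa → memPar K ev od b pb →
    IsLocal K V pa pb (Y a) (Y b)

/-- a bounded 𝕂̄-fold algebra -/
structure BFold (K : Type*) [Field K] [CharZero K]
    (V : Type*) [AddCommGroup V] [Module K V] where
  ev : Submodule K V
  od : Submodule K V
  compl : IsCompl ev od
  Y : V →ₗ[K] EDist1 K V
  Y_par : ∀ a p, memPar K ev od a p → ∀ (n : Idx K) b q, memPar K ev od b q →
    memPar K ev od (Y a n b) (p + q)
  fields : ∀ a, IsFieldD K V (Y a)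
  bounded : ∀ a (n : Idx K), ¬ Kbar K n → ∀ b, Y a n b = 0

/-- a bounded 𝕂̄-fold module over a bounded 𝕂̄-fold algebra -/
structure BMod (K : Type*) [Field K] [CharZero K]
    (V : Type*) [AddCommGroup V] [Module K V] (A : BFold K V)
    (Mo : Type*) [AddCommGroup Mo] [Module K Mo] where
  evM : Submodule K Mo
  odM : Submodule K Mo
  complM : IsCompl evM odM
  YM : V →ₗ[K] EDist1 K Mo
  YM_par : ∀ a p, memPar K A.ev A.od a p → ∀ n : Idx K, EndPar K evM odM (YM a n) p
  fieldsM : ∀ a, IsFieldD K Mo (YM a)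
  boundedM : ∀ a (n : Idx K), ¬ Kbar K n → ∀ c, YM a n c = 0

variable (K : Type*) [Field K] [CharZero K]
variable (V : Type*) [AddCommGroup V] [Module K V]
variable (Mo : Type*) [AddCommGroup Mo] [Module K Mo]

/-- the operator T₁ : a ↦ a_{(−2,−1)}1 of an OPE-algebra -/
def T1 (A : OPEAlg K V) : Module.End K V where
  toFun := fun a => A.Y a ((-2 : K), (-1 : K)) A.one
  map_add' := by
    intro x y
    simp [map_add, Pi.add_apply, LinearMap.add_apply]
  map_smul' := by
    intro c x
    simp [map_smul, Pi.smul_apply, LinearMap.smul_apply]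

/-- the operator T̄₁ : a ↦ a_{(−1,−2)}1 of an OPE-algebra -/
def T1b (A : OPEAlg K V) : Module.End K V where
  toFun := fun a => A.Y a ((-1 : K), (-2 : K)) A.one
  map_add' := by
    intro x y
    simp [map_add, Pi.add_apply, LinearMap.add_apply]
  map_smul' := by
    intro c x
    simp [map_smul, Pi.smul_apply, LinearMap.smul_apply]

/-- skew-symmetry for the pair (T, T̄) -/
def SkewSym (ev od : Submodule K V) (Yf : V → EDist1 K V)
    (T Tb : Module.End K V) : Prop :=
  ∀ a b pa pb, memPar K ev od a pa → memPar K ev od b pb →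
    ∀ n : Idx K, Kbar K n →
      (Function.support (fun i : ℕ × ℕ =>
        ((i.1.factorial : K)⁻¹ * (i.2.factorial : K)⁻¹ *
            negOnePow K (n.1 + i.1 - (n.2 + i.2))) •
          ((T ^ i.1) * (Tb ^ i.2)) (Yf a (n.1 + i.1, n.2 + i.2) b))).Finite ∧
      koszul K pa pb • Yf b n a =
        ∑ᶠ i : ℕ × ℕ, ((i.1.factorial : K)⁻¹ * (i.2.factorial : K)⁻¹ *
            negOnePow K (n.1 + i.1 - (n.2 + i.2))) •
          ((T ^ i.1) * (Tb ^ i.2)) (Yf a (n.1 + i.1, n.2 + i.2) b)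

/-- (T, T̄) is a translation endomorphism of the module with state-field map YM -/
def TransEnd (YM : V → EDist1 K Mo) (T Tb : Module.End K V) : Prop :=
  (∀ a (n : Idx K), YM (T a) n = (-n.1) • YM a (n.1 - 1, n.2)) ∧
  (∀ a (n : Idx K), YM (Tb a) n = (-n.2) • YM a (n.1, n.2 - 1))

/-- the coefficient at (x-index m, w-index k) of a(𝐱+𝐰) applied to the w-distribution bw -/
def lhsXW (YM : V → EDist1 K Mo) (a : V) (bw : Dist1 K Mo) (m k : Idx K) : Mo :=
  ∑ᶠ i : ℕ × ℕ, ((i.1.factorial : K)⁻¹ * (i.2.factorial : K)⁻¹) •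
    (((dz K (Module.End K Mo))^[i.1] ((dzb K (Module.End K Mo))^[i.2] (YM a))) m)
      (bw (k.1 + i.1, k.2 + i.2))

/-- a and cM are dual in the direct channel -/
def DualDirect (Y : V → EDist1 K V) (YM : V → EDist1 K Mo) (a : V) (cM : Mo) : Prop :=
  ∃ (s : ℕ) (d : Fin s → Idx K → Idx K → (V →ₗ[K] Mo)) (hj : Fin s → Idx K),
    (∀ j, Kbar K (hj j)) ∧
    (∀ j b, InLat2 K Mo (fun kw mx => d j kw mx b)) ∧
    (∀ b (m k : Idx K),
      lhsXW K V Mo YM a (fun k' => YM b k' cM) m k =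
        ∑ j, xwPow K Mo (-(hj j)) (fun kw mx => d j kw mx b) m k) ∧
    (∀ b (m k : Idx K),
      YM (Y a m b) k cM =
        ∑ j, wxPow K Mo (-(hj j)) (fun kw mx => d j kw mx b) m k)

/-- a and b are dual in the exchange channel on the module -/
def DualExch (Y : V → EDist1 K V) (YM : V → EDist1 K Mo) (a b : V) : Prop :=
  ∃ (r : ℕ) (hab : Fin r → Idx K), (∀ i, Kbar K (hab i)) ∧
    ∀ cM : Mo, ∃ (s : ℕ) (hac : Fin s → Idx K)
      (q : Fin r → Fin s → Idx K → Idx K → Mo),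
      (∀ j, Kbar K (hac j)) ∧
      (∀ i j kw mx, q i j kw mx ≠ 0 → IsNegInt K mx.1 ∧ IsNegInt K mx.2) ∧
      (∀ i j mx, InLat1 K Mo (fun kw => q i j kw mx)) ∧
      (∀ m k : Idx K,
        lhsXW K V Mo YM a (fun k' => YM b k' cM) m k =
          ∑ j, xwPow K Mo (-(hac j))
            (fun kw mx => ∑ i, q i j kw (mx.1 - (hab i).1, mx.2 - (hab i).2)) m k) ∧
      (∀ m k : Idx K,
        YM (Y a m b) k cM =
          ∑ j, wxPow K Mo (-(hac j))
            (fun kw mx => ∑ i, q i j kw (mx.1 - (hab i).1, mx.2 - (hab i).2)) m k)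

/-- the module with state-field map YM is dual -/
def IsDualMod (ev od : Submodule K V) (Y : V → EDist1 K V) (YM : V → EDist1 K Mo) : Prop :=
  ∃ (rVV : V → V → ℕ) (hVV : ∀ a b : V, Fin (rVV a b) → Idx K)
    (rVM : V → Mo → ℕ) (hVM : ∀ (a : V) (c : Mo), Fin (rVM a c) → Idx K),
    (∀ a b i, Kbar K (hVV a b i)) ∧ (∀ a c j, Kbar K (hVM a c j)) ∧
    ∀ a b pa pb, memPar K ev od a pa → memPar K ev od b pb → ∀ c : Mo,
      ∃ p : Fin (rVV a b) → Fin (rVM a c) → Fin (rVM b c) → Dist2 K Mo,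
        (∀ i j k, IsPow2 K Mo (p i j k)) ∧
        (∀ m k : Idx K,
          lhsXW K V Mo YM a (fun k' => YM b k' c) m k =
            ∑ i, ∑ j, ∑ kk, tripleXW K Mo (-(hVV a b i)) (-(hVM b c kk))
              (-(hVM a c j)) (p i j kk) m k) ∧
        (∀ m k : Idx K,
          YM (Y a m b) k c =
            ∑ i, ∑ j, ∑ kk, tripleWX K Mo (-(hVV a b i)) (-(hVM b c kk))
              (-(hVM a c j)) (p i j kk) m k)

/-- F_Y is multiply local -/
def MultLocalAlg (A : OPEAlg K V) : Prop :=
  ∀ (r : ℕ) (f : Fin r → V) (pf : Fin r → ZMod 2),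
    (∀ i, memPar K A.ev A.od (f i) (pf i)) →
      MultiplyLocal K V (fun i => A.Y (f i)) pf

/-- F_Y is uniformly local -/
def UnifLocalAlg (A : OPEAlg K V) : Prop :=
  ∃ (rr : V → V → ℕ) (hh : ∀ a b : V, Fin (rr a b) → Idx K),
    ∀ (r : ℕ) (f : Fin r → V) (pf : Fin r → ZMod 2),
      (∀ i, memPar K A.ev A.od (f i) (pf i)) →
        ∃ c, IsMultOPE K V (fun i => A.Y (f i)) pf (fun i j => rr (f i) (f j))
            (fun i j => hh (f i) (f j)) c ∧
          ∀ α, IsPowN K V (evN K V (c α) A.one)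

end OPEA
namespace OPEA

set_option linter.unusedSectionVars false

section Basics

variable {K : Type*} [Field K] [CharZero K]

/-- the integral index pair given by a pair of natural numbers -/
def nc (a : ℕ × ℕ) : Idx K := ((a.1 : K), (a.2 : K))

lemma nc_add (a b : ℕ × ℕ) : (nc (a + b) : Idx K) = nc a + nc b := by
  simp [nc]

@[simp] lemma nc_zero : (nc 0 : Idx K) = 0 := by simp [nc]

lemma nc_injective : Function.Injective (nc : ℕ × ℕ → Idx K) := by
  rintro ⟨a, b⟩ ⟨c, d⟩ h
  simpa [nc] using h

@[simp] lemma gchoose_zero (x : K) : gchoose K x 0 = 1 := by simp [gchoose]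

lemma succ_mul_gchoose (x : K) (k : ℕ) :
    ((k : K) + 1) * gchoose K x (k + 1) = (x - k) * gchoose K x k := by
  have h1 : ((k : K) + 1) ≠ 0 := by exact_mod_cast Nat.succ_ne_zero k
  have h2 : (k.factorial : K) ≠ 0 := by exact_mod_cast Nat.factorial_ne_zero k
  simp only [gchoose, Finset.prod_range_succ, Nat.factorial_succ]
  push_cast
  field_simp

lemma gchoose_succ (x : K) (k : ℕ) :
    gchoose K x (k + 1) = (x - k) * gchoose K x k / ((k : K) + 1) := by
  have h1 : ((k : K) + 1) ≠ 0 := by exact_mod_cast Nat.succ_ne_zero k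
  rw [← succ_mul_gchoose]
  field_simp

lemma gchoose_pascal (x : K) (k : ℕ) :
    gchoose K (x + 1) (k + 1) = gchoose K x (k + 1) + gchoose K x k := by
  induction k with
  | zero => simp [gchoose]
  | succ k ih =>
    have h1 : ((k : K) + 1) ≠ 0 := by exact_mod_cast Nat.succ_ne_zero k
    have h2 : ((k : K) + 1 + 1) ≠ 0 := by exact_mod_cast Nat.succ_ne_zero (k + 1)
    rw [gchoose_succ (x + 1), ih, gchoose_succ x (k + 1)]
    have h3 := succ_mul_gchoose x k
    push_cast
    field_simp
    linear_combination (-1 : K) * h3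

/-- Vandermonde's identity -/
lemma gchoose_add (x y : K) (n : ℕ) :
    gchoose K (x + y) n =
      ∑ a ∈ Finset.HasAntidiagonal.antidiagonal n, gchoose K x a.1 * gchoose K y a.2 := by
  induction n with
  | zero => simp
  | succ n ih =>
    have h1 : ((n : K) + 1) ≠ 0 := by exact_mod_cast Nat.succ_ne_zero n
    apply mul_left_cancel₀ h1
    rw [succ_mul_gchoose, ih, Finset.mul_sum, Finset.mul_sum]
    have e1 : ∀ a ∈ Finset.HasAntidiagonal.antidiagonal (n + 1),
        ((n : K) + 1) * (gchoose K x a.1 * gchoose K y a.2) =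
        (a.1 : K) * gchoose K x a.1 * gchoose K y a.2 +
          gchoose K x a.1 * ((a.2 : K) * gchoose K y a.2) := by
      intro a ha
      rw [Finset.HasAntidiagonal.mem_antidiagonal] at ha
      have : (n : K) + 1 = a.1 + a.2 := by exact_mod_cast ha.symm
      rw [this]; ring
    rw [Finset.sum_congr rfl e1, Finset.sum_add_distrib]
    rw [Finset.Nat.sum_antidiagonal_succ, Finset.Nat.sum_antidiagonal_succ']
    simp only [Nat.cast_zero, zero_mul, mul_zero, zero_add, Nat.cast_add, Nat.cast_one]
    rw [← Finset.sum_add_distrib]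
    apply Finset.sum_congr rfl
    intro a ha
    rw [Finset.HasAntidiagonal.mem_antidiagonal] at ha
    have : (n : K) = a.1 + a.2 := by exact_mod_cast ha.symm
    rw [succ_mul_gchoose, succ_mul_gchoose, this]; ring

lemma gchoose_eq_zero_of_lt {n k : ℕ} (h : n < k) : gchoose K (n : K) k = 0 := by
  have : ∏ i ∈ Finset.range k, ((n : K) - i) = 0 :=
    Finset.prod_eq_zero (Finset.mem_range.2 h) (sub_self _)
  simp [gchoose, this]

lemma gchoose_zero_left (k : ℕ) : gchoose K (0 : K) k = if k = 0 then 1 else 0 := by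
  rcases Nat.eq_zero_or_pos k with rfl | h
  · simp
  · rw [if_neg h.ne']
    exact_mod_cast gchoose_eq_zero_of_lt (K := K) h

lemma gchoose_mul_comm (h : K) (i k : ℕ) :
    gchoose K h i * gchoose K (h - i) k = gchoose K h k * gchoose K (h - k) i := by
  have key : ∀ i k : ℕ, gchoose K h i * gchoose K (h - i) k =
      (∏ j ∈ Finset.range (i + k), (h - (j : K))) / (i.factorial * k.factorial) := by
    intro i k
    rw [Finset.prod_range_add]
    simp only [gchoose, Nat.cast_add, sub_sub]
    field_simp
  rw [key, key, add_comm i k, mul_comm (i.factorial : K)]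

lemma gchoose_add_mul (h : K) (i k : ℕ) :
    gchoose K h (i + k) * gchoose K ((i + k : ℕ) : K) k =
      gchoose K h k * gchoose K (h - k) i := by
  have h0 : gchoose K ((i + k : ℕ) : K) k = ((i + k).choose k : K) := by
    have hf : (k.factorial : K) ≠ 0 := by exact_mod_cast Nat.factorial_ne_zero k
    rw [gchoose, div_eq_iff hf]
    have hle : ∀ j ∈ Finset.range k, (((i + k : ℕ) : K) - j) = (((i + k) - j : ℕ) : K) := by
      intro j hj
      rw [Finset.mem_range] at hj
      rw [Nat.cast_sub (by omega)]
    rw [Finset.prod_congr rfl hle]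
    rw [← Nat.cast_prod, ← Nat.descFactorial_eq_prod_range, Nat.descFactorial_eq_factorial_mul_choose]
    push_cast; ring
  have h1 : ((i + k).choose k : K) = (i + k).factorial / (i.factorial * k.factorial) := by
    rw [Nat.add_choose, Nat.cast_div (Nat.factorial_mul_factorial_dvd_factorial_add i k)]
    · push_cast; rfl
    · exact_mod_cast mul_ne_zero (Nat.factorial_ne_zero i) (Nat.factorial_ne_zero k)
  have h2 : ((i + k).factorial : K) ≠ 0 := by exact_mod_cast Nat.factorial_ne_zero _
  rw [h0, h1]
  simp only [gchoose]
  rw [add_comm i k, Finset.prod_range_add]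
  simp only [Nat.cast_add, sub_sub]
  rw [add_comm k i]
  field_simp

lemma negOnePow_intCast (k : ℤ) : negOnePow K (k : K) = (-1 : K) ^ k := by
  have h : ∃ j : ℤ, (j : K) = (k : K) := ⟨k, rfl⟩
  rw [negOnePow, dif_pos h]
  congr 1
  exact_mod_cast h.choose_spec

lemma negOnePow_add {x y : K} (hx : IsInt K x) (hy : IsInt K y) :
    negOnePow K (x + y) = negOnePow K x * negOnePow K y := by
  obtain ⟨a, rfl⟩ := hx
  obtain ⟨b, rfl⟩ := hy
  rw [← Int.cast_add, negOnePow_intCast, negOnePow_intCast, negOnePow_intCast, zpow_add₀ (by simp)]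

@[simp] lemma negOnePow_zero : negOnePow K (0 : K) = 1 := by
  simpa using negOnePow_intCast (K := K) 0

lemma negOnePow_mul_self {x : K} : negOnePow K x * negOnePow K x = 1 := by
  by_cases h : ∃ k : ℤ, (k : K) = x
  · obtain ⟨k, rfl⟩ := h
    rw [negOnePow_intCast, ← mul_zpow]; simp
  · simp [negOnePow, dif_neg h]

lemma negOnePow_nc (l : ℕ × ℕ) :
    negOnePow K ((nc l : Idx K).1 - (nc l : Idx K).2) = (-1 : K) ^ (l.1 + l.2) := by
  have : ((nc l : Idx K).1 - (nc l : Idx K).2) = (((l.1 : ℤ) - (l.2 : ℤ) : ℤ) : K) := by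
    simp [nc]
  rw [this, negOnePow_intCast, zpow_sub₀ (by simp), pow_add, zpow_natCast, zpow_natCast]
  rcases neg_one_pow_eq_or K l.2 with h | h <;> simp [h, div_neg]

lemma IsInt.add {x y : K} (hx : IsInt K x) (hy : IsInt K y) : IsInt K (x + y) := by
  obtain ⟨a, rfl⟩ := hx
  obtain ⟨b, rfl⟩ := hy
  exact ⟨a + b, by push_cast; rfl⟩

lemma IsInt.neg {x : K} (hx : IsInt K x) : IsInt K (-x) := by
  obtain ⟨a, rfl⟩ := hx
  exact ⟨-a, by push_cast; rfl⟩

lemma Kbar.add {x y : Idx K} (hx : Kbar K x) (hy : Kbar K y) : Kbar K (x + y) := by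
  have := IsInt.add hx hy
  rwa [sub_add_sub_comm] at this

lemma Kbar.neg {x : Idx K} (hx : Kbar K x) : Kbar K (-x) := by
  have := IsInt.neg hx
  rwa [neg_sub'] at this

lemma Kbar_nc (l : ℕ × ℕ) : Kbar K (nc l) :=
  ⟨(l.1 : ℤ) - l.2, by simp [nc]⟩

lemma Kbar_zero : Kbar K (0 : Idx K) := ⟨0, by simp⟩

/-- product of the binomial coefficients in both components -/
def C2 (x : Idx K) (e : ℕ × ℕ) : K := gchoose K x.1 e.1 * gchoose K x.2 e.2

lemma C2_mul_comm (h : Idx K) (i k : ℕ × ℕ) :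
    C2 h i * C2 (h - nc i) k = C2 h k * C2 (h - nc k) i := by
  simp only [C2, nc, Prod.fst_sub, Prod.snd_sub]
  linear_combination gchoose K h.2 i.2 * gchoose K (h.2 - i.2) k.2 * gchoose_mul_comm h.1 i.1 k.1
    + gchoose K h.1 k.1 * gchoose K (h.1 - k.1) i.1 * gchoose_mul_comm h.2 i.2 k.2

lemma C2_add_mul (h : Idx K) (i k : ℕ × ℕ) :
    C2 h (i + k) * C2 (nc (i + k)) k = C2 h k * C2 (h - nc k) i := by
  have h1 := gchoose_add_mul h.1 i.1 k.1
  have h2 := gchoose_add_mul h.2 i.2 k.2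
  simp only [C2, nc, Prod.fst_sub, Prod.snd_sub, Prod.fst_add, Prod.snd_add]
  linear_combination gchoose K h.2 (i.2 + k.2) * gchoose K ((i.2 + k.2 : ℕ) : K) k.2 * h1
    + gchoose K h.1 k.1 * gchoose K (h.1 - k.1) i.1 * h2

lemma C2_add (x y : Idx K) (n : ℕ × ℕ) :
    C2 (x + y) n = ∑ a ∈ Finset.Iic n, C2 x a * C2 y (n - a) := by
  have h1 : ∀ (x y : K) (n : ℕ), gchoose K (x + y) n =
      ∑ a ∈ Finset.Iic n, gchoose K x a * gchoose K y (n - a) := by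
    intro x y n
    rw [gchoose_add, Finset.Nat.sum_antidiagonal_eq_sum_range_succ
      (fun a b => gchoose K x a * gchoose K y b), Nat.range_succ_eq_Iic]
  have h2 : Finset.Iic n = Finset.Iic n.1 ×ˢ Finset.Iic n.2 := by
    ext a; simp [Prod.le_def]
  rw [h2, Finset.sum_product]
  simp only [C2, Prod.fst_add, Prod.snd_add, h1, Prod.fst_sub, Prod.snd_sub]
  rw [Finset.sum_mul_sum]
  apply Finset.sum_congr rfl
  intro a _
  apply Finset.sum_congr rfl
  intro b _
  ring

lemma C2_nc_eq_zero {a e : ℕ × ℕ} (h : ¬ e ≤ a) : C2 (nc a : Idx K) e = 0 := by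
  rw [Prod.le_def, not_and_or, not_le, not_le] at h
  rcases h with h | h
  · simp [C2, nc, gchoose_eq_zero_of_lt h]
  · simp [C2, nc, gchoose_eq_zero_of_lt h]

lemma C2_zero_left (k : ℕ × ℕ) : C2 (0 : Idx K) k = if k = 0 then 1 else 0 := by
  rcases k with ⟨a, b⟩
  simp only [C2, Prod.fst_zero, Prod.snd_zero, gchoose_zero_left, Prod.mk_eq_zero]
  by_cases ha : a = 0 <;> by_cases hb : b = 0 <;> simp [ha, hb]

end Basics

section Kernels

variable {K : Type*} [Field K] [CharZero K] {M : Type*} [AddCommGroup M] [Module K M]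

/-- extension by zero of a function on the natural numbers to `K` -/
def natFn (f : ℕ → K) (x : K) : K := if h : ∃ i : ℕ, (i : K) = x then f h.choose else 0

lemma natFn_cast (f : ℕ → K) (i : ℕ) : natFn f (i : K) = f i := by
  have h : ∃ j : ℕ, (j : K) = (i : K) := ⟨i, rfl⟩
  rw [natFn, dif_pos h]
  congr 1
  exact_mod_cast h.choose_spec

lemma natFn_of_not {f : ℕ → K} {x : K} (h : ¬ ∃ i : ℕ, (i : K) = x) : natFn f x = 0 :=
  dif_neg h

lemma natFn_sub_one (f : ℕ → K) (x : K) :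
    natFn f (x - 1) = natFn (fun i => Nat.casesOn i 0 f) x := by
  by_cases h : ∃ i : ℕ, (i : K) = x
  · obtain ⟨i, rfl⟩ := h
    rw [natFn_cast]
    rcases i with _ | i
    · refine natFn_of_not ?_
      rintro ⟨j, hj⟩
      have : ((j + 1 : ℕ) : K) = ((0 : ℕ) : K) := by push_cast at hj ⊢; rw [hj]; ring
      exact absurd (Nat.cast_injective this) (Nat.succ_ne_zero j)
    · simp [natFn_cast]
  · rw [natFn_of_not h, natFn_of_not]
    rintro ⟨j, hj⟩
    exact h ⟨j + 1, by push_cast; rw [hj]; ring⟩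

lemma natFn_eq_of (f g u : ℕ → K) (x : K) (h : ∀ i, f i = g i - u i) :
    natFn f x = natFn g x - natFn u x := by
  by_cases hx : ∃ i : ℕ, (i : K) = x
  · obtain ⟨i, rfl⟩ := hx
    simp [natFn_cast, h]
  · simp [natFn_of_not hx]

/-- kernels satisfying the recursion of Pascal's triangle -/
def IsPascal (ε : K → K → K) : Prop := ∀ e y, ε e (y + 1) = ε e y - ε (e + 1) y

/-- the kernel of the expansion of `(z - w) ^ e` in the domain `z > w` -/
def expKer (m e y : K) : K := natFn (fun i => (-1) ^ i * gchoose K e i) (m - y)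

lemma expKer_pascal (m : K) : IsPascal (expKer m) := by
  intro e y
  have : m - (y + 1) = m - y - 1 := by ring
  rw [expKer, this, natFn_sub_one]
  apply natFn_eq_of
  rintro (_ | i)
  · simp
  · simp only [gchoose_pascal, pow_succ]; ring

lemma pascal_expand (b : ℕ) : ∃ d : ℕ →₀ K, ∀ ε : K → K → K, IsPascal ε → ∀ e Y,
    ε e (Y + b) = d.sum fun l c => c * ε (e + l) Y := by
  induction b with
  | zero => exact ⟨Finsupp.single 0 1, fun ε _ e Y => by simp⟩
  | succ b ih =>
    obtain ⟨d, hd⟩ := ih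
    refine ⟨d - d.mapDomain Nat.succ, fun ε hε e Y => ?_⟩
    rw [Finsupp.sum_sub_index (by intros; ring), Finsupp.sum_mapDomain_index (by simp)
      (by intros; ring)]
    have : Y + ((b + 1 : ℕ) : K) = Y + b + 1 := by push_cast; ring
    rw [this, hε, hd ε hε, hd ε hε]
    congr 1
    apply Finsupp.sum_congr
    intro l _
    push_cast
    congr 2
    ring

lemma eq_zero_of_gchoose_sum (w : K →₀ M)
    (h : ∀ j, (w.sum fun x u => gchoose K x j • u) = 0) : w = 0 := by
  have h1 : ∀ n j : ℕ, (w.sum fun x u => (x ^ n * gchoose K x j) • u) = 0 := by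
    intro n
    induction n with
    | zero => simpa using h
    | succ n ih =>
      intro j
      have e1 : (w.sum fun x u => (x ^ (n + 1) * gchoose K x j) • u) =
          ((j : K) + 1) • (w.sum fun x u => (x ^ n * gchoose K x (j + 1)) • u) +
          (j : K) • (w.sum fun x u => (x ^ n * gchoose K x j) • u) := by
        rw [Finsupp.smul_sum, Finsupp.smul_sum, ← Finsupp.sum_add]
        apply Finsupp.sum_congr
        intro x _
        rw [smul_smul, smul_smul, ← add_smul]
        congr 1
        have := succ_mul_gchoose x j
        rw [pow_succ]
        linear_combination (- x ^ n) * this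
      rw [e1, ih, ih, smul_zero, smul_zero, add_zero]
  have h2 : ∀ P : Polynomial K, (w.sum fun x u => (P.eval x) • u) = 0 := by
    intro P
    induction P using Polynomial.induction_on' with
    | add p q hp hq =>
      simp only [Polynomial.eval_add, add_smul]
      rw [Finsupp.sum_add, hp, hq, add_zero]
    | monomial n a =>
      have := h1 n 0
      simp only [gchoose_zero, mul_one] at this
      simp only [Polynomial.eval_monomial, mul_smul]
      rw [← Finsupp.smul_sum, this, smul_zero]
  by_contra hw
  obtain ⟨x0, hx0⟩ := Finsupp.ne_iff.1 hw
  have hm : x0 ∈ w.support := by simpa using hx0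
  have h3 := h2 (∏ x ∈ w.support.erase x0, (Polynomial.X - Polynomial.C x))
  rw [Finsupp.sum, Finset.sum_eq_single_of_mem x0 hm] at h3
  · rw [smul_eq_zero] at h3
    rcases h3 with h3 | h3
    · rw [Polynomial.eval_prod, Finset.prod_eq_zero_iff] at h3
      obtain ⟨x, hx, h4⟩ := h3
      rw [Finset.mem_erase] at hx
      simp only [Polynomial.eval_sub, Polynomial.eval_X, Polynomial.eval_C] at h4
      exact hx.1 (sub_eq_zero.1 h4).symm
    · exact hx0 (by simpa using h3)
  · intro x hx hne
    rw [Polynomial.eval_prod, Finset.prod_eq_zero (Finset.mem_erase.2 ⟨hne, hx⟩) (by simp),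
      zero_smul]

/-- a representative of the class of `x` modulo the integers -/
def intRep (x : K) : K :=
  (Quotient.out (QuotientAddGroup.mk x : K ⧸ (Int.castAddHom K).range))

lemma intRep_spec (x : K) : IsInt K (x - intRep x) := by
  have : (QuotientAddGroup.mk (intRep x) : K ⧸ (Int.castAddHom K).range) =
      QuotientAddGroup.mk x := Quotient.out_eq _
  rw [QuotientAddGroup.eq] at this
  obtain ⟨k, hk⟩ := this
  exact ⟨k, by rw [← neg_add_eq_sub]; exact hk⟩

lemma intRep_eq {x y : K} (h : IsInt K (y - x)) : intRep x = intRep y := by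
  have : (QuotientAddGroup.mk x : K ⧸ (Int.castAddHom K).range) = QuotientAddGroup.mk y := by
    rw [QuotientAddGroup.eq]
    obtain ⟨k, hk⟩ := h
    exact ⟨k, by rw [neg_add_eq_sub]; exact hk⟩
  rw [intRep, this, intRep]

/-- an extension of the sign `(-1) ^ k` to all of `K` -/
def signChar (x : K) : K := negOnePow K (x - intRep x)

lemma signChar_add_int {x k : K} (hk : IsInt K k) :
    signChar (x + k) = signChar x * negOnePow K k := by
  have : intRep x = intRep (x + k) := intRep_eq (by simpa using hk)
  rw [signChar, ← this, signChar, ← negOnePow_add (intRep_spec x) hk]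
  congr 1; ring

lemma negOnePow_one : negOnePow K (1 : K) = -1 := by
  simpa using negOnePow_intCast (K := K) 1

lemma isInt_one : IsInt K (1 : K) := ⟨1, by simp⟩

lemma signChar_mul {x y : K} (h : IsInt K (x - y)) :
    signChar x * signChar y = negOnePow K (x - y) := by
  have : x = y + (x - y) := by ring
  conv_lhs => rw [this]
  rw [signChar_add_int h, mul_right_comm, signChar, negOnePow_mul_self, one_mul]

lemma pascal_ker_zero {τ : Type*} [Fintype τ] (e y : τ → K) (v : τ → M)
    (h : ∀ m, ∑ t, expKer m (e t) (y t) • v t = 0) (ε : K → K → K) (hε : IsPascal ε) :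
    ∑ t, ε (e t) (y t) • v t = 0 := by
  obtain ⟨Y, b, hY, hint⟩ : ∃ (Y : τ → K) (b : τ → ℕ), (∀ t, y t = Y t + b t) ∧
      ∀ t t', IsInt K (Y t - Y t') → Y t = Y t' := by
    choose k hk using fun t => intRep_spec (y t)
    let N : ℕ := ∑ t, (k t).natAbs
    have hN : ∀ t, 0 ≤ k t + N := by
      intro t
      have : (k t).natAbs ≤ N :=
        Finset.single_le_sum (f := fun t => (k t).natAbs) (fun _ _ => Nat.zero_le _)
          (Finset.mem_univ t)
      omega
    refine ⟨fun t => intRep (y t) - N, fun t => (k t + N).toNat, fun t => ?_, fun t t' h => ?_⟩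
    · have : (((k t + N).toNat : ℤ) : K) = k t + N := by
        rw [Int.toNat_of_nonneg (hN t)]; push_cast; rfl
      rw [Int.cast_natCast] at this
      rw [this, hk]; ring
    · have h1 : IsInt K (y t' - y t) := by
        have h2 := (IsInt.add (intRep_spec (y t)) h).add (intRep_spec (y t')).neg |>.neg
        convert h2 using 1; ring
      simp only [intRep_eq h1]
  choose d hd using fun b => pascal_expand (K := K) b
  have hcl : ∀ Y0 ∈ Finset.univ.image Y,
      ∑ t ∈ Finset.univ.filter (fun t => Y t = Y0), ε (e t) (y t) • v t = 0 := by
    intro Y0 hY0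
    obtain ⟨t0, -, ht0⟩ := Finset.mem_image.1 hY0
    let W : K →₀ M := ∑ t ∈ Finset.univ.filter (fun t => Y t = Y0),
      (d (b t)).sum fun l c => Finsupp.single (e t + l) (c • v t)
    have hW : ∀ ε : K → K → K, IsPascal ε →
        ∑ t ∈ Finset.univ.filter (fun t => Y t = Y0), ε (e t) (y t) • v t =
        W.sum fun x u => ε x Y0 • u := by
      intro ε hε
      rw [← Finsupp.sum_finsetSum_index (by simp) (by simp)]
      apply Finset.sum_congr rfl
      intro t ht
      rw [Finset.mem_filter] at ht
      rw [hY, ht.2, hd _ ε hε, Finsupp.sum_sum_index (by simp) (by simp), Finsupp.sum, Finset.sum_smul,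
        Finsupp.sum]
      apply Finset.sum_congr rfl
      intro l _
      rw [Finsupp.sum_single_index (by simp), smul_smul, mul_comm]
    have hW0 : W = 0 := by
      apply eq_zero_of_gchoose_sum
      intro j
      have h1 := h (Y0 + j)
      rw [← Finset.sum_filter_add_sum_filter_not Finset.univ (fun t => Y t = Y0),
        hW _ (expKer_pascal _), Finset.sum_eq_zero (s := Finset.univ.filter (fun t => ¬ Y t = Y0)),
        add_zero] at h1
      · have h2 : ((-1 : K) ^ j) • (W.sum fun x u => gchoose K x j • u) = 0 := by
          rw [← h1, Finsupp.smul_sum]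
          apply Finsupp.sum_congr
          intro x _
          rw [expKer, add_sub_cancel_left, natFn_cast, smul_smul]
        rcases neg_one_pow_eq_or K j with h3 | h3 <;> rw [h3] at h2 <;> simpa using h2
      · intro t ht
        rw [Finset.mem_filter] at ht
        rw [expKer, natFn_of_not, zero_smul]
        rintro ⟨i, hi⟩
        apply ht.2
        rw [← ht0]
        apply hint
        refine ⟨(j : ℤ) - b t - i, ?_⟩
        push_cast
        rw [hi, hY, ht0]; ring
    rw [hW ε hε, hW0, Finsupp.sum_zero_index]
  rw [← Finset.sum_fiberwise_of_maps_to (s := Finset.univ) (t := Finset.univ.image Y) (g := Y)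
    (fun t _ => Finset.mem_image_of_mem _ (Finset.mem_univ t))]
  exact Finset.sum_eq_zero hcl

lemma pascal_ker_zero₂ {τ : Type*} [Fintype τ] (e y : τ → Idx K) (v : τ → M)
    (h : ∀ m : Idx K,
      ∑ t, (expKer m.1 (e t).1 (y t).1 * expKer m.2 (e t).2 (y t).2) • v t = 0)
    (ε ε' : K → K → K) (hε : IsPascal ε) (hε' : IsPascal ε') :
    ∑ t, (ε (e t).1 (y t).1 * ε' (e t).2 (y t).2) • v t = 0 := by
  have h1 : ∀ m2, ∑ t, ε (e t).1 (y t).1 • (expKer m2 (e t).2 (y t).2 • v t) = 0 := by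
    intro m2
    apply pascal_ker_zero _ _ _ _ ε hε
    intro m
    simpa only [smul_smul] using h (m, m2)
  have h2 := pascal_ker_zero (fun t => (e t).2) (fun t => (y t).2)
    (fun t => ε (e t).1 (y t).1 • v t) (fun m => by
      rw [← h1 m]
      exact Finset.sum_congr rfl fun t _ => smul_comm _ _ _) ε' hε'
  rw [← h2]
  exact Finset.sum_congr rfl fun t _ => by rw [smul_smul, mul_comm]

end Kernels

section TwoVar

variable {K : Type*} [Field K] [CharZero K] {M : Type*} [AddCommGroup M] [Module K M]

lemma finsum_of_injective {α β : Type*} {f : α → β} (hf : Function.Injective f) (g : β → M)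
    (h : ∀ b, b ∉ Set.range f → g b = 0) : ∑ᶠ b, g b = ∑ᶠ a, g (f a) := by
  rw [← finsum_mem_range hf, ← finsum_mem_univ, ← finsum_mem_inter_support g (Set.range f),
    ← finsum_mem_inter_support g Set.univ]
  have : Set.univ ∩ Function.support g = Set.range f ∩ Function.support g := by
    ext b
    simp only [Set.univ_inter, Set.mem_inter_iff, Function.mem_support]
    exact ⟨fun hb => ⟨by_contra fun h' => hb (h b h'), hb⟩, fun hb => hb.2⟩
  rw [this]

lemma exists_ne_zero_of_finsum {α : Type*} {f : α → M} (h : ∑ᶠ a, f a ≠ 0) : ∃ a, f a ≠ 0 := by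
  by_contra! h'
  exact h (by simp [h'])

lemma finite_nc_add (X : Idx K) : {i : ℕ × ℕ | ∃ j, (nc i : Idx K) + nc j = X}.Finite := by
  by_cases h : ∃ i j : ℕ × ℕ, (nc i : Idx K) + nc j = X
  · obtain ⟨i0, j0, rfl⟩ := h
    apply (Set.finite_Iic (i0 + j0)).subset
    rintro i ⟨j, hj⟩
    rw [← nc_add, ← nc_add] at hj
    rw [Set.mem_Iic, ← nc_injective hj]
    exact le_self_add
  · convert Set.finite_empty
    ext i
    simp only [Set.mem_ofPred_eq, Set.mem_empty_iff_false, iff_false]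
    exact fun ⟨j, hj⟩ => h ⟨i, j, hj⟩

lemma negInt_pair_iff (n m : Idx K) :
    (IsNegInt K (n.1 - m.1) ∧ IsNegInt K (n.2 - m.2)) ↔ ∃ i : ℕ × ℕ, n = m - 1 - nc i := by
  have key : ∀ a b : K, IsNegInt K (a - b) ↔ ∃ i : ℕ, a = b - 1 - i := by
    intro a b
    constructor
    · rintro ⟨k, hk, h⟩
      refine ⟨(-k - 1).toNat, ?_⟩
      have : (((-k - 1).toNat : ℤ) : K) = -k - 1 := by
        rw [Int.toNat_of_nonneg (by omega)]; push_cast; rfl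
      rw [Int.cast_natCast] at this
      rw [this, h]; ring
    · rintro ⟨i, rfl⟩
      exact ⟨-1 - i, by omega, by push_cast; ring⟩
  rw [key, key]
  constructor
  · rintro ⟨⟨i, hi⟩, ⟨j, hj⟩⟩
    exact ⟨(i, j), Prod.ext hi hj⟩
  · rintro ⟨i, rfl⟩
    exact ⟨⟨i.1, rfl⟩, ⟨i.2, rfl⟩⟩

lemma negInt_pair_iff' (n : Idx K) :
    (IsNegInt K n.1 ∧ IsNegInt K n.2) ↔ ∃ i : ℕ × ℕ, n = - 1 - nc i := by
  have := negInt_pair_iff n 0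
  simpa using this

lemma inLat1_iff (a : Dist1 K M) : InLat1 K M a ↔ ∃ S : Finset (Idx K), ∀ n, a n ≠ 0 →
    ∃ m ∈ S, ∃ i : ℕ × ℕ, n = m - nc i := by
  constructor
  · rintro ⟨S, hS⟩
    refine ⟨S.image (fun m => m - 1), fun n hn => ?_⟩
    obtain ⟨m, hm, h⟩ := hS n hn
    exact ⟨m - 1, Finset.mem_image_of_mem _ hm, (negInt_pair_iff _ _).1 h⟩
  · rintro ⟨S, hS⟩
    refine ⟨S.image (fun m => m + 1), fun n hn => ?_⟩
    obtain ⟨m, hm, h⟩ := hS n hn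
    exact ⟨m + 1, Finset.mem_image_of_mem _ hm, (negInt_pair_iff _ _).2 (by simpa using h)⟩

lemma inLat2_iff (a : Dist2 K M) : InLat2 K M a ↔ ∃ S : Finset (Idx K × Idx K), ∀ n k, a n k ≠ 0 →
    ∃ m ∈ S, ∃ i j : ℕ × ℕ, n = m.1 - nc i ∧ k = m.2 - nc j := by
  constructor
  · rintro ⟨S, hS⟩
    refine ⟨S.image (fun m => m - 1), fun n k hn => ?_⟩
    obtain ⟨m, hm, h, h'⟩ := hS n k hn
    obtain ⟨i, hi⟩ := (negInt_pair_iff _ _).1 h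
    obtain ⟨j, hj⟩ := (negInt_pair_iff _ _).1 h'
    exact ⟨m - 1, Finset.mem_image_of_mem _ hm, i, j, hi, hj⟩
  · rintro ⟨S, hS⟩
    refine ⟨S.image (fun m => m + 1), fun n k hn => ?_⟩
    obtain ⟨m, hm, i, j, hi, hj⟩ := hS n k hn
    exact ⟨m + 1, Finset.mem_image_of_mem _ hm, (negInt_pair_iff _ _).2 ⟨i, by simpa using hi⟩,
      (negInt_pair_iff _ _).2 ⟨j, by simpa using hj⟩⟩

lemma inLatN_iff {r : ℕ} (a : DistN K M r) : InLatN K M a ↔ ∃ S : Finset (Fin r → Idx K),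
    ∀ n, a n ≠ 0 → ∃ m ∈ S, ∃ k : Fin r → ℕ × ℕ, ∀ i, n i = m i - nc (k i) := by
  constructor
  · rintro ⟨S, hS⟩
    refine ⟨S.image (fun m => m - 1), fun n hn => ?_⟩
    obtain ⟨m, hm, h⟩ := hS n hn
    choose k hk using fun i => (negInt_pair_iff _ _).1 (h i)
    exact ⟨m - 1, Finset.mem_image_of_mem _ hm, k, hk⟩
  · rintro ⟨S, hS⟩
    refine ⟨S.image (fun m => m + 1), fun n hn => ?_⟩
    obtain ⟨m, hm, k, hk⟩ := hS n hn
    exact ⟨m + 1, Finset.mem_image_of_mem _ hm, fun i => (negInt_pair_iff _ _).2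
      ⟨k i, by simpa using hk i⟩⟩

lemma InLat2.finite_line {c : Dist2 K M} (hc : InLat2 K M c) (T : Idx K) :
    (Function.support fun x => c x (T - x)).Finite := by
  obtain ⟨S, hS⟩ := (inLat2_iff c).1 hc
  refine (Set.Finite.biUnion S.finite_toSet fun s _ =>
    (finite_nc_add (s.1 + s.2 - T)).image fun i => s.1 - nc i).subset ?_
  intro x hx
  obtain ⟨s, hs, i, j, hi, hj⟩ := hS _ _ hx
  simp only [Set.mem_iUnion]
  refine ⟨s, hs, i, ⟨j, ?_⟩, hi.symm⟩
  rw [hi] at hj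
  linear_combination hj

/-- the kernel of the expansion of `(𝐳-𝐰)^e` for `z > w` -/
def expKer₂ (m e y : Idx K) : K := expKer m.1 e.1 y.1 * expKer m.2 e.2 y.2

lemma expKer₂_nc (m e : Idx K) (i : ℕ × ℕ) :
    expKer₂ m e (m - nc i) = (-1) ^ (i.1 + i.2) * C2 e i := by
  simp only [expKer₂, expKer, Prod.fst_sub, Prod.snd_sub, sub_sub_cancel, nc, natFn_cast, C2]
  ring

lemma expKer₂_of_not {m e y : Idx K} (h : ∀ i, y ≠ m - nc i) : expKer₂ m e y = 0 := by
  by_cases h1 : ∃ i : ℕ, (i : K) = m.1 - y.1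
  · by_cases h2 : ∃ i : ℕ, (i : K) = m.2 - y.2
    · obtain ⟨i, hi⟩ := h1
      obtain ⟨j, hj⟩ := h2
      exact absurd (Prod.ext (by simp [nc, hi]) (by simp [nc, hj])) (h (i, j))
    · simp [expKer₂, expKer, natFn_of_not h2]
  · simp [expKer₂, expKer, natFn_of_not h1]

lemma zwPow_eq (E : Idx K) (c : Dist2 K M) (m k : Idx K) :
    zwPow K M E c m k = ∑ᶠ x, expKer₂ m E (x - E) • c x (m + k + E - x) := by
  rw [finsum_of_injective (f := fun i : ℕ × ℕ => m + E - nc i)]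
  · unfold zwPow
    apply finsum_congr
    intro i
    have : m + E - nc i - E = m - nc i := by ring
    rw [this, expKer₂_nc, C2, mul_assoc]
    congr 2
    ext <;> simp [nc] <;> ring
  · intro i j h
    exact nc_injective (sub_right_injective h)
  · intro x hx
    rw [expKer₂_of_not, zero_smul]
    intro i hi
    exact hx ⟨i, by linear_combination -hi⟩

lemma sum_kernel_zero {τ : Type*} [Fintype τ] {c : τ → Dist2 K M} (h : τ → Idx K)
    (hc : ∀ b T, (Function.support fun x => c b x (T - x)).Finite) (T : Idx K)
    (h0 : ∀ m, ∑ b, zwPow K M (-h b) (c b) m (T - m) = 0)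
    (ε ε' : K → K → K) (hε : IsPascal ε) (hε' : IsPascal ε') :
    ∑ b, ∑ᶠ x : Idx K, (ε (-(h b).1) (x.1 + (h b).1) * ε' (-(h b).2) (x.2 + (h b).2)) •
      c b x (T - h b - x) = 0 := by
  have hfin := fun b => hc b (T - h b)
  have conv : ∀ f : τ → Idx K → K, ∑ b, ∑ᶠ x : Idx K, f b x • c b x (T - h b - x) =
      ∑ p : Σ b, (hfin b).toFinset, f p.1 p.2 • c p.1 p.2 (T - h p.1 - p.2) := by
    intro f
    rw [Fintype.sum_sigma]
    apply Finset.sum_congr rfl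
    intro b _
    rw [finsum_eq_sum_of_support_subset (s := (hfin b).toFinset)]
    · rw [← Finset.sum_coe_sort]
    · rw [Set.Finite.coe_toFinset]
      intro x hx
      exact right_ne_zero_of_smul hx
  rw [conv fun b x => ε (-(h b).1) (x.1 + (h b).1) * ε' (-(h b).2) (x.2 + (h b).2)]
  refine pascal_ker_zero₂ (fun p : Σ b, (hfin b).toFinset => -h p.1) (fun p => (p.2 : Idx K) + h p.1)
    (fun p => c p.1 p.2 (T - h p.1 - p.2)) ?_ ε ε' hε hε'
  intro m
  rw [← h0 m]
  simp_rw [zwPow_eq]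
  have := (conv fun b x => expKer₂ m (-h b) (x - -h b)).symm
  simp only [sub_neg_eq_add, expKer₂] at this ⊢
  simp only [add_sub_cancel, ← sub_eq_add_neg]
  exact this

/-- `binomial coefficient` with an exponent in `K²`, zero unless it is a pair of naturals -/
def C2K (x E : Idx K) : K := natFn (gchoose K x.1) E.1 * natFn (gchoose K x.2) E.2

lemma C2K_nc (x : Idx K) (e : ℕ × ℕ) : C2K x (nc e) = C2 x e := by
  simp [C2K, nc, natFn_cast, C2]

lemma C2K_of_not {E : Idx K} (x : Idx K) (h : ∀ e, nc e ≠ E) : C2K x E = 0 := by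
  by_cases h1 : ∃ i : ℕ, (i : K) = E.1
  · by_cases h2 : ∃ i : ℕ, (i : K) = E.2
    · obtain ⟨i, hi⟩ := h1
      obtain ⟨j, hj⟩ := h2
      exact absurd (Prod.ext hi hj) (h (i, j))
    · simp [C2K, natFn_of_not h2]
  · simp [C2K, natFn_of_not h1]

/-- restriction of `∂^(E)` in the first variable pair to the diagonal -/
def diagD (E : Idx K) (c : Dist2 K M) : Dist1 K M :=
  fun n => ∑ᶠ x : Idx K, C2K (-x - 1) E • c x (n - E - 1 - x)

lemma d1z_iterate (j : ℕ) (c : Dist2 K M) (n k : Idx K) :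
    ((d1z K M)^[j] c) n k = ((-1) ^ j * ∏ i ∈ Finset.range j, (n.1 - (i : K))) •
      c (n.1 - j, n.2) k := by
  induction j generalizing n with
  | zero => simp
  | succ j ih =>
    rw [Function.iterate_succ_apply', d1z, ih, smul_smul, Finset.prod_range_succ', pow_succ]
    have : n.1 - 1 - (j : K) = n.1 - ((j + 1 : ℕ) : K) := by push_cast; ring
    simp only [this]
    congr 1
    have : ∀ i : ℕ, n.1 - 1 - (i : K) = n.1 - ((i + 1 : ℕ) : K) := by intro i; push_cast; ring
    simp only [this]
    push_cast; ring

lemma d1zb_iterate (j : ℕ) (c : Dist2 K M) (n k : Idx K) :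
    ((d1zb K M)^[j] c) n k = ((-1) ^ j * ∏ i ∈ Finset.range j, (n.2 - (i : K))) •
      c (n.1, n.2 - j) k := by
  induction j generalizing n with
  | zero => simp
  | succ j ih =>
    rw [Function.iterate_succ_apply', d1zb, ih, smul_smul, Finset.prod_range_succ', pow_succ]
    have : n.2 - 1 - (j : K) = n.2 - ((j + 1 : ℕ) : K) := by push_cast; ring
    simp only [this]
    congr 1
    have : ∀ i : ℕ, n.2 - 1 - (i : K) = n.2 - ((i + 1 : ℕ) : K) := by intro i; push_cast; ring
    simp only [this]
    push_cast; ring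

lemma dPow_natCast {A : Type*} [AddCommGroup A] [Module K A] (d : A → A) (j : ℕ) (a : A) :
    dPow K d (j : K) a = ((j.factorial : K))⁻¹ • d^[j] a := by
  have h : ∃ i : ℕ, (i : K) = (j : K) := ⟨j, rfl⟩
  have h2 : h.choose = j := by exact_mod_cast h.choose_spec
  rw [dPow, dif_pos h, h2]

lemma dPow_of_not {A : Type*} [AddCommGroup A] [Module K A] {d : A → A} {x : K} {a : A}
    (h : ¬ ∃ j : ℕ, (j : K) = x) : dPow K d x a = 0 := dif_neg h

lemma gchoose_neg (x : K) (j : ℕ) : gchoose K (-x - 1) j = (-1) ^ j * gchoose K (x + j) j := by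
  simp only [gchoose]
  rw [← Finset.prod_range_reflect, mul_div_assoc']
  congr 1
  rw [← Finset.card_range j, ← Finset.prod_const, Finset.card_range, ← Finset.prod_mul_distrib]
  apply Finset.prod_congr rfl
  intro i hi
  rw [Finset.mem_range] at hi
  rw [Nat.sub_sub, Nat.cast_sub (by omega)]
  push_cast; ring

lemma ddPow2_nc (e : ℕ × ℕ) (c : Dist2 K M) (n k : Idx K) :
    ddPow2 K M (nc e) c n k = ((-1) ^ (e.1 + e.2) * C2 n e) • c (n - nc e) k := by
  simp only [ddPow2, nc, dPow_natCast, Pi.smul_apply, d1z_iterate, d1zb_iterate, C2, gchoose,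
    smul_smul]
  congr 1
  rw [pow_add]
  field_simp

lemma diag_ddPow2 (E : Idx K) (c : Dist2 K M) (n : Idx K) :
    diag K M (ddPow2 K M E c) n = diagD E c n := by
  by_cases h : ∃ e : ℕ × ℕ, nc e = E
  · obtain ⟨e, rfl⟩ := h
    unfold diag diagD
    simp only [ddPow2_nc]
    rw [← finsum_comp_equiv (Equiv.addRight (nc e : Idx K))]
    apply finsum_congr
    intro x
    simp only [Equiv.coe_addRight, add_sub_cancel_right, C2K_nc]
    congr 1
    · simp only [C2, Prod.fst_sub, Prod.snd_sub, Prod.fst_neg, Prod.snd_neg, Prod.fst_one,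
        Prod.snd_one, gchoose_neg, Prod.fst_add, Prod.snd_add, nc]
      ring
    · congr 1
      ext <;> simp <;> ring
  · have h' : ∀ e, nc e ≠ E := fun e he => h ⟨e, he⟩
    have h1 : diagD E c n = 0 := by
      simp [diagD, C2K_of_not _ h']
    have h2 : ddPow2 K M E c = 0 := by
      by_cases h1 : ∃ i : ℕ, (i : K) = E.1
      · by_cases h2 : ∃ i : ℕ, (i : K) = E.2
        · obtain ⟨i, hi⟩ := h1
          obtain ⟨j, hj⟩ := h2
          exact absurd (Prod.ext hi hj) (h' (i, j))
        · obtain ⟨i, hi⟩ := h1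
          rw [ddPow2, dPow_of_not h2, ← hi, dPow_natCast]
          ext n k
          simp [d1z_iterate]
      · rw [ddPow2, dPow_of_not h1]
    rw [h1, h2]
    simp [diag]

lemma prodAt_eq {E : Type*} [AddCommGroup E] [Module K E] {r : ℕ} (c : Fin r → EDist2 K E)
    (h : Fin r → Idx K) (n : Idx K) (v : E) (m : Idx K) :
    prodAt K E c h n v m = ∑ i, diagD (h i - 1 - n) (ev2 K E (c i) v) m := by
  unfold prodAt
  apply Finset.sum_congr rfl
  intro i _
  rw [← diag_ddPow2]
  rfl

/-- the diagonal restriction only depends on the sum of the products with powers of `𝐳-𝐰` -/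
lemma sum_diagD_eq_zero {τ : Type*} [Fintype τ] {c : τ → Dist2 K M} (h : τ → Idx K)
    (hc : ∀ b T, (Function.support fun x => c b x (T - x)).Finite) (n n' : Idx K)
    (h0 : ∀ m, ∑ b, zwPow K M (-h b) (c b) m (n + n' - m) = 0) :
    ∑ b, diagD (h b - 1 - n) (c b) n' = 0 := by
  let ε : K → K → K → K := fun n e y => natFn (gchoose K (-y - e - 1)) (-e - 1 - n)
  have hε : ∀ n, IsPascal (ε n) := by
    intro n e y
    have e1 : -(e + 1) - 1 - n = -e - 1 - n - 1 := by ring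
    simp only [ε]
    rw [e1, natFn_sub_one]
    apply natFn_eq_of
    rintro (_ | i)
    · simp
    · have e2 : -y - e - 1 = -y - (e + 1) - 1 + 1 := by ring
      have e3 : -(y + 1) - e - 1 = -y - (e + 1) - 1 := by ring
      rw [e2, gchoose_pascal, e3]; simp
  have := sum_kernel_zero h hc (n + n') h0 (ε n.1) (ε n.2) (hε _) (hε _)
  rw [← this]
  apply Finset.sum_congr rfl
  intro b _
  unfold diagD
  apply finsum_congr
  intro x
  congr 1
  · simp only [C2K, ε, Prod.fst_sub, Prod.snd_sub, Prod.fst_neg, Prod.snd_neg, Prod.fst_one,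
      Prod.snd_one, neg_neg]
    congr 3 <;> ring
  · congr 1; ring

/-- a vanishing sum for `z > w` vanishes for `w > z` -/
lemma sum_zwPowW_eq_zero {τ : Type*} [Fintype τ] {c : τ → Dist2 K M} (h : τ → Idx K)
    (hK : ∀ b, Kbar K (h b)) (hc : ∀ b, InLat2 K M (c b))
    (h0 : ∀ m k, ∑ b, zwPow K M (-h b) (c b) m k = 0) (m k : Idx K) :
    ∑ b, zwPowW K M (-h b) (c b) m k = 0 := by
  let ε : K → K → K → K := fun m e y =>
    signChar e * natFn (fun i => (-1) ^ i * gchoose K e i) (y + e - m)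
  have hε : ∀ m, IsPascal (ε m) := by
    intro m e y
    have e1 : y + e - m = y + e + 1 - m - 1 := by ring
    have e2 : y + 1 + e - m = y + e + 1 - m := by ring
    have e3 : y + (e + 1) - m = y + e + 1 - m := by ring
    have key : natFn (fun i => Nat.casesOn i 0 fun i => (-1) ^ i * gchoose K e i) (y + e + 1 - m) =
        natFn (fun i => (-1) ^ i * gchoose K e i) (y + e + 1 - m) -
          natFn (fun i => (-1) ^ i * gchoose K (e + 1) i) (y + e + 1 - m) := by
      apply natFn_eq_of
      rintro (_ | i)
      · simp
      · simp only [gchoose_pascal, pow_succ]; ring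
    simp only [ε]
    rw [e2, e3, signChar_add_int isInt_one, negOnePow_one, e1, natFn_sub_one, key]
    ring
  have := sum_kernel_zero h (fun b T => (hc b).finite_line T) (m + k) (fun m' => h0 m' _) (ε m.1) (ε m.2) (hε _) (hε _)
  rw [← this]
  apply Finset.sum_congr rfl
  intro b _
  rw [finsum_of_injective (f := fun i : ℕ × ℕ => m + nc i)]
  · unfold zwPowW
    apply finsum_congr
    intro i
    congr 1
    · have hi : IsInt K (-(h b).1 - -(h b).2) := (hK b).neg
      have e1 : ∀ a b c : K, a + b + c + -c - a = b := by intros; ring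
      simp only [ε, Prod.fst_add, Prod.snd_add, nc, e1, natFn_cast, Prod.fst_neg, Prod.snd_neg]
      rw [← signChar_mul hi]
      ring
    · congr 1
      ext <;> simp [nc] <;> ring
  · intro i j h
    exact nc_injective (add_right_injective _ h)
  · intro x hx
    have e1 : ∀ a b c : K, a + b + -b - c = a - c := by intros; ring
    simp only [ε, e1]
    by_cases h1 : ∃ i : ℕ, (i : K) = x.1 - m.1
    · by_cases h2 : ∃ i : ℕ, (i : K) = x.2 - m.2
      · obtain ⟨i, hi⟩ := h1
        obtain ⟨j, hj⟩ := h2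
        exact absurd ⟨(i, j), by ext <;> simp [nc, hi, hj]⟩ hx
      · simp [natFn_of_not h2]
    · simp [natFn_of_not h1]

lemma InLat2.finite_zwPow {c : Dist2 K M} (hc : InLat2 K M c) (h m k : Idx K) :
    (Function.support fun x => expKer₂ m h (x - h) • c x (m + k + h - x)).Finite :=
  (hc.finite_line _).subset fun _ hx => right_ne_zero_of_smul hx

lemma InLat2.finite_diagD {c : Dist2 K M} (hc : InLat2 K M c) (E n : Idx K) :
    (Function.support fun x => C2K (-x - 1) E • c x (n - E - 1 - x)).Finite :=
  (hc.finite_line _).subset fun _ hx => right_ne_zero_of_smul hx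

variable {N : Type*} [AddCommGroup N] [Module K N]

lemma InLat2.map {c : Dist2 K M} (hc : InLat2 K M c) (f : M →ₗ[K] N) :
    InLat2 K N fun x y => f (c x y) := by
  obtain ⟨S, hS⟩ := hc
  exact ⟨S, fun n k h => hS n k fun h' => h (by simp [h'])⟩

lemma zwPow_map {c : Dist2 K M} (hc : InLat2 K M c) (f : M →ₗ[K] N) (h m k : Idx K) :
    zwPow K N h (fun x y => f (c x y)) m k = f (zwPow K M h c m k) := by
  rw [zwPow_eq, zwPow_eq, map_finsum f (hc.finite_zwPow h m k)]
  simp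

lemma diagD_map {c : Dist2 K M} (hc : InLat2 K M c) (f : M →ₗ[K] N) (E n : Idx K) :
    diagD E (fun x y => f (c x y)) n = f (diagD E c n) := by
  rw [diagD, diagD, map_finsum f (hc.finite_diagD E n)]
  simp

lemma diagD_add {c d : Dist2 K M} (hc : InLat2 K M c) (hd : InLat2 K M d) (E n : Idx K) :
    diagD E (c + d) n = diagD E c n + diagD E d n := by
  rw [diagD, diagD, diagD, ← finsum_add_distrib (hc.finite_diagD E n) (hd.finite_diagD E n)]
  simp

lemma zwPow_add {c d : Dist2 K M} (hc : InLat2 K M c) (hd : InLat2 K M d) (h m k : Idx K) :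
    zwPow K M h (c + d) m k = zwPow K M h c m k + zwPow K M h d m k := by
  rw [zwPow_eq, zwPow_eq, zwPow_eq,
    ← finsum_add_distrib (hc.finite_zwPow h m k) (hd.finite_zwPow h m k)]
  simp

lemma diagD_smul {c : Dist2 K M} (a : K) (E n : Idx K) :
    diagD E (a • c) n = a • diagD E c n := by
  rw [diagD, diagD, smul_finsum]
  exact finsum_congr fun x => by rw [Pi.smul_apply, Pi.smul_apply, smul_comm]

lemma zwPow_smul {c : Dist2 K M} (a : K) (h m k : Idx K) :
    zwPow K M h (a • c) m k = a • zwPow K M h c m k := by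
  rw [zwPow, zwPow, smul_finsum]
  exact finsum_congr fun x => by rw [Pi.smul_apply, Pi.smul_apply, smul_comm]

lemma zwPowW_smul {c : Dist2 K M} (a : K) (h m k : Idx K) :
    zwPowW K M h (a • c) m k = a • zwPowW K M h c m k := by
  rw [zwPowW, zwPowW, smul_finsum]
  exact finsum_congr fun x => by rw [Pi.smul_apply, Pi.smul_apply, smul_comm]

lemma InLat2.add {c d : Dist2 K M} (hc : InLat2 K M c) (hd : InLat2 K M d) :
    InLat2 K M (c + d) := by
  obtain ⟨S, hS⟩ := hc
  obtain ⟨S', hS'⟩ := hd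
  refine ⟨S ∪ S', fun n k h => ?_⟩
  by_cases h1 : c n k = 0
  · obtain ⟨m, hm, h2⟩ := hS' n k fun h2 => h (by simp [h1, h2])
    exact ⟨m, Finset.mem_union_right _ hm, h2⟩
  · obtain ⟨m, hm, h2⟩ := hS n k h1
    exact ⟨m, Finset.mem_union_left _ hm, h2⟩

lemma InLat2.smul {c : Dist2 K M} (hc : InLat2 K M c) (a : K) : InLat2 K M (a • c) := by
  obtain ⟨S, hS⟩ := hc
  exact ⟨S, fun n k h => hS n k fun h' => h (by simp [h'])⟩

lemma InLat1.add {c d : Dist1 K M} (hc : InLat1 K M c) (hd : InLat1 K M d) :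
    InLat1 K M (c + d) := by
  obtain ⟨S, hS⟩ := hc
  obtain ⟨S', hS'⟩ := hd
  refine ⟨S ∪ S', fun n h => ?_⟩
  by_cases h1 : c n = 0
  · obtain ⟨m, hm, h2⟩ := hS' n fun h2 => h (by simp [h1, h2])
    exact ⟨m, Finset.mem_union_right _ hm, h2⟩
  · obtain ⟨m, hm, h2⟩ := hS n h1
    exact ⟨m, Finset.mem_union_left _ hm, h2⟩

lemma InLat1.zero : InLat1 K M (0 : Dist1 K M) := ⟨∅, fun _ h => absurd rfl h⟩

lemma InLat1.sum {τ : Type*} (s : Finset τ) {c : τ → Dist1 K M}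
    (h : ∀ t ∈ s, InLat1 K M (c t)) : InLat1 K M (fun n => ∑ t ∈ s, c t n) := by
  have : (fun n => ∑ t ∈ s, c t n) = ∑ t ∈ s, c t := by ext n; simp
  rw [this]
  exact Finset.sum_induction _ _ (fun _ _ => InLat1.add) InLat1.zero h

lemma InLat2.diagD {c : Dist2 K M} (hc : InLat2 K M c) (E : Idx K) : InLat1 K M (diagD E c) := by
  obtain ⟨S, hS⟩ := (inLat2_iff c).1 hc
  refine (inLat1_iff _).2 ⟨S.image fun s => s.1 + s.2 + E + 1, fun n hn => ?_⟩
  obtain ⟨x, hx⟩ := exists_ne_zero_of_finsum hn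
  obtain ⟨s, hs, i, j, hi, hj⟩ := hS _ _ (right_ne_zero_of_smul hx)
  refine ⟨_, Finset.mem_image_of_mem _ hs, i + j, ?_⟩
  rw [nc_add]
  linear_combination hi + hj

end TwoVar

section Product
variable {K : Type*} [Field K] [CharZero K]

section Derivation

variable {M : Type*} [AddCommGroup M] [Module K M] (π : Idx K →ₗ[K] K) (u : Idx K)

/-- the total derivative of a two-variable distribution in direction `u` -/
def totDer (c : Dist2 K M) : Dist2 K M :=
  fun n k => (-π n) • c (n - u) k + (-π k) • c n (k - u)

lemma inLat2_totDer {c : Dist2 K M} (hc : InLat2 K M c) (hu : ∃ i : ℕ × ℕ, u = nc i) :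
    InLat2 K M (totDer π u c) := by
  obtain ⟨j, rfl⟩ := hu
  obtain ⟨S, hS⟩ := (inLat2_iff c).1 hc
  refine (inLat2_iff _).2 ⟨S.image (fun s => (s.1 + nc j, s.2)) ∪ S.image (fun s => (s.1, s.2 + nc j)),
    fun n k h => ?_⟩
  by_cases h1 : c (n - nc j) k = 0
  · have h2 : c n (k - nc j) ≠ 0 := fun h2 => h (by simp [totDer, h1, h2])
    obtain ⟨s, hs, i, i', h3, h4⟩ := hS _ _ h2
    exact ⟨_, Finset.mem_union_right _ (Finset.mem_image_of_mem _ hs), i, i', h3,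
      by linear_combination h4⟩
  · obtain ⟨s, hs, i, i', h3, h4⟩ := hS _ _ h1
    exact ⟨_, Finset.mem_union_left _ (Finset.mem_image_of_mem _ hs), i, i',
      by linear_combination h3, h4⟩

lemma zwPow_totDer {c : Dist2 K M} (hc : InLat2 K M c)
    (hker : ∀ m h y : Idx K, π (y + h + u) * expKer₂ m h (y + u) + π (m - y) * expKer₂ m h y =
      π m * expKer₂ (m - u) h y) (h m k : Idx K) :
    zwPow K M h (totDer π u c) m k =
      (-π m) • zwPow K M h c (m - u) k + (-π k) • zwPow K M h c m (k - u) := by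
  rw [zwPow_eq, zwPow_eq, zwPow_eq]
  have hf : (Function.support fun x => c x (m + k + h - u - x)).Finite := hc.finite_line _
  have hs : ∀ f : Idx K → K, (Function.support fun x => f x • c x (m + k + h - u - x)).Finite :=
    fun f => hf.subset fun _ hx => right_ne_zero_of_smul hx
  have e1 : ∀ x, m - u + k + h - x = m + k + h - u - x := fun x => by ring
  have e2 : ∀ x, m + (k - u) + h - x = m + k + h - u - x := fun x => by ring
  simp only [e1, e2, smul_finsum, smul_smul]
  rw [← finsum_add_distrib (hs _) (hs _)]
  have e3 : ∀ x, expKer₂ m h (x - h) • totDer π u c x (m + k + h - x) =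
      (expKer₂ m h (x - h) * (-π x)) • c (x - u) (m + k + h - x) +
      (expKer₂ m h (x - h) * (-π (m + k + h - x))) • c x (m + k + h - u - x) := fun x => by
    rw [totDer, smul_add, smul_smul, smul_smul]
    congr 3
    ring
  rw [finsum_congr e3, finsum_add_distrib _ (hs _)]
  · rw [← finsum_comp_equiv (Equiv.addRight u)]
    have e4 : ∀ x, (expKer₂ m h (Equiv.addRight u x - h) * -π (Equiv.addRight u x)) •
        c (Equiv.addRight u x - u) (m + k + h - Equiv.addRight u x) =
        (expKer₂ m h (x - h + u) * -π (x - h + h + u)) • c x (m + k + h - u - x) := fun x => by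
      simp only [Equiv.coe_addRight]
      have a1 : x + u - h = x - h + u := by ring
      have a2 : x - h + h + u = x + u := by ring
      have a3 : m + k + h - (x + u) = m + k + h - u - x := by ring
      rw [a1, a2, a3, add_sub_cancel_right]
    rw [finsum_congr e4, ← finsum_add_distrib (hs _) (hs _)]
    refine finsum_congr fun x => ?_
    rw [← add_smul, ← add_smul]
    congr 1
    have := hker m h (x - h)
    simp only [map_add, map_sub] at this ⊢
    linear_combination -this
  · have : (Function.support fun x => c (x - u) (m + k + h - x)) ⊆
        (fun x => x + u) '' (Function.support fun x => c x (m + k + h - u - x)) := by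
      intro x hx
      refine ⟨x - u, ?_, by simp⟩
      simp only [Function.mem_support] at hx ⊢
      convert hx using 2
      ring
    exact ((hf.image _).subset this).subset fun _ hx => right_ne_zero_of_smul hx

lemma diagD_totDer {c : Dist2 K M} (hc : InLat2 K M c)
    (hker : ∀ y E : Idx K, π y * C2K (y - u) E = π (y - E) * C2K y E) (hu : π u = π 1) (E n : Idx K) :
    diagD E (totDer π u c) n = (-π n) • diagD E c (n - u) := by
  rw [diagD, diagD]
  have hf : (Function.support fun x => c x (n - E - 1 - u - x)).Finite := hc.finite_line _
  have hs : ∀ f : Idx K → K, (Function.support fun x => f x • c x (n - E - 1 - u - x)).Finite :=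
    fun f => hf.subset fun _ hx => right_ne_zero_of_smul hx
  have e1 : ∀ x, n - u - E - 1 - x = n - E - 1 - u - x := fun x => by ring
  simp only [e1, smul_finsum, smul_smul]
  have e3 : ∀ x, C2K (-x - 1) E • totDer π u c x (n - E - 1 - x) =
      (C2K (-x - 1) E * (-π x)) • c (x - u) (n - E - 1 - x) +
      (C2K (-x - 1) E * (-π (n - E - 1 - x))) • c x (n - E - 1 - u - x) := fun x => by
    rw [totDer, smul_add, smul_smul, smul_smul]
    congr 3
    ring
  rw [finsum_congr e3, finsum_add_distrib _ (hs _)]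
  · rw [← finsum_comp_equiv (Equiv.addRight u)]
    have e4 : ∀ x, (C2K (-(Equiv.addRight u x) - 1) E * -π (Equiv.addRight u x)) •
        c (Equiv.addRight u x - u) (n - E - 1 - Equiv.addRight u x) =
        (C2K ((-x - 1) - u) E * -π (x + u)) • c x (n - E - 1 - u - x) := fun x => by
      simp only [Equiv.coe_addRight]
      have a1 : -(x + u) - 1 = -x - 1 - u := by ring
      have a3 : n - E - 1 - (x + u) = n - E - 1 - u - x := by ring
      rw [a1, a3, add_sub_cancel_right]
    rw [finsum_congr e4, ← finsum_add_distrib (hs _) (hs _)]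
    refine finsum_congr fun x => ?_
    rw [← add_smul]
    congr 1
    have := hker (-x - 1) E
    simp only [map_add, map_sub, map_neg, hu] at this ⊢
    linear_combination this
  · have : (Function.support fun x => c (x - u) (n - E - 1 - x)) ⊆
        (fun x => x + u) '' (Function.support fun x => c x (n - E - 1 - u - x)) := by
      intro x hx
      refine ⟨x - u, ?_, by simp⟩
      simp only [Function.mem_support] at hx ⊢
      convert hx using 2
      ring
    exact ((hf.image _).subset this).subset fun _ hx => right_ne_zero_of_smul hx

lemma mul_gchoose_sub_one (y : K) (j : ℕ) :
    y * gchoose K (y - 1) j = (y - j) * gchoose K y j := by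
  have h := succ_mul_gchoose y j
  have h2 : ((j : K) + 1) * gchoose K y (j + 1) = y * gchoose K (y - 1) j := by
    rw [gchoose, gchoose, Finset.prod_range_succ', Nat.factorial_succ]
    have h3 : (j.factorial : K) ≠ 0 := by exact_mod_cast Nat.factorial_ne_zero j
    have h4 : ((j : K) + 1) ≠ 0 := by exact_mod_cast Nat.succ_ne_zero j
    push_cast
    field_simp
    rw [mul_comm]
    simp only [sub_zero]
    congr 1
    exact Finset.prod_congr rfl fun i _ => by ring
  rw [← h2, h]

lemma natFn_gchoose_sub_one (y E : K) :
    y * natFn (gchoose K (y - 1)) E = (y - E) * natFn (gchoose K y) E := by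
  by_cases h : ∃ j : ℕ, (j : K) = E
  · obtain ⟨j, rfl⟩ := h
    rw [natFn_cast, natFn_cast, mul_gchoose_sub_one]
  · rw [natFn_of_not h, natFn_of_not h, mul_zero, mul_zero]

lemma expKer_der (m h y : K) :
    (y + h + 1) * expKer m h (y + 1) + (m - y) * expKer m h y = m * expKer (m - 1) h y := by
  have h1 : expKer (m - 1) h y = expKer m h (y + 1) := by
    rw [expKer, expKer]; congr 1; ring
  have h2 : (m - y) * expKer m h y = (m - y - 1 - h) * expKer m h (y + 1) := by
    have : m - (y + 1) = m - y - 1 := by ring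
    rw [expKer, expKer, this, natFn_sub_one]
    by_cases h : ∃ j : ℕ, (j : K) = m - y
    · obtain ⟨j, hj⟩ := h
      rw [← hj, natFn_cast, natFn_cast]
      cases j with
      | zero => simp
      | succ j =>
        have := succ_mul_gchoose h j
        push_cast
        linear_combination (-1) ^ (j + 1) * this
    · rw [natFn_of_not h, natFn_of_not h, mul_zero, mul_zero]
  rw [h1, h2]
  ring

end Derivation

section HalfOPE

variable {E : Type*} [AddCommGroup E] [Module K E] {τ : Type*} [Fintype τ]

/-- `c, h` are the data of an expansion of `a(z) b(w)` in the domain `z > w` -/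
def HalfOPE (a b : EDist1 K E) (c : τ → EDist2 K E) (h : τ → Idx K) : Prop :=
  (∀ i, IsField2D K E (c i)) ∧
  ∀ v m k, a m (b k v) = ∑ i, zwPow K E (-(h i)) (ev2 K E (c i) v) m k

lemma ev2_add (c : EDist2 K E) (v w : E) : ev2 K E c (v + w) = ev2 K E c v + ev2 K E c w := by
  ext; simp [ev2]

lemma ev2_smul (c : EDist2 K E) (x : K) (v : E) : ev2 K E c (x • v) = x • ev2 K E c v := by
  ext; simp [ev2]

/-- the product field attached to expansion data -/
def prodE (c : τ → EDist2 K E) (hc : ∀ i, IsField2D K E (c i)) (h : τ → Idx K) (n : Idx K) :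
    EDist1 K E := fun m =>
  { toFun := fun v => ∑ i, diagD (h i - 1 - n) (ev2 K E (c i) v) m
    map_add' := fun v w => by
      rw [← Finset.sum_add_distrib]
      exact Finset.sum_congr rfl fun i _ => by rw [ev2_add, diagD_add (hc i v) (hc i w)]
    map_smul' := fun x v => by
      rw [Finset.smul_sum]
      exact Finset.sum_congr rfl fun i _ => by rw [ev2_smul, diagD_smul]; rfl }

/-- `g` is the `n`-th product of `a` and `b` -/
def IsProd (a b : EDist1 K E) (n : Idx K) (g : EDist1 K E) : Prop :=
  ∃ (r : ℕ) (c : Fin r → EDist2 K E) (h : Fin r → Idx K), HalfOPE a b c h ∧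
    ∀ v m, g m v = ∑ i, diagD (h i - 1 - n) (ev2 K E (c i) v) m

/-- diagonal values only depend on the left hand side of an expansion -/
lemma HalfOPE.sum_diagD_eq {a b : EDist1 K E} {σ : Type*} [Fintype σ]
    {c : τ → EDist2 K E} {h : τ → Idx K} {M : Type*} [AddCommGroup M] [Module K M]
    (H : HalfOPE a b c h) (v : E) (f : E →ₗ[K] M)
    {d : σ → Dist2 K M} (hd : ∀ i T, (Function.support fun x => d i x (T - x)).Finite)
    (h' : σ → Idx K) (n n' : Idx K)
    (h0 : ∀ m, f (a m (b (n + n' - m) v)) = ∑ i, zwPow K M (-(h' i)) (d i) m (n + n' - m)) :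
    f (∑ i, diagD (h i - 1 - n) (ev2 K E (c i) v) n') = ∑ i, diagD (h' i - 1 - n) (d i) n' := by
  have key := sum_diagD_eq_zero (τ := τ ⊕ σ)
    (c := Sum.elim (fun i => fun x y => f (c i x y v)) (fun i => (-1 : K) • d i)) (Sum.elim h h')
    (by
      rintro (i | i)
      · exact ((H.1 i v).map f).finite_line
      · exact fun T => (hd i T).subset fun x => right_ne_zero_of_smul) n n' (by
      intro m
      rw [Fintype.sum_sum_type]
      simp only [Sum.elim_inl, Sum.elim_inr, zwPow_smul]
      have e : ∀ i, zwPow K M (-(h i)) (fun x y => f (c i x y v)) m (n + n' - m) =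
          f (zwPow K E (-(h i)) (ev2 K E (c i) v) m (n + n' - m)) :=
        fun i => zwPow_map (H.1 i v) f _ _ _
      simp only [e]
      rw [← map_sum, ← H.2, h0, ← Finset.smul_sum, neg_one_smul, add_neg_cancel])
  rw [Fintype.sum_sum_type] at key
  simp only [Sum.elim_inl, Sum.elim_inr, diagD_smul] at key
  rw [← Finset.smul_sum, neg_one_smul, ← sub_eq_add_neg, sub_eq_zero] at key
  rw [← key, map_sum]
  exact Finset.sum_congr rfl fun i _ => (diagD_map (H.1 i v) f _ _).symm

lemma IsProd.unique {a b g : EDist1 K E} {n : Idx K} (hg : IsProd a b n g)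
    {c : τ → EDist2 K E} {h : τ → Idx K} (H : HalfOPE a b c h) (v : E) (m : Idx K) :
    g m v = ∑ i, diagD (h i - 1 - n) (ev2 K E (c i) v) m := by
  obtain ⟨r, c', h', H', e⟩ := hg
  rw [e]
  exact H'.sum_diagD_eq v LinearMap.id (fun i => (H.1 i v).finite_line) h n m fun m' => H.2 _ _ _

lemma IsProd.mem {a b g : EDist1 K E} {n : Idx K} (hg : IsProd a b n g) (N : Submodule K E)
    (v : E) (hN : ∀ m k, a m (b k v) ∈ N) (m : Idx K) : g m v ∈ N := by
  obtain ⟨r, c, h, H, e⟩ := hg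
  rw [e, ← Submodule.Quotient.mk_eq_zero, ← Submodule.mkQ_apply]
  have := H.sum_diagD_eq (σ := Fin 0) v N.mkQ (d := fun i => i.elim0) (fun i => i.elim0)
    (fun i => i.elim0) n m (fun m' => by
      rw [Submodule.mkQ_apply, (Submodule.Quotient.mk_eq_zero N).2 (hN _ _)]; simp)
  simpa using this

lemma IsProd.isField {a b g : EDist1 K E} {n : Idx K} (hg : IsProd a b n g) :
    IsFieldD K E g := by
  obtain ⟨r, c, h, H, e⟩ := hg
  intro v
  have : ev1 K E g v = fun m => ∑ i, diagD (h i - 1 - n) (ev2 K E (c i) v) m := by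
    ext m; exact e v m
  rw [this]
  exact InLat1.sum _ fun i _ => (H.1 i v).diagD _

lemma exists_isProd {a b : EDist1 K E} (n : Idx K) {r : ℕ} {c : Fin r → EDist2 K E}
    {h : Fin r → Idx K} (H : HalfOPE a b c h) : ∃ g, IsProd a b n g :=
  ⟨prodE c H.1 h n, r, c, h, H, fun _ _ => rfl⟩

/-- covariance with respect to one translation -/
def TransCov1 (π : Idx K →ₗ[K] K) (u : Idx K) (T : Module.End K E) (a : EDist1 K E) : Prop :=
  ∀ n v, T (a n v) - a n (T v) = (-π n) • a (n - u) v

lemma transCov_iff (T Tb : Module.End K E) (a : EDist1 K E) : TransCov K E T Tb a ↔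
    TransCov1 (LinearMap.fst K K K) (1, 0) T a ∧ TransCov1 (LinearMap.snd K K K) (0, 1) Tb a := by
  have e1 : ∀ n : Idx K, n - (1, 0) = (n.1 - 1, n.2) := fun n => by ext <;> simp
  have e2 : ∀ n : Idx K, n - (0, 1) = (n.1, n.2 - 1) := fun n => by ext <;> simp
  simp only [TransCov, TransCov1, e1, e2, LinearMap.ext_iff, LinearMap.sub_apply, Module.End.mul_apply,
    LinearMap.smul_apply, LinearMap.fst_apply, LinearMap.snd_apply]

lemma IsProd.transCov1 {a b g : EDist1 K E} {n : Idx K} (hg : IsProd a b n g)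
    {π : Idx K →ₗ[K] K} {u : Idx K} (hu : π u = π 1) (hu' : ∃ i : ℕ × ℕ, u = nc i)
    (hk1 : ∀ m h y : Idx K, π (y + h + u) * expKer₂ m h (y + u) + π (m - y) * expKer₂ m h y =
      π m * expKer₂ (m - u) h y)
    (hk2 : ∀ y E : Idx K, π y * C2K (y - u) E = π (y - E) * C2K y E)
    {T : Module.End K E} (ha : TransCov1 π u T a) (hb : TransCov1 π u T b) :
    TransCov1 π u T g := by
  obtain ⟨r, c, h, H, e⟩ := hg
  intro m v
  have hl : ∀ i, InLat2 K E (fun x y => T (c i x y v)) := fun i => (H.1 i v).map T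
  have hl2 : ∀ i, InLat2 K E (ev2 K E (c i) (T v) + totDer π u (ev2 K E (c i) v)) := fun i =>
    (H.1 i (T v)).add (inLat2_totDer π u (H.1 i v) hu')
  have key := H.sum_diagD_eq v T (fun i => (hl2 i).finite_line) h n m fun m' => by
    simp only [zwPow_add (H.1 _ (T v)) (inLat2_totDer π u (H.1 _ v) hu'),
      zwPow_totDer π u (H.1 _ v) hk1, Finset.sum_add_distrib, ← Finset.smul_sum, ← H.2]
    have h1 := ha m' (b (n + m - m') v)
    have h2 := congrArg (a m') (hb (n + m - m') v)
    rw [map_sub, map_smul] at h2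
    rw [← h1, ← h2]
    abel
  simp only [e]
  rw [key]
  simp only [diagD_add (H.1 _ (T v)) (inLat2_totDer π u (H.1 _ v) hu'),
    diagD_totDer π u (H.1 _ v) hk2 hu, Finset.sum_add_distrib, ← Finset.smul_sum]
  abel

lemma IsProd.transCov {a b g : EDist1 K E} {n : Idx K} (hg : IsProd a b n g)
    {T Tb : Module.End K E} (ha : TransCov K E T Tb a) (hb : TransCov K E T Tb b) :
    TransCov K E T Tb g := by
  rw [transCov_iff] at *
  constructor
  · refine hg.transCov1 (by simp) ⟨(1, 0), by simp [nc]⟩ ?_ ?_ ha.1 hb.1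
    · intro m h y
      have := expKer_der m.1 h.1 y.1
      simp only [expKer₂, LinearMap.fst_apply, Prod.fst_add, Prod.snd_add, Prod.fst_sub,
        Prod.snd_sub, add_zero, sub_zero]
      linear_combination expKer m.2 h.2 y.2 * this
    · intro y E
      have := natFn_gchoose_sub_one y.1 E.1
      simp only [C2K, LinearMap.fst_apply, Prod.fst_sub, Prod.snd_sub, sub_zero]
      linear_combination natFn (gchoose K y.2) E.2 * this
  · refine hg.transCov1 (by simp) ⟨(0, 1), by simp [nc]⟩ ?_ ?_ ha.2 hb.2
    · intro m h y
      have := expKer_der m.2 h.2 y.2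
      simp only [expKer₂, LinearMap.snd_apply, Prod.fst_add, Prod.snd_add, Prod.fst_sub,
        Prod.snd_sub, add_zero, sub_zero]
      linear_combination expKer m.1 h.1 y.1 * this
    · intro y E
      have := natFn_gchoose_sub_one y.2 E.2
      simp only [C2K, LinearMap.snd_apply, Prod.fst_sub, Prod.snd_sub, sub_zero]
      linear_combination natFn (gchoose K y.1) E.1 * this

end HalfOPE
end Product

section States
variable {K : Type*} [Field K] [CharZero K] {E : Type*} [AddCommGroup E] [Module K E]

/-- divided powers of a pair of operators -/
def divPow (T Tb : Module.End K E) (q : ℕ × ℕ) : Module.End K E :=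
  ((q.1.factorial : K)⁻¹ * (q.2.factorial : K)⁻¹) • (T ^ q.1 * Tb ^ q.2)

@[simp] lemma divPow_zero (T Tb : Module.End K E) : divPow T Tb 0 = 1 := by simp [divPow]

variable {π : Idx K →ₗ[K] K} {u : Idx K} {T Tb : Module.End K E} {a b g : EDist1 K E} {one : E}

lemma TransCov1.ne_zero_add (ha : TransCov1 π u T a) (hu : π u = 1) (hT : T one = 0)
    {m : Idx K} (hm : ¬ IsNegInt K (π m)) (h : a m one ≠ 0) (j : ℕ) :
    a (m + (j : K) • u) one ≠ 0 := by
  induction j with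
  | zero => simpa using h
  | succ j ih =>
    intro h0
    have := ha (m + ((j + 1 : ℕ) : K) • u) one
    have e : m + ((j + 1 : ℕ) : K) • u - u = m + (j : K) • u := by
      push_cast; rw [add_smul, one_smul]; abel
    rw [h0, hT, map_zero, map_zero, sub_zero, e, eq_comm, smul_eq_zero] at this
    rcases this with h1 | h1
    · rw [neg_eq_zero, map_add, map_smul, hu] at h1
      exact hm ⟨-((j : ℤ) + 1), by omega, by push_cast at h1 ⊢; simp at h1; linear_combination -h1⟩
    · exact ih h1

lemma not_inLat1_of_line {d : Dist1 K E} (hd : InLat1 K E d) (m u : Idx K)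
    (hu : u = (1, 0) ∨ u = (0, 1)) : ∃ j : ℕ, d (m + (j : K) • u) = 0 := by
  by_contra! hne
  obtain ⟨S, hS⟩ := (inLat1_iff _).1 hd
  have : (Set.univ : Set ℕ) ⊆ ⋃ s ∈ S, {j : ℕ | ∃ i : ℕ × ℕ, m + (j : K) • u = s - nc i} := by
    intro j _
    obtain ⟨s, hs, h⟩ := hS _ (hne j)
    exact Set.mem_biUnion hs h
  refine Set.infinite_univ (Set.Finite.subset (Set.Finite.biUnion S.finite_toSet fun s _ => ?_) this)
  by_cases h : ∃ j i, m + ((j : ℕ) : K) • u = s - nc i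
  · obtain ⟨j0, i0, h0⟩ := h
    refine (Set.finite_Iic (j0 + i0.1 + i0.2)).subset ?_
    rintro j ⟨i, hi⟩
    have h1 : ((j : K) - j0) • u = nc i0 - nc i := by
      rw [sub_smul]; linear_combination hi - h0
    rw [Set.mem_Iic]
    rcases hu with rfl | rfl
    · have h2 := congrArg Prod.fst h1
      simp [nc] at h2
      have : j + i.1 = j0 + i0.1 := by
        have : (j : K) + i.1 = j0 + i0.1 := by linear_combination h2
        exact_mod_cast this
      omega
    · have h2 := congrArg Prod.snd h1
      simp [nc] at h2
      have : j + i.2 = j0 + i0.2 := by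
        have : (j : K) + i.2 = j0 + i0.2 := by linear_combination h2
        exact_mod_cast this
      omega
  · convert Set.finite_empty
    ext j
    simp only [Set.mem_ofPred_eq, Set.mem_empty_iff_false, iff_false]
    exact fun ⟨i, hi⟩ => h ⟨j, i, hi⟩

/-- a translation covariant field is weakly creative for an invariant vector -/
lemma TransCov.isPow1 (ha : TransCov K E T Tb a) (hf : InLat1 K E (ev1 K E a one))
    (hT : T one = 0) (hTb : Tb one = 0) : IsPow1 K E (ev1 K E a one) := by
  rw [transCov_iff] at ha
  intro m hm
  constructor
  · by_contra hn
    obtain ⟨j, hj⟩ := not_inLat1_of_line hf m (1, 0) (Or.inl rfl)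
    exact ha.1.ne_zero_add (by simp) hT (m := m) hn hm j hj
  · by_contra hn
    obtain ⟨j, hj⟩ := not_inLat1_of_line hf m (0, 1) (Or.inr rfl)
    exact ha.2.ne_zero_add (by simp) hTb (m := m) hn hm j hj

lemma TransCov.creative (ha : TransCov K E T Tb a) (hT : T one = 0) (hTb : Tb one = 0)
    (q : ℕ × ℕ) : a (-1 - nc q) one = divPow T Tb q (a (-1) one) := by
  have key : ∀ j : ℕ, a (-1 - nc (0, j)) one = divPow T Tb (0, j) (a (-1) one) := by
    intro j
    induction j with
    | zero => have : ((0, 0) : ℕ × ℕ) = 0 := rfl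
              simp [this]
    | succ j ih =>
      have h := LinearMap.congr_fun (ha.2 (-1 - nc (0, j))) one
      have e : ((-1 - nc (0, j) : Idx K).1, (-1 - nc (0, j) : Idx K).2 - 1) = -1 - nc (0, j + 1) := by
        ext <;> simp [nc]; ring
      rw [e] at h
      simp only [LinearMap.sub_apply, Module.End.mul_apply, hTb, map_zero, sub_zero, ih,
        LinearMap.smul_apply] at h
      have h2 : (-(-1 - nc (0, j) : Idx K).2) = (j : K) + 1 := by simp [nc]
      have h3 : ((j : K) + 1) ≠ 0 := by exact_mod_cast Nat.succ_ne_zero j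
      rw [h2, ← inv_smul_eq_iff₀ h3] at h
      rw [← h]
      simp only [divPow, LinearMap.smul_apply, pow_zero, one_mul, map_smul, smul_smul, pow_succ',
        Module.End.mul_apply, Nat.factorial_succ]
      congr 1
      push_cast
      rw [mul_inv]
      ring
  obtain ⟨i, j⟩ := q
  induction i with
  | zero => exact key j
  | succ i ih =>
    have h := LinearMap.congr_fun (ha.1 (-1 - nc (i, j))) one
    have e : ((-1 - nc (i, j) : Idx K).1 - 1, (-1 - nc (i, j) : Idx K).2) = -1 - nc (i + 1, j) := by
      ext <;> simp [nc]; ring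
    rw [e] at h
    simp only [LinearMap.sub_apply, Module.End.mul_apply, hT, map_zero, sub_zero, ih,
      LinearMap.smul_apply] at h
    have h2 : (-(-1 - nc (i, j) : Idx K).1) = (i : K) + 1 := by simp [nc]
    have h3 : ((i : K) + 1) ≠ 0 := by exact_mod_cast Nat.succ_ne_zero i
    rw [h2, ← inv_smul_eq_iff₀ h3] at h
    rw [← h]
    simp only [divPow, LinearMap.smul_apply, map_smul, smul_smul, pow_succ',
      Module.End.mul_apply, Nat.factorial_succ]
    congr 1
    push_cast
    rw [mul_inv]
    ring

lemma TransCov1.apply_pow (ha : TransCov1 π u T a) (hu : π u = 1) (j : ℕ) (m : Idx K) (v : E) :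
    a m ((T ^ j) v) = ∑ l ∈ Finset.range (j + 1),
      ((j.choose l : K) * l.factorial * gchoose K (π m) l) • (T ^ (j - l)) (a (m - (l : K) • u) v) := by
  induction j generalizing m with
  | zero => simp
  | succ j ih =>
    have h1 : a m ((T ^ (j + 1)) v) = T (a m ((T ^ j) v)) + π m • a (m - u) ((T ^ j) v) := by
      have := ha m ((T ^ j) v)
      rw [pow_succ', Module.End.mul_apply]
      rw [neg_smul] at this
      rw [← sub_eq_zero]
      rw [← sub_eq_zero] at this
      rw [← neg_eq_zero, ← this]
      abel
    have e0 : ∀ l : ℕ, m - u - (l : K) • u = m - ((l + 1 : ℕ) : K) • u := fun l => by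
      push_cast; rw [add_smul, one_smul]; abel
    have e1 : ∀ l : ℕ, π m * gchoose K (π m - 1) l = (l + 1) * gchoose K (π m) (l + 1) := fun l => by
      rw [mul_gchoose_sub_one, succ_mul_gchoose]
    have e2 : ∀ l ∈ Finset.range (j + 1),
        T (((j.choose l : K) * l.factorial * gchoose K (π m) l) • (T ^ (j - l)) (a (m - (l : K) • u) v)) =
        ((j.choose l : K) * l.factorial * gchoose K (π m) l) •
          (T ^ (j + 1 - l)) (a (m - (l : K) • u) v) := fun l hl => by
      rw [map_smul, Nat.succ_sub (Finset.mem_range_succ_iff.1 hl), pow_succ', Module.End.mul_apply]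
    have e3 : ∀ l ∈ Finset.range (j + 1), π m •
        ((j.choose l : K) * l.factorial * gchoose K (π (m - u)) l) •
          (T ^ (j - l)) (a (m - u - (l : K) • u) v) =
        ((j.choose l : K) * (l + 1).factorial * gchoose K (π m) (l + 1)) •
          (T ^ (j + 1 - (l + 1))) (a (m - ((l + 1 : ℕ) : K) • u) v) := fun l hl => by
      rw [smul_smul, e0, Nat.add_sub_add_right, map_sub, hu, Nat.factorial_succ]
      congr 1
      push_cast
      linear_combination (j.choose l : K) * l.factorial * e1 l
    rw [h1, ih, ih, map_sum, Finset.smul_sum, Finset.sum_congr rfl e2, Finset.sum_congr rfl e3,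
      Finset.sum_range_succ' _ (j + 1)]
    have e4 : ∀ l, ((j + 1).choose (l + 1) : K) * (l + 1).factorial * gchoose K (π m) (l + 1) =
        (j.choose (l + 1) : K) * (l + 1).factorial * gchoose K (π m) (l + 1) +
        (j.choose l : K) * (l + 1).factorial * gchoose K (π m) (l + 1) := fun l => by
      rw [Nat.choose_succ_succ]; push_cast; ring
    simp only [e4, add_smul, Finset.sum_add_distrib]
    rw [add_right_comm]
    congr 1
    have := Finset.sum_range_succ' (fun l : ℕ =>
      ((j.choose l : K) * l.factorial * gchoose K (π m) l) •
          (T ^ (j + 1 - l)) (a (m - (l : K) • u) v)) (j + 1)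
    rw [Finset.sum_range_succ] at this
    simpa using this

lemma TransCov.apply_divPow (ha : TransCov K E T Tb a) (q : ℕ × ℕ) (m : Idx K) (v : E) :
    a m (divPow T Tb q v) = ∑ p ∈ Finset.Iic q,
      C2 m (q - p) • divPow T Tb p (a (m - nc (q - p)) v) := by
  rw [transCov_iff] at ha
  obtain ⟨i, j⟩ := q
  have h0 : Finset.Iic ((i, j) : ℕ × ℕ) = Finset.range (i + 1) ×ˢ Finset.range (j + 1) := by
    ext x; simp [Prod.le_def]
  have hf : ∀ n : ℕ, (n.factorial : K) ≠ 0 := fun n => by exact_mod_cast Nat.factorial_ne_zero n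
  rw [h0, Finset.sum_product, ← Finset.sum_range_reflect]
  simp only [divPow, LinearMap.smul_apply, Module.End.mul_apply, map_smul]
  rw [ha.1.apply_pow (by simp), Finset.smul_sum]
  refine Finset.sum_congr rfl fun l hl => ?_
  rw [← Finset.sum_range_reflect, ha.2.apply_pow (by simp), map_sum, Finset.smul_sum, Finset.smul_sum]
  refine Finset.sum_congr rfl fun l' hl' => ?_
  have hl1 : l ≤ i := Finset.mem_range_succ_iff.1 hl
  have hl2 : l' ≤ j := Finset.mem_range_succ_iff.1 hl'
  have h1 : i + 1 - 1 - l = i - l := by omega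
  have h2 : j + 1 - 1 - l' = j - l' := by omega
  have h3 : ((i, j) : ℕ × ℕ) - (i - l, j - l') = (l, l') := by
    ext
    · show i - (i - l) = l
      omega
    · show j - (j - l') = l'
      omega
  have h4 : m - (l : K) • ((1, 0) : Idx K) - (l' : K) • ((0, 1) : Idx K) = m - nc (l, l') := by
    ext <;> simp [nc]
  rw [h1, h2, h3, h4, map_smul, smul_smul, smul_smul, smul_smul]
  congr 1
  have c1 : (i.choose l : K) * l.factorial * (i - l).factorial = i.factorial := by
    exact_mod_cast Nat.choose_mul_factorial_mul_factorial hl1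
  have c2 : (j.choose l' : K) * l'.factorial * (j - l').factorial = j.factorial := by
    exact_mod_cast Nat.choose_mul_factorial_mul_factorial hl2
  have d1 : (i.factorial : K)⁻¹ * ((i.choose l : K) * l.factorial) = ((i - l).factorial : K)⁻¹ := by
    refine eq_inv_of_mul_eq_one_left ?_
    rw [mul_assoc, c1, inv_mul_cancel₀ (hf _)]
  have d2 : (j.factorial : K)⁻¹ * ((j.choose l' : K) * l'.factorial) = ((j - l').factorial : K)⁻¹ := by
    refine eq_inv_of_mul_eq_one_left ?_
    rw [mul_assoc, c2, inv_mul_cancel₀ (hf _)]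
  simp only [C2, LinearMap.fst_apply, LinearMap.snd_apply, Prod.snd_sub, Prod.smul_snd, smul_zero,
    sub_zero]
  rw [← d1, ← d2]
  ring

/-- the two-variable distribution concentrated at one index -/
def pointMass (x k : Idx K) (w : E) : Dist2 K E := fun x' k' => if x' = x ∧ k' = k then w else 0

lemma inLat2_pointMass (x k : Idx K) (w : E) : InLat2 K E (pointMass x k w) := by
  refine (inLat2_iff _).2 ⟨{(x, k)}, fun n m h => ⟨_, Finset.mem_singleton_self _, 0, 0, ?_⟩⟩
  have : n = x ∧ m = k := by
    by_contra h'
    exact h (if_neg h')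
  simp [this.1, this.2]

lemma zwPow_pointMass {x k m n h : Idx K} (w : E) (e : m + n + h = x + k) :
    zwPow K E h (pointMass x k w) m n = expKer₂ m h (x - h) • w := by
  rw [zwPow_eq, finsum_eq_single _ x]
  · have : m + n + h - x = k := by rw [e]; ring
    rw [this, pointMass, if_pos ⟨rfl, rfl⟩]
  · intro y hy
    rw [pointMass, if_neg (fun h => hy h.1), smul_zero]

lemma diagD_pointMass {x k D n : Idx K} (w : E) (e : n - D - 1 = x + k) :
    diagD D (pointMass x k w) n = C2K (-x - 1) D • w := by
  rw [diagD, finsum_eq_single _ x]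
  · have : n - D - 1 - x = k := by rw [e]; ring
    rw [this, pointMass, if_pos ⟨rfl, rfl⟩]
  · intro y hy
    rw [pointMass, if_neg (fun h => hy h.1), smul_zero]

lemma finite_nc_support {d : Dist1 K E} (hd : InLat1 K E d) (n : Idx K) :
    {p : ℕ × ℕ | d (n + nc p) ≠ 0}.Finite := by
  obtain ⟨S, hS⟩ := (inLat1_iff _).1 hd
  refine (Set.Finite.biUnion S.finite_toSet fun s _ => finite_nc_add (s - n)).subset ?_
  intro p hp
  obtain ⟨s, hs, i, hi⟩ := hS _ hp
  exact Set.mem_biUnion hs ⟨i, by linear_combination hi⟩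

/-- the state of a product field -/
lemma IsProd.state {n : Idx K} (hg : IsProd a b n g) (ha : TransCov K E T Tb a)
    (hb : TransCov K E T Tb b) (haf : IsFieldD K E a) (hbf : IsFieldD K E b)
    (hT : T one = 0) (hTb : Tb one = 0) : g (-1) one = a n (b (-1) one) := by
  obtain ⟨r, c, h, H, e⟩ := hg
  have hfin := finite_nc_support (haf (b (-1) one)) n
  have hmem : ∀ p, p ∉ hfin.toFinset → a (n + nc p) (b (-1) one) = 0 := fun p hp => by
    simpa [ev1] using hp
  have key := H.sum_diagD_eq one LinearMap.id (σ := hfin.toFinset)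
    (d := fun p => pointMass (-1) (-1 - nc p.1) (divPow T Tb p.1 (a (n + nc p.1) (b (-1) one))))
    (fun p => (inLat2_pointMass _ _ _).finite_line) (fun p => n + 1 + nc p.1) n (-1) (by
      intro m
      rw [LinearMap.id_apply]
      have e1 : ∀ p : hfin.toFinset, zwPow K E (-(n + 1 + nc p.1)) (pointMass (-1) (-1 - nc p.1)
          (divPow T Tb p.1 (a (n + nc p.1) (b (-1) one)))) m (n + -1 - m) =
          expKer₂ m (-(n + 1 + nc p.1)) (n + nc p.1) •
            divPow T Tb p.1 (a (n + nc p.1) (b (-1) one)) := fun p => by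
        rw [zwPow_pointMass _ (by ring)]
        congr 2
        ring
      simp only [e1]
      rw [Finset.sum_coe_sort hfin.toFinset (fun p => expKer₂ m (-(n + 1 + nc p)) (n + nc p) •
            divPow T Tb p (a (n + nc p) (b (-1) one)))]
      by_cases hq : ∃ q : ℕ × ℕ, m = n + nc q
      · obtain ⟨q, rfl⟩ := hq
        have e2 : n + -1 - (n + nc q) = -1 - nc q := by ring
        rw [e2, hb.creative hT hTb, ha.apply_divPow]
        have e3 : ∀ p ∈ Finset.Iic q, n + nc q - nc (q - p) = n + nc p ∧
            expKer₂ (n + nc q) (-(n + 1 + nc p)) (n + nc p) = C2 (n + nc q) (q - p) := fun p hp => by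
          have h1 : (nc q : Idx K) = nc p + nc (q - p) := by
            rw [← nc_add, add_tsub_cancel_of_le (Finset.mem_Iic.1 hp)]
          refine ⟨by rw [h1]; ring, ?_⟩
          have h2 : n + nc p = n + nc q - nc (q - p) := by rw [h1]; ring
          conv_lhs => rw [h2]
          rw [expKer₂_nc, h1]
          have g1 := gchoose_neg (n.1 + p.1) (q - p).1
          have g2 := gchoose_neg (n.2 + p.2) (q - p).2
          simp only [C2, nc, Prod.fst_add, Prod.snd_add, Prod.fst_neg, Prod.snd_neg, Prod.fst_one,
            Prod.snd_one]
          have s1 : -(n.1 + 1 + (p.1 : K)) = -(n.1 + p.1) - 1 := by ring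
          have s2 : -(n.2 + 1 + (p.2 : K)) = -(n.2 + p.2) - 1 := by ring
          have s3 : ∀ i : ℕ, (-1 : K) ^ i * (-1) ^ i = 1 := fun i => by rw [← mul_pow]; simp
          rw [s1, s2, g1, g2, ← add_assoc, ← add_assoc, pow_add]
          linear_combination (gchoose K (n.1 + p.1 + (q - p).1) (q - p).1 *
            gchoose K (n.2 + p.2 + (q - p).2) (q - p).2) *
            ((-1) ^ (q - p).2 * (-1) ^ (q - p).2 * s3 (q - p).1 + s3 (q - p).2)
        rw [Finset.sum_congr rfl fun p hp => by rw [(e3 p hp).1, ← (e3 p hp).2]]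
        have e4 : ∀ p, p ∉ Finset.Iic q →
            expKer₂ (n + nc q) (-(n + 1 + nc p)) (n + nc p) = 0 := fun p hp => by
          refine expKer₂_of_not fun i hi => hp ?_
          have : (nc p : Idx K) + nc i = nc q := by linear_combination hi
          rw [← nc_add] at this
          rw [Finset.mem_Iic, ← nc_injective this]
          exact le_self_add
        refine (Finset.sum_subset (Finset.subset_union_left (s₂ := hfin.toFinset)) ?_).trans
          (Finset.sum_subset (Finset.subset_union_right (s₁ := Finset.Iic q)) ?_).symm
        · intro p _ hp
          rw [e4 p hp, zero_smul]
        · intro p _ hp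
          rw [hmem p hp, map_zero, smul_zero]
      · have h1 : b (n + -1 - m) one = 0 := by
          by_contra h2
          obtain ⟨i, hi⟩ := (negInt_pair_iff' _).1 (hb.isPow1 (hbf one) hT hTb _ h2)
          exact hq ⟨i, by linear_combination -hi⟩
        rw [h1, map_zero, eq_comm]
        refine Finset.sum_eq_zero fun p _ => ?_
        rw [expKer₂_of_not, zero_smul]
        intro i hi
        refine hq ⟨p + i, ?_⟩
        rw [nc_add]
        linear_combination -hi)
  rw [e]
  rw [LinearMap.id_apply] at key
  rw [key]
  have e5 : ∀ p : hfin.toFinset, diagD (n + 1 + nc p.1 - 1 - n) (pointMass (-1) (-1 - nc p.1)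
      (divPow T Tb p.1 (a (n + nc p.1) (b (-1) one)))) (-1) =
      if p.1 = 0 then a n (b (-1) one) else 0 := fun p => by
    rw [diagD_pointMass _ (by ring)]
    have : n + 1 + nc p.1 - 1 - n = (nc p.1 : Idx K) := by ring
    rw [this, C2K_nc, neg_neg, sub_self, C2_zero_left]
    by_cases hp : p.1 = 0
    · simp [hp]
    · simp [hp]
  simp only [e5]
  rw [Finset.sum_coe_sort hfin.toFinset (fun p => if p = 0 then a n (b (-1) one) else 0),
    Finset.sum_ite_eq']
  by_cases h0 : (0 : ℕ × ℕ) ∈ hfin.toFinset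
  · rw [if_pos h0]
  · rw [if_neg h0, ← hmem 0 h0]; simp

end States

section Goddard
variable {K : Type*} [Field K] [CharZero K] {E : Type*} [AddCommGroup E] [Module K E]

lemma isLocal_of_fintype {pa pb : ZMod 2} {a b : EDist1 K E} {τ : Type*} [Fintype τ]
    (c : τ → EDist2 K E) (h : τ → Idx K) (hK : ∀ i, Kbar K (h i))
    (hc : ∀ i, IsField2D K E (c i))
    (h1 : ∀ v m k, a m (b k v) = ∑ i, zwPow K E (-(h i)) (ev2 K E (c i) v) m k)
    (h2 : ∀ v m k, koszul K pa pb • (b k (a m v)) =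
      ∑ i, zwPowW K E (-(h i)) (ev2 K E (c i) v) m k) : IsLocal K E pa pb a b := by
  let e := (Fintype.equivFin τ).symm
  refine ⟨Fintype.card τ, c ∘ e, h ∘ e, fun i => hK _, fun i => hc _, fun v m k => ?_,
    fun v m k => ?_⟩
  · rw [h1]
    exact (Equiv.sum_comp e fun i => zwPow K E (-(h i)) (ev2 K E (c i) v) m k).symm
  · rw [h2]
    exact (Equiv.sum_comp e fun i => zwPowW K E (-(h i)) (ev2 K E (c i) v) m k).symm

lemma IsLocal.add {pa pb : ZMod 2} {a b b' : EDist1 K E} (h : IsLocal K E pa pb a b)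
    (h' : IsLocal K E pa pb a b') : IsLocal K E pa pb a (b + b') := by
  obtain ⟨r, c, e, hK, hc, h1, h2⟩ := h
  obtain ⟨r', c', e', hK', hc', h1', h2'⟩ := h'
  refine isLocal_of_fintype (Sum.elim c c') (Sum.elim e e') (by rintro (i | i); exacts [hK i, hK' i])
    (by rintro (i | i); exacts [hc i, hc' i]) (fun v m k => ?_) (fun v m k => ?_)
  · simp [Fintype.sum_sum_type, h1, h1']
  · simp [Fintype.sum_sum_type, h2, h2']

lemma ev2_smul_left (c : EDist2 K E) (x : K) (v : E) : ev2 K E (x • c) v = x • ev2 K E c v := by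
  ext; simp [ev2]

lemma IsLocal.smul {pa pb : ZMod 2} {a b : EDist1 K E} (h : IsLocal K E pa pb a b) (x : K) :
    IsLocal K E pa pb a (x • b) := by
  obtain ⟨r, c, e, hK, hc, h1, h2⟩ := h
  refine isLocal_of_fintype (fun i => x • c i) e hK
    (fun i v => by rw [ev2_smul_left]; exact (hc i v).smul x) (fun v m k => ?_) (fun v m k => ?_)
  · simp [ev2_smul_left, zwPow_smul, h1, Finset.smul_sum]
  · simp only [ev2_smul_left, zwPowW_smul, ← Finset.smul_sum, ← h2, Pi.smul_apply,
      LinearMap.smul_apply, smul_comm x]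

lemma IsLocal.zero {pa pb : ZMod 2} {a : EDist1 K E} : IsLocal K E pa pb a 0 :=
  ⟨0, fun i => i.elim0, fun i => i.elim0, fun i => i.elim0, fun i => i.elim0, by simp, by simp⟩

lemma koszul_smul_eq_zero {p q : ZMod 2} {v : E} (h : koszul K p q • v = 0) : v = 0 := by
  rw [koszul] at h
  split_ifs at h <;> simpa using h

lemma IsLocal.comm_eq_zero {pa pb : ZMod 2} {a b : EDist1 K E} (h : IsLocal K E pa pb a b) {v : E}
    (h0 : ∀ k, b k v = 0) (m k : Idx K) : b k (a m v) = 0 := by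
  obtain ⟨r, c, e, hK, hc, h1, h2⟩ := h
  apply koszul_smul_eq_zero (K := K) (p := pa) (q := pb)
  rw [h2]
  exact sum_zwPowW_eq_zero e hK (fun i => hc i v) (fun m k => by rw [← h1, h0, map_zero]) m k

variable {ι : Type*} (S : ι → EDist1 K E) (ps : ι → ZMod 2) (one : E) (T Tb : Module.End K E)

/-- translation covariant, weakly creative distributions local to all generators -/
structure Nice (p : ZMod 2) (x : EDist1 K E) : Prop where
  tc : TransCov K E T Tb x
  pow : IsPow1 K E (ev1 K E x one)
  loc : ∀ i, IsLocal K E (ps i) p (S i) x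

/-- iterated states -/
def wordState (l : List (ι × Idx K)) : E := l.foldr (fun t acc => S t.1 t.2 acc) one

variable {S ps one T Tb}

lemma TransCov.add {x y : EDist1 K E} (hx : TransCov K E T Tb x) (hy : TransCov K E T Tb y) :
    TransCov K E T Tb (x + y) := by
  constructor
  · intro n
    rw [Pi.add_apply, Pi.add_apply, smul_add, ← hx.1, ← hy.1, mul_add, add_mul]; abel
  · intro n
    rw [Pi.add_apply, Pi.add_apply, smul_add, ← hx.2, ← hy.2, mul_add, add_mul]; abel

lemma TransCov.smul {x : EDist1 K E} (hx : TransCov K E T Tb x) (a : K) :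
    TransCov K E T Tb (a • x) := by
  constructor
  · intro n
    rw [Pi.smul_apply, Pi.smul_apply, smul_comm, ← hx.1, smul_sub, mul_smul_comm, smul_mul_assoc]
  · intro n
    rw [Pi.smul_apply, Pi.smul_apply, smul_comm, ← hx.2, smul_sub, mul_smul_comm, smul_mul_assoc]

lemma Nice.add {p : ZMod 2} {x y : EDist1 K E} (hx : Nice S ps one T Tb p x)
    (hy : Nice S ps one T Tb p y) : Nice S ps one T Tb p (x + y) where
  tc := hx.tc.add hy.tc
  pow n hn := by
    by_cases h : ev1 K E x one n = 0
    · exact hy.pow n fun h' => hn (by simp only [ev1] at *; simp [h, h'])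
    · exact hx.pow n h
  loc i := (hx.loc i).add (hy.loc i)

lemma Nice.smul {p : ZMod 2} {x : EDist1 K E} (hx : Nice S ps one T Tb p x) (a : K) :
    Nice S ps one T Tb p (a • x) where
  tc := hx.tc.smul a
  pow n hn := hx.pow n fun h' => hn (by simp only [ev1] at *; simp [h'])
  loc i := (hx.loc i).smul a

lemma Nice.zero {p : ZMod 2} : Nice S ps one T Tb p 0 where
  tc := ⟨fun n => by simp, fun n => by simp⟩
  pow n hn := absurd rfl hn
  loc i := IsLocal.zero

lemma Nice.sub {p : ZMod 2} {x y : EDist1 K E} (hx : Nice S ps one T Tb p x)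
    (hy : Nice S ps one T Tb p y) : Nice S ps one T Tb p (x - y) := by
  have := hx.add (hy.smul (-1))
  rwa [neg_one_smul, ← sub_eq_add_neg] at this

/-- uniqueness of fields with given state -/
lemma Nice.eq_zero {p : ZMod 2} {x : EDist1 K E} (hx : Nice S ps one T Tb p x)
    (hT : T one = 0) (hTb : Tb one = 0)
    (hspan : Submodule.span K (Set.range (wordState S one)) = ⊤) (h0 : x (-1) one = 0) : x = 0 := by
  have h1 : ∀ l : List (ι × Idx K), ∀ n, x n (wordState S one l) = 0 := by
    intro l
    induction l with
    | nil =>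
      intro n
      by_contra hn
      obtain ⟨i, rfl⟩ := (negInt_pair_iff' _).1 (hx.pow n hn)
      exact hn (by rw [wordState, List.foldr_nil, hx.tc.creative hT hTb, h0, map_zero])
    | cons t l ih => exact fun n => (hx.loc t.1).comm_eq_zero ih _ _
  ext n v
  have hv : v ∈ Submodule.span K (Set.range (wordState S one)) := hspan ▸ Submodule.mem_top
  induction hv using Submodule.span_induction with
  | mem v h => obtain ⟨l, rfl⟩ := h; simpa using h1 l n
  | zero => simp
  | add v w _ _ h h' => simp only [map_add, h, h']
  | smul a v _ h => simp only [map_smul, h]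

lemma Nice.eq {p : ZMod 2} {x y : EDist1 K E} (hx : Nice S ps one T Tb p x)
    (hy : Nice S ps one T Tb p y) (hT : T one = 0) (hTb : Tb one = 0)
    (hspan : Submodule.span K (Set.range (wordState S one)) = ⊤)
    (h0 : x (-1) one = y (-1) one) : x = y := by
  rw [← sub_eq_zero]
  exact (hx.sub hy).eq_zero hT hTb hspan (by simp [h0])

end Goddard

section MultiVar
variable {K : Type*} [Field K] [CharZero K] {M : Type*} [AddCommGroup M] [Module K M] {r : ℕ}

def flipR (ρ : Fin r → ℕ) (p : Pairs r) : Bool := decide (ρ p.1.2 < ρ p.1.1)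

def leadV (f : Bool) (p : Pairs r) : Fin r := if f then p.1.2 else p.1.1

def tailV (f : Bool) (p : Pairs r) : Fin r := if f then p.1.1 else p.1.2

def dirV (f : Bool) (p : Pairs r) (x : Idx K) : Fin r → Idx K :=
  Pi.single (tailV f p) x - Pi.single (leadV f p) x

theorem pairs_ne (p : Pairs r) : p.1.1 ≠ p.1.2 := ne_of_lt p.2

theorem pairShift_eq (p : Pairs r) (h : Idx K) (f : Bool) (kk : ℕ × ℕ) :
    pairShift K p h f kk = Pi.single (leadV f p) h + dirV f p (nc kk) := by
  have hp := pairs_ne p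
  funext i
  unfold pairShift dirV leadV tailV
  by_cases h1 : i = p.1.1
  · subst h1
    cases f
    · simp [hp, nc, sub_eq_add_neg]
      ext <;> simp
    · simp [hp, nc]
  · by_cases h2 : i = p.1.2
    · subst h2
      cases f
      · simp [hp.symm, nc]
      · simp [hp.symm, nc, sub_eq_add_neg]
        ext <;> simp
    · cases f <;> simp [h1, h2]

theorem dirV_add (f : Bool) (p : Pairs r) (x y : Idx K) :
    dirV f p (x + y) = dirV f p x + dirV f p y := by
  simp only [dirV, Pi.single_add]; abel

theorem dirV_zero (f : Bool) (p : Pairs r) : dirV f p (0 : Idx K) = 0 := by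
  simp [dirV]

/-- the product of the binomials of all pairs, expanded according to the ranks `ρ` -/
def permMulR (ρ : Fin r → ℕ) (hs : Pairs r → Idx K) (c : DistN K M r) : DistN K M r :=
  fun m => ∑ᶠ κ : Pairs r → ℕ × ℕ,
    (∏ p : Pairs r, pairCoef K (hs p) (flipR ρ p) (κ p)) •
      c (fun i => m i + ∑ p : Pairs r, pairShift K p (hs p) (flipR ρ p) (κ p) i)

theorem permMul_eq_permMulR (σ : Equiv.Perm (Fin r)) (hs : Pairs r → Idx K) (c : DistN K M r) :
    permMul K M σ hs c = permMulR (fun i => (σ.symm i : ℕ)) hs c := by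
  have : flipOf σ = flipR (fun i => (σ.symm i : ℕ)) := by
    funext p
    simp [flipOf, flipR]
  unfold permMul permMulR
  rw [this]

def leadSum (ρ : Fin r → ℕ) (hs : Pairs r → Idx K) : Fin r → Idx K :=
  ∑ p, Pi.single (leadV (flipR ρ p) p) (hs p)

def dirSum (ρ : Fin r → ℕ) (κ : Pairs r → ℕ × ℕ) : Fin r → Idx K :=
  ∑ p, dirV (flipR ρ p) p (nc (κ p))

theorem permMulR_apply (ρ : Fin r → ℕ) (hs : Pairs r → Idx K) (c : DistN K M r)
    (m : Fin r → Idx K) :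
    permMulR ρ hs c m = ∑ᶠ κ : Pairs r → ℕ × ℕ,
      (∏ p : Pairs r, pairCoef K (hs p) (flipR ρ p) (κ p)) •
        c (m + leadSum ρ hs + dirSum ρ κ) := by
  unfold permMulR
  congr 1; funext κ; congr 2
  funext i
  simp only [pairShift_eq, leadSum, dirSum, Pi.add_apply, Finset.sum_apply,
    Finset.sum_add_distrib, add_assoc]

/-- multiplication by the binomial of one pair -/
def pairMul (ρ : Fin r → ℕ) (p : Pairs r) (h : Idx K) (c : DistN K M r) : DistN K M r :=
  fun m => ∑ᶠ k : ℕ × ℕ, pairCoef K h (flipR ρ p) k •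
    c (m + Pi.single (leadV (flipR ρ p) p) h + dirV (flipR ρ p) p (nc k))

theorem leadSum_add_single (ρ : Fin r → ℕ) (hs : Pairs r → Idx K) (p : Pairs r) (h : Idx K) :
    leadSum ρ (hs + Pi.single p h) = leadSum ρ hs + Pi.single (leadV (flipR ρ p) p) h := by
  simp only [leadSum, Pi.add_apply, Pi.single_add, Finset.sum_add_distrib]
  congr 1
  rw [Finset.sum_eq_single p]
  · simp
  · intro q _ hq
    rw [Pi.single_eq_of_ne hq]; simp
  · simp

theorem dirSum_add_single (ρ : Fin r → ℕ) (κ : Pairs r → ℕ × ℕ) (p : Pairs r) (k : ℕ × ℕ) :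
    (dirSum ρ (κ + Pi.single p k) : Fin r → Idx K) =
      dirSum ρ κ + dirV (flipR ρ p) p (nc k) := by
  simp only [dirSum, Pi.add_apply, nc_add, dirV_add, Finset.sum_add_distrib]
  congr 1
  rw [Finset.sum_eq_single p]
  · simp
  · intro q _ hq
    rw [Pi.single_eq_of_ne hq, nc_zero, dirV_zero]
  · simp

/-- a weight which is positive on the directions of expansion -/
def wt (ρ : Fin r → ℕ) : (Fin r → Idx K) →+ K :=
  AddMonoidHom.mk' (fun x => ∑ i, ((ρ i : K) + 1) * ((x i).1 + (x i).2)) (by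
    intro x y
    rw [← Finset.sum_add_distrib]
    refine Finset.sum_congr rfl fun i _ => ?_
    simp only [Pi.add_apply, Prod.fst_add, Prod.snd_add]; ring)

theorem wt_apply (ρ : Fin r → ℕ) (x : Fin r → Idx K) :
    wt ρ x = ∑ i, ((ρ i : K) + 1) * ((x i).1 + (x i).2) := rfl

theorem wt_single (ρ : Fin r → ℕ) (i : Fin r) (x : Idx K) :
    wt ρ (Pi.single i x) = ((ρ i : K) + 1) * (x.1 + x.2) := by
  rw [wt_apply, Finset.sum_eq_single i]
  · simp
  · intro j _ hj
    rw [Pi.single_eq_of_ne hj]; simp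
  · simp

theorem wt_dirV (ρ : Fin r → ℕ) (p : Pairs r) (hp : ρ p.1.1 ≠ ρ p.1.2) (k : ℕ × ℕ) :
    ∃ N : ℕ, wt ρ (dirV (flipR ρ p) p (nc k : Idx K)) = N ∧ k.1 + k.2 ≤ N := by
  have key : ρ (leadV (flipR ρ p) p) < ρ (tailV (flipR ρ p) p) := by
    unfold leadV tailV flipR
    by_cases h : ρ p.1.2 < ρ p.1.1
    · simp [h]
    · simp [h]; omega
  obtain ⟨d, hd⟩ := Nat.exists_eq_add_of_lt key
  refine ⟨(d + 1) * (k.1 + k.2), ?_, Nat.le_mul_of_pos_left _ (Nat.succ_pos d)⟩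
  rw [dirV, map_sub, wt_single, wt_single, hd]
  simp only [nc]
  push_cast; ring

/-- the condition on the support which makes the expansions with ranks `ρ` summable -/
structure Adm (ρ : Fin r → ℕ) (D : DistN K M r) : Prop where
  cone : ∀ w : K, ∃ N₀ : ℕ, ∀ x (N : ℕ), D x ≠ 0 → wt ρ x = w + N → N ≤ N₀
  line : ∀ i j, i ≠ j → ρ i = ρ j → ∀ y : Fin r → Idx K,
    {m : Idx K | D (y + Pi.single i m - Pi.single j m) ≠ 0}.Finite

def ZeroEq (ρ : Fin r → ℕ) (hs : Pairs r → Idx K) : Prop :=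
  ∀ p, ρ p.1.1 = ρ p.1.2 → hs p = 0

theorem adm_of_inLatN (ρ : Fin r → ℕ) {c : DistN K M r} (hc : InLatN K M c) : Adm ρ c := by
  rw [inLatN_iff] at hc
  obtain ⟨S, hS⟩ := hc
  refine ⟨fun w => ?_, fun i j hij hρ y => ?_⟩
  · refine ⟨S.sup fun s => if h : ∃ n : ℕ, wt ρ s - w = n then h.choose else 0,
      fun x N hx hN => ?_⟩
    obtain ⟨s, hs, k, hk⟩ := hS x hx
    refine le_trans ?_ (Finset.le_sup hs)
    have hw : wt ρ x = wt ρ s - ((∑ i, (ρ i + 1) * ((k i).1 + (k i).2) : ℕ) : K) := by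
      rw [wt_apply, wt_apply]
      push_cast
      rw [← Finset.sum_sub_distrib]
      refine Finset.sum_congr rfl fun i _ => ?_
      rw [hk i]; simp only [nc, Prod.fst_sub, Prod.snd_sub]; ring
    generalize (∑ i, (ρ i + 1) * ((k i).1 + (k i).2) : ℕ) = N' at hw
    have hex : ∃ n : ℕ, wt ρ s - w = n := ⟨N + N', by push_cast; linear_combination hN - hw⟩
    rw [dif_pos hex]
    have h1 := hex.choose_spec
    have h2 : ((hex.choose : ℕ) : K) = ((N + N' : ℕ) : K) := by
      rw [← h1]; push_cast; linear_combination hN - hw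
    have h3 := Nat.cast_injective h2
    omega
  · have : {m : Idx K | c (y + Pi.single i m - Pi.single j m) ≠ 0} ⊆
        ⋃ s ∈ S, (fun k : ℕ × ℕ => s i - nc k - y i) ''
          {k | ∃ k', nc k + nc k' = s i + s j - y i - y j} := by
      intro m hm
      obtain ⟨s, hs, k, hk⟩ := hS _ hm
      have h1 := hk i
      have h2 := hk j
      simp only [Pi.add_apply, Pi.sub_apply, Pi.single_eq_same, Pi.single_eq_of_ne hij,
        Pi.single_eq_of_ne hij.symm, sub_zero, add_zero] at h1 h2
      simp only [Set.mem_iUnion, Set.mem_image]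
      refine ⟨s, hs, k i, ⟨k j, ?_⟩, ?_⟩
      · linear_combination h1 + h2
      · linear_combination -h1
    refine Set.Finite.subset (S.finite_toSet.biUnion fun s _ => ?_) this
    exact (finite_nc_add _).image _

theorem Adm.bound {ρ : Fin r → ℕ} {D : DistN K M r} (hD : Adm ρ D) {p : Pairs r}
    (hp : ρ p.1.1 ≠ ρ p.1.2) (w : K) :
    {k : ℕ × ℕ | ∃ y, wt ρ y = w ∧ D (y + dirV (flipR ρ p) p (nc k)) ≠ 0}.Finite := by
  obtain ⟨N₀, hN⟩ := hD.cone w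
  refine Set.Finite.subset (Set.finite_Iic (N₀, N₀)) ?_
  rintro k ⟨y, hy, hk⟩
  obtain ⟨N, hN1, hN2⟩ := wt_dirV (K := K) ρ p hp k
  have := hN _ N hk (by rw [map_add, hy, hN1])
  exact Prod.mk_le_mk.2 ⟨by omega, by omega⟩

theorem pairCoef_eq (h : Idx K) (f : Bool) (k : ℕ × ℕ) :
    pairCoef K h f k = (if f then negOnePow K (h.1 - h.2) else 1) * (-1) ^ (k.1 + k.2) *
      C2 h k := by
  simp only [pairCoef, C2]; ring

theorem pairCoef_zero (f : Bool) (k : ℕ × ℕ) :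
    pairCoef K (0 : Idx K) f k = if k = 0 then 1 else 0 := by
  rw [pairCoef_eq, C2_zero_left]
  split_ifs with h1 h2 <;> simp_all [negOnePow_zero]

theorem pairCoef_add {h h' : Idx K} (hh : Kbar K h) (hh' : Kbar K h') (f : Bool) (n : ℕ × ℕ) :
    pairCoef K (h + h') f n = ∑ k ∈ Finset.Iic n, pairCoef K h f k * pairCoef K h' f (n - k) := by
  rw [pairCoef_eq, C2_add, Finset.mul_sum]
  refine Finset.sum_congr rfl fun k hk => ?_
  rw [pairCoef_eq, pairCoef_eq]
  have hk' : k ≤ n := Finset.mem_Iic.1 hk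
  have e1 : n.1 + n.2 = (k.1 + k.2) + ((n - k).1 + (n - k).2) := by
    have := hk'.1; have := hk'.2
    simp only [Prod.fst_sub, Prod.snd_sub]; omega
  have e2 : (if f then negOnePow K ((h + h').1 - (h + h').2) else 1) =
      (if f then negOnePow K (h.1 - h.2) else 1) * (if f then negOnePow K (h'.1 - h'.2) else 1) := by
    cases f
    · simp
    · simp only [if_true]
      rw [← negOnePow_add hh hh']
      congr 1
      simp only [Prod.fst_add, Prod.snd_add]; ring
  rw [e1, e2, pow_add]; ring

theorem wt_dirSum (ρ : Fin r → ℕ) (κ : Pairs r → ℕ × ℕ) (hκ : ∀ p, ρ p.1.1 = ρ p.1.2 → κ p = 0) :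
    ∃ N : ℕ, wt ρ (dirSum ρ κ : Fin r → Idx K) = N ∧ ∀ p, (κ p).1 + (κ p).2 ≤ N := by
  have h : ∀ p, ∃ N : ℕ, wt ρ (dirV (flipR ρ p) p (nc (κ p) : Idx K)) = N ∧
      (κ p).1 + (κ p).2 ≤ N := by
    intro p
    by_cases hp : ρ p.1.1 = ρ p.1.2
    · exact ⟨0, by rw [hκ p hp, nc_zero, dirV_zero]; simp, by rw [hκ p hp]; simp⟩
    · exact wt_dirV ρ p hp _
  choose N hN1 hN2 using h
  refine ⟨∑ p, N p, ?_, fun p => (hN2 p).trans (Finset.single_le_sum (fun _ _ => Nat.zero_le _)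
    (Finset.mem_univ p))⟩
  rw [dirSum, map_sum]; push_cast
  exact Finset.sum_congr rfl fun p _ => hN1 p

theorem ok_of_prod_ne {ρ : Fin r → ℕ} {hs : Pairs r → Idx K} (hz : ZeroEq ρ hs)
    {κ : Pairs r → ℕ × ℕ} (h : ∏ p, pairCoef K (hs p) (flipR ρ p) (κ p) ≠ 0) (p : Pairs r)
    (hp : ρ p.1.1 = ρ p.1.2) : κ p = 0 := by
  by_contra h0
  refine h (Finset.prod_eq_zero (Finset.mem_univ p) ?_)
  rw [hz p hp, pairCoef_zero, if_neg h0]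

theorem Adm.bound_dirSum {ρ : Fin r → ℕ} {D : DistN K M r} (hD : Adm ρ D) (w : K) :
    {κ : Pairs r → ℕ × ℕ | (∀ p, ρ p.1.1 = ρ p.1.2 → κ p = 0) ∧
      ∃ y, wt ρ y = w ∧ D (y + dirSum ρ κ) ≠ 0}.Finite := by
  obtain ⟨N₀, hN⟩ := hD.cone w
  refine Set.Finite.subset (Set.finite_Icc 0 (fun _ => (N₀, N₀))) ?_
  rintro κ ⟨hκ, y, hy, hk⟩
  obtain ⟨N, hN1, hN2⟩ := wt_dirSum (K := K) ρ κ hκ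
  have := hN _ N hk (by rw [map_add, hy, hN1])
  refine ⟨fun p => zero_le, fun p => ?_⟩
  have := hN2 p
  exact Prod.mk_le_mk.2 ⟨by omega, by omega⟩

theorem finite_permMulR {ρ : Fin r → ℕ} {D : DistN K M r} (hD : Adm ρ D) {hs : Pairs r → Idx K}
    (hz : ZeroEq ρ hs) (y : Fin r → Idx K) :
    (Function.support fun κ : Pairs r → ℕ × ℕ =>
      (∏ p, pairCoef K (hs p) (flipR ρ p) (κ p)) • D (y + dirSum ρ κ)).Finite := by
  refine (hD.bound_dirSum (wt ρ y)).subset fun κ hκ => ?_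
  exact ⟨ok_of_prod_ne hz (left_ne_zero_of_smul hκ), y, rfl, right_ne_zero_of_smul hκ⟩

theorem finite_pairMul {ρ : Fin r → ℕ} {D : DistN K M r} (hD : Adm ρ D) {p : Pairs r}
    (hp : ρ p.1.1 ≠ ρ p.1.2) (h : Idx K) (y : Fin r → Idx K) :
    (Function.support fun k : ℕ × ℕ =>
      pairCoef K h (flipR ρ p) k • D (y + dirV (flipR ρ p) p (nc k))).Finite :=
  (hD.bound hp (wt ρ y)).subset fun _ hk => ⟨y, rfl, right_ne_zero_of_smul hk⟩

theorem pairMul_permMulR {ρ : Fin r → ℕ} {D : DistN K M r} (hD : Adm ρ D) {hs : Pairs r → Idx K}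
    (hz : ZeroEq ρ hs) (hK : ∀ q, Kbar K (hs q)) {p : Pairs r} (hp : ρ p.1.1 ≠ ρ p.1.2)
    {h : Idx K} (hh : Kbar K h) :
    pairMul ρ p h (permMulR ρ hs D) = permMulR ρ (hs + Pi.single p h) D := by
  funext n
  rw [permMulR_apply, leadSum_add_single]
  set y := n + (leadSum ρ hs + Pi.single (leadV (flipR ρ p) p) h) with hy
  set u : (ℕ × ℕ) → (Pairs r → ℕ × ℕ) → K := fun k κ =>
    pairCoef K h (flipR ρ p) k * ∏ q, pairCoef K (hs q) (flipR ρ q) (κ q) with hu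
  set g : (Pairs r → ℕ × ℕ) × (ℕ × ℕ) → M := fun x =>
    if x.2 ≤ x.1 p then u x.2 (x.1 - Pi.single p x.2) • D (y + dirSum ρ x.1) else 0 with hg
  set f : (ℕ × ℕ) × (Pairs r → ℕ × ℕ) → (Pairs r → ℕ × ℕ) × (ℕ × ℕ) :=
    fun x => (x.2 + Pi.single p x.1, x.1) with hf
  have hgf : ∀ x, g (f x) = u x.1 x.2 • D (y + dirSum ρ (x.2 + Pi.single p x.1)) := by
    intro x
    have : x.1 ≤ (x.2 + Pi.single p x.1 : Pairs r → ℕ × ℕ) p := by simp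
    simp only [hg, hf]
    rw [if_pos this, add_tsub_cancel_right]
  have hfi : Function.Injective f := by
    rintro ⟨k, κ⟩ ⟨k', κ'⟩ hx
    simp only [hf, Prod.mk.injEq] at hx
    obtain ⟨h1, rfl⟩ := hx
    rw [add_right_cancel h1]
  have hrange : ∀ x, x ∉ Set.range f → g x = 0 := by
    rintro ⟨κ, k⟩ hx
    simp only [hg]
    rw [if_neg]
    intro hle
    refine hx ⟨(k, κ - Pi.single p k), ?_⟩
    simp only [hf, Prod.mk.injEq, and_true]
    funext q
    by_cases hq : q = p
    · subst hq; simp [tsub_add_cancel_of_le hle]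
    · simp [Pi.single_eq_of_ne hq]
  have hgfin : (Function.support g).Finite := by
    have hF := hD.bound_dirSum (wt ρ y)
    refine Set.Finite.subset (hF.biUnion fun κ _ => (Set.finite_Iic (κ p)).image fun k => (κ, k)) ?_
    rintro ⟨κ, k⟩ hx
    have hx' : g (κ, k) ≠ 0 := hx
    simp only [hg] at hx'
    split_ifs at hx' with hle
    · have h1 := left_ne_zero_of_smul hx'
      simp only [Set.mem_iUnion]
      refine ⟨κ, ⟨fun q hq => ?_, y, rfl, right_ne_zero_of_smul hx'⟩, k, hle, rfl⟩
      have h2 := ok_of_prod_ne hz (right_ne_zero_of_mul h1) q hq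
      have hqp : q ≠ p := by rintro rfl; exact hp hq
      simpa [Pi.single_eq_of_ne hqp] using h2
    · exact absurd rfl hx'
  have hgffin : (Function.support fun x => g (f x)).Finite :=
    (hgfin.preimage hfi.injOn).subset fun x hx => hx
  have h1 : pairMul ρ p h (permMulR ρ hs D) n = ∑ᶠ x, g (f x) := by
    rw [finsum_curry _ hgffin]
    unfold pairMul
    congr 1; funext k
    rw [permMulR_apply]
    rw [smul_finsum]
    congr 1; funext κ
    rw [hgf, smul_smul, dirSum_add_single]
    simp only [hu]
    congr 2
    simp only [hy]; abel
  rw [h1, ← finsum_of_injective hfi g hrange, finsum_curry g hgfin]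
  congr 1; funext κ
  have h2 : ∑ᶠ k, g (κ, k) = ∑ k ∈ Finset.Iic (κ p), g (κ, k) := by
    refine finsum_eq_sum_of_support_subset _ fun k hk => ?_
    rw [Finset.coe_Iic]
    by_contra hle
    exact hk (if_neg hle)
  rw [h2]
  have h3 : ∀ k ∈ Finset.Iic (κ p), g (κ, k) =
      (pairCoef K h (flipR ρ p) k * pairCoef K (hs p) (flipR ρ p) (κ p - k) *
        ∏ q ∈ Finset.univ.erase p, pairCoef K (hs q) (flipR ρ q) (κ q)) •
          D (y + dirSum ρ κ) := by
    intro k hk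
    simp only [hg]
    rw [if_pos (Finset.mem_Iic.1 hk)]
    congr 1
    simp only [hu]
    rw [← Finset.mul_prod_erase Finset.univ _ (Finset.mem_univ p), ← mul_assoc]
    congr 1
    · simp
    · refine Finset.prod_congr rfl fun q hq => ?_
      simp [Pi.single_eq_of_ne (Finset.ne_of_mem_erase hq)]
  rw [Finset.sum_congr rfl h3, ← Finset.sum_smul, ← Finset.sum_mul,
    ← pairCoef_add hh (hK p), ← Finset.mul_prod_erase Finset.univ _ (Finset.mem_univ p)]
  congr 1
  congr 1
  · simp [add_comm]
  · refine Finset.prod_congr rfl fun q hq => ?_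
    simp [Pi.single_eq_of_ne (Finset.ne_of_mem_erase hq)]

theorem permMulR_zero (ρ : Fin r → ℕ) (D : DistN K M r) : permMulR ρ 0 D = D := by
  funext n
  rw [permMulR_apply, finsum_eq_single _ (0 : Pairs r → ℕ × ℕ)]
  · simp [leadSum, dirSum, nc_zero, dirV_zero, pairCoef_zero]
  · intro κ hκ
    obtain ⟨p, hp⟩ := Function.ne_iff.1 hκ
    rw [Finset.prod_eq_zero (Finset.mem_univ p), zero_smul]
    rw [Pi.zero_apply, pairCoef_zero]
    exact if_neg hp

theorem Adm.permMulR {ρ : Fin r → ℕ} {D : DistN K M r} (hD : Adm ρ D) {hs : Pairs r → Idx K}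
    (hz : ZeroEq ρ hs) : Adm ρ (permMulR ρ hs D) := by
  refine ⟨fun w => ?_, fun i j hij hρ y => ?_⟩
  · obtain ⟨N₀, hN⟩ := hD.cone (w + wt ρ (leadSum ρ hs))
    refine ⟨N₀, fun x N hx hw => ?_⟩
    rw [permMulR_apply] at hx
    obtain ⟨κ, hκ⟩ := exists_ne_zero_of_finsum hx
    obtain ⟨N', hN1, hN2⟩ := wt_dirSum (K := K) ρ κ (ok_of_prod_ne hz (left_ne_zero_of_smul hκ))
    have := hN _ (N + N') (right_ne_zero_of_smul hκ)
      (by rw [map_add, map_add, hw, hN1]; push_cast; ring)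
    omega
  · have hfin := hD.bound_dirSum (wt ρ (y + leadSum ρ hs))
    refine Set.Finite.subset (hfin.biUnion fun κ _ => hD.line i j hij hρ
      (y + leadSum ρ hs + dirSum ρ κ)) ?_
    intro m hm
    rw [Set.mem_ofPred_eq, permMulR_apply] at hm
    obtain ⟨κ, hκ⟩ := exists_ne_zero_of_finsum hm
    have hk' := right_ne_zero_of_smul hκ
    have e : y + Pi.single i m - Pi.single j m + leadSum ρ hs + dirSum ρ κ =
      y + leadSum ρ hs + dirSum ρ κ + Pi.single i m - Pi.single j m := by abel
    simp only [Set.mem_iUnion]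
    refine ⟨κ, ⟨ok_of_prod_ne hz (left_ne_zero_of_smul hκ),
      y + Pi.single i m - Pi.single j m + leadSum ρ hs, ?_, hk'⟩, ?_⟩
    · simp only [map_add, map_sub, wt_single, hρ]; ring
    · rw [Set.mem_ofPred_eq]
      rwa [e] at hk'

end MultiVar

section Merge
variable {K : Type*} [Field K] [CharZero K] {M : Type*} [AddCommGroup M] [Module K M] {r : ℕ}

theorem finsum_swap {α β : Type*} (F : α → β → M)
    (h : (Function.support fun x : α × β => F x.1 x.2).Finite) :
    ∑ᶠ a, ∑ᶠ b, F a b = ∑ᶠ b, ∑ᶠ a, F a b := by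
  rw [← finsum_curry (fun x : α × β => F x.1 x.2) h,
    ← finsum_comp_equiv (Equiv.prodComm β α),
    finsum_curry]
  · rfl
  · exact (h.preimage (Equiv.prodComm β α).injective.injOn).subset fun x hx => hx

theorem lift_pi (k : Fin r) {y : Fin (r + 1)} (hy : y ≠ k.castSucc) :
    k.castSucc.succAbove (k.predAbove y) = y := by
  exact Fin.succAbove_predAbove hy

theorem lift_k (k : Fin r) : k.castSucc.succAbove k = k.succ := by
  simp

theorem lift_ne (k : Fin r) (j : Fin r) : k.castSucc.succAbove j ≠ k.castSucc :=
  Fin.succAbove_ne _ _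

theorem pi_lift (k j : Fin r) : k.predAbove (k.castSucc.succAbove j) = j := by
  exact Fin.predAbove_succAbove k j

/-- splitting the merged variable: its exponent is put at `k.succ` -/
def unmerge (k : Fin r) : (Fin r → Idx K) →+ (Fin (r + 1) → Idx K) :=
  AddMonoidHom.mk' (fun n y => if y = k.castSucc then 0 else n (k.predAbove y)) (by
    intro x y; funext i
    by_cases h : i = k.castSucc <;> simp [h])

theorem unmerge_apply (k : Fin r) (n : Fin r → Idx K) (y : Fin (r + 1)) :
    unmerge k n y = if y = k.castSucc then 0 else n (k.predAbove y) := rfl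

theorem unmerge_single (k j : Fin r) (x : Idx K) :
    unmerge k (Pi.single j x) = Pi.single (k.castSucc.succAbove j) x := by
  funext y
  rw [unmerge_apply]
  by_cases h : y = k.castSucc
  · subst h
    rw [if_pos rfl, Pi.single_eq_of_ne (lift_ne k j).symm]
  · rw [if_neg h]
    by_cases h2 : y = k.castSucc.succAbove j
    · subst h2
      rw [pi_lift, Pi.single_eq_same, Pi.single_eq_same]
    · rw [Pi.single_eq_of_ne h2, Pi.single_eq_of_ne]
      intro h3
      rw [← h3, lift_pi k h] at h2
      exact h2 rfl

/-- the argument of the slice of a distribution in the variables to be merged -/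
def splitArg (k : Fin r) (e n : Fin r → Idx K) (m : Idx K) : Fin (r + 1) → Idx K :=
  unmerge k (n - e) + Pi.single k.castSucc m - Pi.single k.succ m

/-- the divided derivative of order `e` in the variable `k.castSucc`, restricted to the diagonal
of the variables `k.castSucc` and `k.succ` -/
def mergeD (k : Fin r) (e : ℕ × ℕ) (D : DistN K M (r + 1)) : DistN K M r :=
  fun n => ∑ᶠ m : Idx K, C2 (-m - 1) e • D (splitArg k (Pi.single k (nc e + 1)) n m)

theorem pi_lt {k : Fin r} {p : Pairs (r + 1)} (hp : p.1 ≠ (k.castSucc, k.succ)) :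
    k.predAbove p.1.1 < k.predAbove p.1.2 := by
  refine lt_of_le_of_ne (Fin.predAbove_right_monotone k p.2.le) fun h => ?_
  by_cases h1 : p.1.1 = k.castSucc
  · by_cases h2 : p.1.2 = k.castSucc
    · exact pairs_ne p (h1.trans h2.symm)
    · have := lift_pi k h2
      rw [← h, h1, Fin.predAbove_castSucc_self, lift_k] at this
      exact hp (Prod.ext h1 this.symm)
  · by_cases h2 : p.1.2 = k.castSucc
    · have := lift_pi k h1
      rw [h, h2, Fin.predAbove_castSucc_self, lift_k] at this
      have h3 := p.2
      rw [← this, h2] at h3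
      simp [Fin.lt_def] at h3
    · exact pairs_ne p (by rw [← lift_pi k h1, ← lift_pi k h2, h])

/-- the pair of merged variables belonging to a pair -/
def mergePair (k : Fin r) (p : Pairs (r + 1)) (hp : p.1 ≠ (k.castSucc, k.succ)) : Pairs r :=
  ⟨(k.predAbove p.1.1, k.predAbove p.1.2), pi_lt hp⟩

/-- the coefficients in the product rule -/
def mergeCoef (k : Fin r) (p : Pairs (r + 1)) (h : Idx K) (l : ℕ × ℕ) : K :=
  if p.1.1 = k.castSucc then C2 h l
  else if p.1.2 = k.castSucc then (-1) ^ (l.1 + l.2) * C2 h l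
  else if l = 0 then 1 else 0

theorem pairCoef_sub_mul {h : Idx K} (hh : Kbar K h) (f : Bool) (l i : ℕ × ℕ) :
    pairCoef K h f i * C2 (h - nc i) l =
      ((if f then (-1) ^ (l.1 + l.2) else 1) * C2 h l) * pairCoef K (h - nc l) f i := by
  have key := C2_mul_comm h i l
  rw [pairCoef_eq, pairCoef_eq]
  cases f
  · simp only [Bool.false_eq_true, if_false]
    linear_combination (-1) ^ (i.1 + i.2) * key
  · simp only [if_true]
    have e2 : (h.1 - h.2) = ((h - nc l : Idx K).1 - (h - nc l : Idx K).2) +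
        ((nc l : Idx K).1 - (nc l : Idx K).2) := by
      simp only [Prod.fst_sub, Prod.snd_sub]; ring
    have hk : Kbar K (h - nc l) := by
      rw [sub_eq_add_neg]; exact hh.add (Kbar_nc l).neg
    rw [e2, negOnePow_add hk (Kbar_nc l), negOnePow_nc]
    linear_combination (negOnePow K ((h - nc l : Idx K).1 - (h - nc l : Idx K).2)) *
      (-1) ^ (l.1 + l.2) * (-1) ^ (i.1 + i.2) * key

theorem pairCoef_add_mul {h : Idx K} (hh : Kbar K h) (f : Bool) (l i : ℕ × ℕ) :
    pairCoef K h f (i + l) * C2 (nc (i + l)) l =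
      ((if f then 1 else (-1) ^ (l.1 + l.2)) * C2 h l) * pairCoef K (h - nc l) f i := by
  have key := C2_add_mul h i l
  have hs : (-1 : K) ^ ((i + l).1 + (i + l).2) = (-1) ^ (i.1 + i.2) * (-1) ^ (l.1 + l.2) := by
    rw [← pow_add]; congr 1; simp only [Prod.fst_add, Prod.snd_add]; ring
  rw [pairCoef_eq, pairCoef_eq, hs]
  cases f
  · simp only [Bool.false_eq_true, if_false]
    linear_combination (-1) ^ (i.1 + i.2) * (-1) ^ (l.1 + l.2) * key
  · simp only [if_true]
    have e2 : (h.1 - h.2) = ((h - nc l : Idx K).1 - (h - nc l : Idx K).2) +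
        ((nc l : Idx K).1 - (nc l : Idx K).2) := by
      simp only [Prod.fst_sub, Prod.snd_sub]; ring
    have hk : Kbar K (h - nc l) := by
      rw [sub_eq_add_neg]; exact hh.add (Kbar_nc l).neg
    have h1 : (-1 : K) ^ (l.1 + l.2) * (-1) ^ (l.1 + l.2) = 1 := by
      rw [← pow_add, ← two_mul, pow_mul]; simp
    rw [e2, negOnePow_add hk (Kbar_nc l), negOnePow_nc]
    linear_combination (negOnePow K ((h - nc l : Idx K).1 - (h - nc l : Idx K).2)) *
      (-1) ^ (l.1 + l.2) * (-1) ^ (i.1 + i.2) * (-1) ^ (l.1 + l.2) * key +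
      (negOnePow K ((h - nc l : Idx K).1 - (h - nc l : Idx K).2)) * (-1) ^ (i.1 + i.2) *
        C2 h l * C2 (h - nc l) i * h1

/-- the exponent of the variable `k.castSucc` in the expansion of the binomial of a pair -/
def mergeExp (k : Fin r) (f : Bool) (p : Pairs (r + 1)) (h : Idx K) (i : ℕ × ℕ) : Idx K :=
  if leadV f p = k.castSucc then h - nc i else if tailV f p = k.castSucc then nc i else 0

theorem leadV_mergePair {k : Fin r} {p : Pairs (r + 1)} (hp : p.1 ≠ (k.castSucc, k.succ))
    (f : Bool) : leadV f (mergePair k p hp) = k.predAbove (leadV f p) := by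
  cases f <;> rfl

theorem tailV_mergePair {k : Fin r} {p : Pairs (r + 1)} (hp : p.1 ≠ (k.castSucc, k.succ))
    (f : Bool) : tailV f (mergePair k p hp) = k.predAbove (tailV f p) := by
  cases f <;> rfl

theorem lead_ne_tail (f : Bool) (p : Pairs r) : leadV f p ≠ tailV f p := by
  cases f
  · exact pairs_ne p
  · exact (pairs_ne p).symm

theorem mergeCoef_lead {k : Fin r} {p : Pairs (r + 1)} {f : Bool}
    (h : leadV f p = k.castSucc) (x : Idx K) (l : ℕ × ℕ) :
    mergeCoef k p x l = (if f then (-1) ^ (l.1 + l.2) else 1) * C2 x l := by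
  have := pairs_ne p
  cases f
  · simp only [leadV] at h
    simp_all [mergeCoef]
  · simp only [leadV] at h
    simp_all [mergeCoef]

theorem mergeCoef_tail {k : Fin r} {p : Pairs (r + 1)} {f : Bool}
    (h : tailV f p = k.castSucc) (x : Idx K) (l : ℕ × ℕ) :
    mergeCoef k p x l = (if f then 1 else (-1) ^ (l.1 + l.2)) * C2 x l := by
  have := pairs_ne p
  cases f
  · simp only [tailV] at h
    simp_all [mergeCoef]
  · simp only [tailV] at h
    simp_all [mergeCoef]

theorem mergeCoef_none {k : Fin r} {p : Pairs (r + 1)} {f : Bool}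
    (h : leadV f p ≠ k.castSucc) (h' : tailV f p ≠ k.castSucc) (x : Idx K) (l : ℕ × ℕ) :
    mergeCoef k p x l = if l = 0 then 1 else 0 := by
  cases f
  · simp only [leadV, tailV] at h h'
    simp_all [mergeCoef]
  · simp only [leadV, tailV] at h h'
    simp_all [mergeCoef]

theorem finsum_mergeExp {k : Fin r} {p : Pairs (r + 1)} (hp : p.1 ≠ (k.castSucc, k.succ))
    (f : Bool) {h : Idx K} (hh : Kbar K h) (l : ℕ × ℕ) (G : (Fin r → Idx K) → M) :
    ∑ᶠ i : ℕ × ℕ, (pairCoef K h f i * C2 (mergeExp k f p h i) l) •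
      G (Pi.single (leadV f (mergePair k p hp)) h + dirV f (mergePair k p hp) (nc i)) =
    mergeCoef k p h l • ∑ᶠ i : ℕ × ℕ, pairCoef K (h - nc l) f i •
      G (Pi.single (leadV f (mergePair k p hp)) (h - nc l) + dirV f (mergePair k p hp) (nc i) +
        Pi.single k (nc l)) := by
  rw [smul_finsum]
  by_cases h1 : leadV f p = k.castSucc
  · have hl : leadV f (mergePair k p hp) = k := by
      rw [leadV_mergePair, h1, Fin.predAbove_castSucc_self]
    congr 1; funext i
    rw [mergeExp, if_pos h1, pairCoef_sub_mul hh, mergeCoef_lead h1, smul_smul, hl]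
    congr 2
    have : h = h - nc l + nc l := by ring
    conv_lhs => rw [this, Pi.single_add]
    abel
  · by_cases h2 : tailV f p = k.castSucc
    · have hl : tailV f (mergePair k p hp) = k := by
        rw [tailV_mergePair, h2, Fin.predAbove_castSucc_self]
      rw [finsum_of_injective (f := fun i : ℕ × ℕ => i + l) (add_left_injective l)]
      · congr 1; funext i
        rw [mergeExp, if_neg h1, if_pos h2, pairCoef_add_mul hh, mergeCoef_tail h2, smul_smul]
        congr 2
        simp only [nc_add, dirV, hl, Pi.single_add, Pi.single_sub]
        abel
      · intro i hi
        rw [mergeExp, if_neg h1, if_pos h2, C2_nc_eq_zero, mul_zero, zero_smul]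
        intro hle
        exact hi ⟨i - l, tsub_add_cancel_of_le hle⟩
    · congr 1; funext i
      rw [mergeExp, if_neg h1, if_neg h2, mergeCoef_none h1 h2, C2_zero_left]
      by_cases hl : l = 0
      · subst hl
        simp [nc_zero]
      · simp [hl]

theorem splitArg_mergeExp {k : Fin r} {p : Pairs (r + 1)} (hp : p.1 ≠ (k.castSucc, k.succ))
    (f : Bool) (h : Idx K) (i : ℕ × ℕ) (e n : Fin r → Idx K) (m : Idx K) :
    splitArg k e n m + Pi.single (leadV f p) h + dirV f p (nc i) =
      splitArg k e (n + (Pi.single (leadV f (mergePair k p hp)) h +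
        dirV f (mergePair k p hp) (nc i))) (m + mergeExp k f p h i) := by
  have hlt := lead_ne_tail f p
  have e1 : n + (Pi.single (leadV f (mergePair k p hp)) h + dirV f (mergePair k p hp) (nc i)) - e =
      (n - e) + (Pi.single (leadV f (mergePair k p hp)) h +
        dirV f (mergePair k p hp) (nc i)) := by abel
  rw [splitArg, splitArg, e1]
  simp only [map_add, map_sub, dirV, unmerge_single, leadV_mergePair,
    tailV_mergePair]
  by_cases h1 : leadV f p = k.castSucc
  · have h2 : tailV f p ≠ k.castSucc := fun h => hlt (h1.trans h.symm)
    rw [mergeExp, if_pos h1, lift_pi k h2, h1, Fin.predAbove_castSucc_self, lift_k]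
    simp only [Pi.single_add, Pi.single_sub]
    abel
  · by_cases h2 : tailV f p = k.castSucc
    · rw [mergeExp, if_neg h1, if_pos h2, lift_pi k h1, h2, Fin.predAbove_castSucc_self, lift_k]
      simp only [Pi.single_add]
      abel
    · rw [mergeExp, if_neg h1, if_neg h2, lift_pi k h1, lift_pi k h2]
      simp only [add_zero]
      abel

theorem Adm.finite_splitArg {ρ : Fin r → ℕ} {k : Fin r} {D : DistN K M (r + 1)}
    (hD : Adm (fun y => ρ (k.predAbove y)) D) (e n : Fin r → Idx K) :
    {m | D (splitArg k e n m) ≠ 0}.Finite :=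
  hD.line k.castSucc k.succ (ne_of_lt (by simp [Fin.lt_def])) (by simp) _

theorem wt_splitArg (ρ : Fin r → ℕ) (k : Fin r) (e n : Fin r → Idx K) (m : Idx K) :
    wt (fun y => ρ (k.predAbove y)) (splitArg k e n m) =
      wt (fun y => ρ (k.predAbove y)) (unmerge k (n - e)) := by
  simp only [splitArg, map_add, map_sub, wt_single, Fin.predAbove_castSucc_self,
    Fin.predAbove_succ_self]
  ring

theorem mergeD_pairMul {ρ : Fin r → ℕ} {k : Fin r} {D : DistN K M (r + 1)}
    (hD : Adm (fun y => ρ (k.predAbove y)) D) {p : Pairs (r + 1)}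
    (hp : p.1 ≠ (k.castSucc, k.succ))
    (hρ : ρ (mergePair k p hp).1.1 ≠ ρ (mergePair k p hp).1.2) {h : Idx K} (hh : Kbar K h)
    (e : ℕ × ℕ) :
    mergeD k e (pairMul (fun y => ρ (k.predAbove y)) p h D) =
      ∑ l ∈ Finset.Iic e, mergeCoef k p h l •
        pairMul ρ (mergePair k p hp) (h - nc l) (mergeD k (e - l) D) := by
  set ρ' : Fin (r + 1) → ℕ := fun y => ρ (k.predAbove y) with hρ'
  set f := flipR ρ' p with hf
  have hf' : flipR ρ (mergePair k p hp) = f := rfl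
  funext n
  set E : Fin r → Idx K := Pi.single k (nc e + 1) with hE
  set y : ℕ × ℕ → Fin r → Idx K := fun i => Pi.single (leadV f (mergePair k p hp)) h +
    dirV f (mergePair k p hp) (nc i) with hy
  set x := mergeExp k f p h with hx
  set F : Idx K → ℕ × ℕ → M := fun m i => (C2 (-m - 1) e * pairCoef K h f i) •
    D (splitArg k E (n + y i) (m + x i)) with hF
  have hbd : {i | ∃ m, D (splitArg k E (n + y i) (m + x i)) ≠ 0}.Finite := by
    refine (hD.bound (p := p) hρ (wt ρ' (unmerge k (n - E)) +
      wt ρ' (Pi.single (leadV f p) h))).subset ?_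
    rintro i ⟨m, hm⟩
    refine ⟨splitArg k E n m + Pi.single (leadV f p) h, ?_, ?_⟩
    · rw [map_add, wt_splitArg]
    · rwa [← splitArg_mergeExp hp] at hm
  have hline : ∀ n', {m | D (splitArg k E n' m) ≠ 0}.Finite := fun n' => hD.finite_splitArg E n'
  have h1 : mergeD k e (pairMul ρ' p h D) n = ∑ᶠ m, ∑ᶠ i, F m i := by
    unfold mergeD pairMul
    congr 1; funext m
    rw [smul_finsum]
    congr 1; funext i
    rw [smul_smul, splitArg_mergeExp hp]
  have hFfin : (Function.support fun z : Idx K × (ℕ × ℕ) => F z.1 z.2).Finite := by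
    refine Set.Finite.subset (hbd.biUnion fun i _ =>
      ((hline (n + y i)).image fun m => (m - x i, i))) ?_
    rintro ⟨m, i⟩ hz
    have hz' := right_ne_zero_of_smul hz
    simp only [Set.mem_iUnion, Set.mem_image]
    exact ⟨i, ⟨m, hz'⟩, m + x i, hz', by rw [add_sub_cancel_right]⟩
  set G : (ℕ × ℕ) → (Fin r → Idx K) → M := fun l y =>
    ∑ᶠ m, C2 (-m - 1) (e - l) • D (splitArg k E (n + y) m) with hG
  have h2 : ∀ i, ∑ᶠ m, F m i = ∑ l ∈ Finset.Iic e,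
      (pairCoef K h f i * C2 (x i) l) • G l (y i) := by
    intro i
    rw [← finsum_comp_equiv (Equiv.subRight (x i))]
    have : ∀ m, F (Equiv.subRight (x i) m) i = ∑ l ∈ Finset.Iic e,
        (pairCoef K h f i * C2 (x i) l) • (C2 (-m - 1) (e - l) •
          D (splitArg k E (n + y i) m)) := by
      intro m
      simp only [hF, Equiv.subRight_apply, sub_add_cancel]
      have e1 : -(m - x i) - 1 = x i + (-m - 1) := by ring
      rw [e1, C2_add, Finset.sum_mul, Finset.sum_smul]
      refine Finset.sum_congr rfl fun l _ => ?_
      rw [smul_smul]; congr 1; ring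
    simp only [this]
    rw [finsum_sum_comm]
    · refine Finset.sum_congr rfl fun l _ => ?_
      rw [hG, smul_finsum]
    · intro l _
      exact (hline (n + y i)).subset fun m hm =>
        right_ne_zero_of_smul (right_ne_zero_of_smul hm)
  rw [h1, finsum_swap F hFfin]
  simp only [h2]
  rw [finsum_sum_comm, Finset.sum_apply]
  · refine Finset.sum_congr rfl fun l hl => ?_
    rw [finsum_mergeExp hp f hh l (G l)]
    rw [Pi.smul_apply]
    congr 1
    unfold pairMul
    rw [hf']
    congr 1; funext i
    congr 1
    simp only [hG, mergeD]
    congr 1; funext m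
    refine congrArg (fun z => C2 (-m - 1) (e - l) • D z) ?_
    unfold splitArg
    congr 3
    have hle : l ≤ e := Finset.mem_Iic.1 hl
    have : (nc e : Idx K) = nc (e - l) + nc l := by rw [← nc_add, tsub_add_cancel_of_le hle]
    rw [hE, this]
    simp only [Pi.single_add]
    abel
  · intro l _
    refine hbd.subset fun i hi => ?_
    obtain ⟨m, hm⟩ := exists_ne_zero_of_finsum (right_ne_zero_of_smul hi)
    refine ⟨m - x i, ?_⟩
    rw [sub_add_cancel]
    exact right_ne_zero_of_smul hm

end Merge

section Leibniz
variable {K : Type*} [Field K] [CharZero K] {M : Type*} [AddCommGroup M] [Module K M] {r : ℕ}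

/-- extension by zero of a function on pairs `i < j` -/
def exP (hs : Pairs r → Idx K) (i j : Fin r) : Idx K := if h : i < j then hs ⟨(i, j), h⟩ else 0

theorem exP_pair (hs : Pairs r → Idx K) (p : Pairs r) : exP hs p.1.1 p.1.2 = hs p := dif_pos p.2

theorem exP_add (hs hs' : Pairs r → Idx K) (i j : Fin r) :
    exP (hs + hs') i j = exP hs i j + exP hs' i j := by
  unfold exP; split_ifs <;> simp

theorem exP_neg (hs : Pairs r → Idx K) (i j : Fin r) :
    exP (-hs) i j = -exP hs i j := by
  unfold exP; split_ifs <;> simp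

theorem exP_single (p : Pairs r) (h : Idx K) (i j : Fin r) :
    exP (Pi.single p h) i j = if p.1 = (i, j) then h else 0 := by
  unfold exP
  split_ifs with h1 h2 h2
  · have : p = ⟨(i, j), h1⟩ := Subtype.ext h2
    subst this; simp
  · rw [Pi.single_eq_of_ne]; rintro rfl; exact h2 rfl
  · have := p.2; rw [h2] at this; exact absurd this h1
  · rfl

/-- the exponents after merging, apart from the shifts by derivatives -/
def mergeH (k : Fin r) (hs : Pairs (r + 1) → Idx K) (q : Pairs r) : Idx K :=
  exP hs (k.castSucc.succAbove q.1.1) (k.castSucc.succAbove q.1.2) +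
    (if k = q.1.1 then exP hs k.castSucc (k.castSucc.succAbove q.1.2) else 0) +
    (if k = q.1.2 then exP hs (k.castSucc.succAbove q.1.1) k.castSucc else 0)

theorem mergeH_add (k : Fin r) (hs hs' : Pairs (r + 1) → Idx K) :
    mergeH k (hs + hs') = mergeH k hs + mergeH k hs' := by
  funext q
  simp only [mergeH, exP_add, Pi.add_apply]
  split_ifs <;> ring

theorem mergeH_neg (k : Fin r) (hs : Pairs (r + 1) → Idx K) :
    mergeH k (-hs) = -mergeH k hs := by
  funext q
  simp only [mergeH, exP_neg, Pi.neg_apply]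
  split_ifs <;> ring

theorem mergeH_single {k : Fin r} {p : Pairs (r + 1)} (hp : p.1 ≠ (k.castSucc, k.succ))
    (h : Idx K) : mergeH k (Pi.single p h) = Pi.single (mergePair k p hp) h := by
  have hlt := pi_lt hp
  have hne := pairs_ne p
  funext q
  have hq : q = mergePair k p hp ↔ k.predAbove p.1.1 = q.1.1 ∧ k.predAbove p.1.2 = q.1.2 := by
    constructor
    · rintro rfl; exact ⟨rfl, rfl⟩
    · rintro ⟨h1, h2⟩; exact Subtype.ext (Prod.ext h1.symm h2.symm)
  have key : ∀ (y : Fin (r + 1)) (j : Fin r), y = k.castSucc.succAbove j ↔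
      y ≠ k.castSucc ∧ k.predAbove y = j := by
    intro y j
    constructor
    · rintro rfl; exact ⟨lift_ne k j, pi_lift k j⟩
    · rintro ⟨h1, rfl⟩; exact (lift_pi k h1).symm
  rw [Pi.single_apply]
  simp only [mergeH, exP_single, Prod.ext_iff, hq, key]
  clear hq key hlt
  by_cases h1 : p.1.1 = k.castSucc
  · have h2 : p.1.2 ≠ k.castSucc := fun h => hne (h1.trans h.symm)
    simp only [h1, h2, Ne, not_true, not_false_eq_true, false_and, true_and, if_false,
      Fin.predAbove_castSucc_self, and_false, zero_add, add_zero, ite_self]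
    by_cases c1 : k = q.1.1
    · simp [c1]
    · simp [c1]
  · by_cases h2 : p.1.2 = k.castSucc
    · simp only [h1, h2, Ne, not_true, not_false_eq_true, false_and, true_and, if_false,
        Fin.predAbove_castSucc_self, and_false, and_true, zero_add, add_zero, ite_self]
      by_cases c1 : k = q.1.2
      · simp [← c1]
      · simp [c1]
    · simp [h1, h2]

theorem Kbar_nc_sub {h : Idx K} (hh : Kbar K h) (l : ℕ × ℕ) : Kbar K (h - nc l) := by
  rw [sub_eq_add_neg]; exact hh.add (Kbar_nc l).neg

theorem inLatN_mergeD {c : DistN K M (r + 1)} (hc : InLatN K M c) (k : Fin r) (e : ℕ × ℕ) :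
    InLatN K M (mergeD k e c) := by
  rw [inLatN_iff] at hc ⊢
  obtain ⟨S, hS⟩ := hc
  refine ⟨S.image fun s j => if j = k then s k.castSucc + s k.succ + nc e + 1
    else s (k.castSucc.succAbove j), fun n hn => ?_⟩
  obtain ⟨m, hm⟩ := exists_ne_zero_of_finsum hn
  obtain ⟨s, hs, d, hd⟩ := hS _ (right_ne_zero_of_smul hm)
  refine ⟨_, Finset.mem_image_of_mem _ hs, fun j => if j = k then d k.castSucc + d k.succ
    else d (k.castSucc.succAbove j), fun j => ?_⟩
  have hat : k.castSucc ≠ k.succ := ne_of_lt (by simp [Fin.lt_def])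
  by_cases hj : j = k
  · subst hj
    have h1 := hd j.castSucc
    have h2 := hd j.succ
    simp only [splitArg, unmerge_apply, Pi.add_apply, Pi.sub_apply, Pi.single_eq_same,
      Pi.single_eq_of_ne hat, Pi.single_eq_of_ne hat.symm, if_true, hat.symm, if_false,
      Fin.predAbove_succ_self] at h1 h2
    simp only [if_true, nc_add]
    linear_combination h1 + h2
  · have h1 := hd (k.castSucc.succAbove j)
    have h2 : k.castSucc.succAbove j ≠ k.succ := by
      rw [← lift_k k]
      exact fun h => hj (Fin.succAbove_right_injective h)
    simp only [splitArg, unmerge_apply, Pi.add_apply, Pi.sub_apply, lift_ne, if_false,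
      Pi.single_eq_of_ne (lift_ne k j), Pi.single_eq_of_ne h2, pi_lift,
      Pi.single_eq_of_ne hj] at h1
    simp only [if_neg hj]
    linear_combination h1

theorem isPowN_mergeD {c : DistN K M (r + 1)} (hc : IsPowN K M c) (k : Fin r) (e : ℕ × ℕ) :
    IsPowN K M (mergeD k e c) := by
  intro n hn j
  obtain ⟨m, hm⟩ := exists_ne_zero_of_finsum hn
  have hd := hc _ (right_ne_zero_of_smul hm)
  have hat : k.castSucc ≠ k.succ := ne_of_lt (by simp [Fin.lt_def])
  by_cases hj : j = k
  · subst hj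
    obtain ⟨d1, h1⟩ := (negInt_pair_iff' _).1 (hd j.castSucc)
    obtain ⟨d2, h2⟩ := (negInt_pair_iff' _).1 (hd j.succ)
    simp only [splitArg, unmerge_apply, Pi.add_apply, Pi.sub_apply, Pi.single_eq_same,
      Pi.single_eq_of_ne hat, Pi.single_eq_of_ne hat.symm, if_true, hat.symm, if_false,
      Fin.predAbove_succ_self] at h1 h2
    have hm1 : -m - 1 = nc d1 := by linear_combination -h1
    have hle : e ≤ d1 := by
      by_contra h
      refine left_ne_zero_of_smul hm ?_
      rw [hm1, C2_nc_eq_zero h]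
    refine (negInt_pair_iff' _).2 ⟨(d1 - e) + d2, ?_⟩
    have h3 : (nc d1 : Idx K) = nc (d1 - e) + nc e := by rw [← nc_add, tsub_add_cancel_of_le hle]
    rw [nc_add]
    linear_combination h1 + h2 - h3
  · have h1 := hd (k.castSucc.succAbove j)
    have h2 : k.castSucc.succAbove j ≠ k.succ := by
      rw [← lift_k k]
      exact fun h => hj (Fin.succAbove_right_injective h)
    simp only [splitArg, unmerge_apply, Pi.add_apply, Pi.sub_apply, lift_ne, if_false,
      Pi.single_eq_of_ne (lift_ne k j), Pi.single_eq_of_ne h2, pi_lift,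
      Pi.single_eq_of_ne hj, add_zero, sub_zero] at h1
    exact h1

theorem pairMul_sum {X : Type*} (s : Finset X) {ρ : Fin r → ℕ} {D : X → DistN K M r}
    (hD : ∀ x, Adm ρ (D x)) {p : Pairs r} (hp : ρ p.1.1 ≠ ρ p.1.2) (h : Idx K) (u : X → K) :
    pairMul ρ p h (∑ x ∈ s, u x • D x) = ∑ x ∈ s, u x • pairMul ρ p h (D x) := by
  funext n
  rw [Finset.sum_apply]
  simp only [pairMul, Pi.smul_apply, Finset.sum_apply, Finset.smul_sum]
  rw [finsum_sum_comm]
  · refine Finset.sum_congr rfl fun x _ => ?_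
    rw [smul_finsum]
    congr 1; funext i; rw [smul_comm]
  · intro x _
    refine (finite_pairMul (hD x) hp h (n + Pi.single (leadV (flipR ρ p) p) h)).subset
      fun i hi h0 => hi ?_
    dsimp only at h0 ⊢
    rw [smul_comm, h0, smul_zero]

/-- the result of merging the variables `k.castSucc` and `k.succ` -/
structure MergeData (k : Fin r) (e : ℕ × ℕ) (hs : Pairs (r + 1) → Idx K) where
  X : Type
  fin : Fintype X
  co : X → K
  l : X → Pairs r → ℕ × ℕ
  e' : X → ℕ × ℕ
  l_le : ∀ x q, l x q ≤ e
  l_zero : ∀ x q, q.1.1 ≠ k → q.1.2 ≠ k → l x q = 0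

theorem exists_mergeData (M : Type*) [AddCommGroup M] [Module K M] (k : Fin r)
    (P : Finset (Pairs (r + 1)))
    (hP : ∀ p ∈ P, p.1 ≠ (k.castSucc, k.succ)) :
    ∀ hs : Pairs (r + 1) → Idx K, (∀ p ∉ P, hs p = 0) → (∀ p, Kbar K (hs p)) → ∀ e,
    ∃ d : MergeData k e hs, ∀ ρ : Fin r → ℕ, Function.Injective ρ →
      ∀ c : DistN K M (r + 1), InLatN K M c →
      mergeD k e (permMulR (fun y => ρ (k.predAbove y)) hs c) =
        haveI := d.fin
        ∑ x, d.co x • permMulR ρ (mergeH k hs - fun q => nc (d.l x q)) (mergeD k (d.e' x) c) := by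
  induction P using Finset.induction_on with
  | empty =>
    intro hs h0 _ e
    have : hs = 0 := funext fun p => h0 p (Finset.notMem_empty p)
    subst this
    refine ⟨⟨Unit, inferInstance, fun _ => 1, fun _ _ => 0, fun _ => e, fun _ _ => zero_le,
      fun _ _ _ _ => rfl⟩, fun ρ _ c _ => ?_⟩
    have : (mergeH k (0 : Pairs (r + 1) → Idx K) - fun q => nc (0 : ℕ × ℕ)) = 0 := by
      funext q
      simp [mergeH, exP, nc_zero]
    rw [permMulR_zero]
    show mergeD k e c = ∑ x : Unit, (1 : K) • permMulR ρ
      (mergeH k (0 : Pairs (r + 1) → Idx K) - fun q => nc (0 : ℕ × ℕ)) (mergeD k e c)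
    rw [this, permMulR_zero]
    simp
  | insert p P hpP ih =>
    intro hs h0 hK e
    have hp : p.1 ≠ (k.castSucc, k.succ) := hP p (Finset.mem_insert_self _ _)
    have hP' : ∀ q ∈ P, q.1 ≠ (k.castSucc, k.succ) := fun q hq =>
      hP q (Finset.mem_insert_of_mem hq)
    set hs₀ := Function.update hs p 0 with hhs₀
    have hsum : hs = hs₀ + Pi.single p (hs p) := by
      funext q
      by_cases hq : q = p
      · subst hq; simp [hhs₀]
      · simp [hhs₀, hq]
    have h0' : ∀ q ∉ P, hs₀ q = 0 := by
      intro q hq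
      by_cases hqp : q = p
      · subst hqp; simp [hhs₀]
      · rw [hhs₀, Function.update_of_ne hqp]
        exact h0 q (by simp [hqp, hq])
    have hK' : ∀ q, Kbar K (hs₀ q) := by
      intro q
      by_cases hqp : q = p
      · subst hqp; simp only [hhs₀, Function.update_self]; exact Kbar_zero
      · rw [hhs₀, Function.update_of_ne hqp]; exact hK q
    choose d hd using fun l : ℕ × ℕ => ih hP' hs₀ h0' hK' (e - l)
    let s := (Finset.Iic e).filter fun l => mergeCoef k p (hs p) l ≠ 0
    let _ : ∀ l, Fintype (d l).X := fun l => (d l).fin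
    refine ⟨⟨Σ l : s, (d l.1).X, inferInstance,
      fun x => mergeCoef k p (hs p) x.1.1 * (d x.1.1).co x.2,
      fun x => (d x.1.1).l x.2 + Pi.single (mergePair k p hp) x.1.1,
      fun x => (d x.1.1).e' x.2, ?_, ?_⟩, ?_⟩
    · rintro ⟨⟨l, hl⟩, x⟩ q
      have hle : l ≤ e := by
        have := (Finset.mem_filter.1 hl).1
        exact Finset.mem_Iic.1 this
      have h1 := (d l).l_le x q
      by_cases hq : q = mergePair k p hp
      · subst hq
        simp only [Pi.add_apply, Pi.single_eq_same]
        exact (add_le_add_left h1 l).trans (tsub_add_cancel_of_le hle).le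
      · simp only [Pi.add_apply, Pi.single_eq_of_ne hq, add_zero]
        exact h1.trans tsub_le_self
    · rintro ⟨⟨l, hl⟩, x⟩ q hq1 hq2
      simp only [Pi.add_apply]
      rw [(d l).l_zero x q hq1 hq2, zero_add]
      by_cases hq : q = mergePair k p hp
      · subst hq
        rw [Pi.single_eq_same]
        have h1 := (Finset.mem_filter.1 hl).2
        have ha : p.1.1 ≠ k.castSucc := fun h => hq1 (by simp [mergePair, h])
        have hb : p.1.2 ≠ k.castSucc := fun h => hq2 (by simp [mergePair, h])
        rw [mergeCoef, if_neg ha, if_neg hb] at h1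
        by_contra hl0
        exact h1 (if_neg hl0)
      · rw [Pi.single_eq_of_ne hq]
    · intro ρ hρ c hc
      have hA := adm_of_inLatN (fun y => ρ (k.predAbove y)) hc
      have hz : ∀ q : Pairs (r + 1), ρ (k.predAbove q.1.1) = ρ (k.predAbove q.1.2) →
          q.1 = (k.castSucc, k.succ) := by
        intro q hq
        by_contra h
        exact (pi_lt h).ne (hρ hq)
      have hz0 : ZeroEq (fun y => ρ (k.predAbove y)) hs₀ := by
        intro q hq
        exact h0' q fun hqP => hP' q hqP (hz q hq)
      have hpne : ρ (mergePair k p hp).1.1 ≠ ρ (mergePair k p hp).1.2 := fun h =>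
        (mergePair k p hp).2.ne (hρ h)
      have hz' : ∀ hs' : Pairs r → Idx K, ZeroEq ρ hs' := fun hs' q hq =>
        absurd (hρ hq) q.2.ne
      have hA' : ∀ e', Adm ρ (mergeD k e' c) := fun e' => adm_of_inLatN ρ (inLatN_mergeD hc k e')
      have hKm : ∀ q, Kbar K (mergeH k hs₀ q) := by
        intro q
        have hex : ∀ i j, Kbar K (exP hs₀ i j) := by
          intro i j; unfold exP; split_ifs
          · exact hK' _
          · exact Kbar_zero
        unfold mergeH
        refine ((hex _ _).add ?_).add ?_ <;> split_ifs
        · exact hex _ _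
        · exact Kbar_zero
        · exact hex _ _
        · exact Kbar_zero
      conv_lhs => rw [hsum, ← pairMul_permMulR hA hz0 hK' (p := p) hpne (hK p)]
      rw [mergeD_pairMul (hA.permMulR hz0) hp hpne (hK p)]
      rw [Fintype.sum_sigma]
      rw [← Finset.sum_filter_of_ne (p := fun l => mergeCoef k p (hs p) l ≠ 0)
        (fun l _ h h' => h (by rw [h', zero_smul]))]
      rw [← Finset.sum_coe_sort s]
      refine Finset.sum_congr rfl fun l _ => ?_
      rw [hd l.1 ρ hρ c hc, pairMul_sum _ (fun x => (hA' _).permMulR (hz' _)) hpne,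
        Finset.smul_sum]
      refine Finset.sum_congr rfl fun x _ => ?_
      rw [smul_smul, pairMul_permMulR
        (hs := mergeH k hs₀ - fun q => nc ((d l.1).l x q)) (hA' _) (hz' _) (fun q => Kbar_nc_sub (hKm q) _) hpne
        (Kbar_nc_sub (hK p) _)]
      refine congrArg (fun z => _ • permMulR ρ z _) ?_
      have hH : mergeH k hs = mergeH k hs₀ + Pi.single (mergePair k p hp) (hs p) := by
        conv_lhs => rw [hsum]
        rw [mergeH_add, mergeH_single hp]
      funext q
      simp only [hH]
      by_cases hq : q = mergePair k p hp
      · subst hq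
        simp only [Pi.add_apply, Pi.sub_apply, Pi.single_eq_same, nc_add]; ring
      · simp only [Pi.add_apply, Pi.sub_apply, Pi.single_eq_of_ne hq, nc_add, nc_zero]; ring

end Leibniz

section Slice
variable {K : Type*} [Field K] [CharZero K] {M : Type*} [AddCommGroup M] [Module K M] {r : ℕ}
variable {E : Type*} [AddCommGroup E] [Module K E]

theorem castSucc_ne_succ' (k : Fin r) : k.castSucc ≠ k.succ := ne_of_lt (by simp [Fin.lt_def])

theorem castSucc_lt_succ' (k : Fin r) : k.castSucc < k.succ := by simp [Fin.lt_def]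

/-- the pair of variables to be merged -/
def midPair (k : Fin r) : Pairs (r + 1) := ⟨(k.castSucc, k.succ), castSucc_lt_succ' k⟩

/-- the exponents `x` and `y` at the variables to be merged, `n` elsewhere -/
def sliceArg (k : Fin r) (n : Fin r → Idx K) (x y : Idx K) : Fin (r + 1) → Idx K := fun i =>
  if i = k.castSucc then x else if i = k.succ then y else n (k.predAbove i)

/-- the two-variable distribution in the variables to be merged -/
def slice (k : Fin r) (n : Fin r → Idx K) (D : DistN K M (r + 1)) : Dist2 K M :=
  fun x y => D (sliceArg k n x y)

theorem splitArg_eq (k : Fin r) (e n : Fin r → Idx K) (he : ∀ j, j ≠ k → e j = 0) (x : Idx K) :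
    splitArg k e n x = sliceArg k n x (n k - e k - x) := by
  funext i
  have h0 := castSucc_ne_succ' k
  simp only [splitArg, sliceArg, unmerge_apply, Pi.add_apply, Pi.sub_apply]
  by_cases h1 : i = k.castSucc
  · subst h1
    simp [h0]
  · by_cases h2 : i = k.succ
    · subst h2
      simp [h0.symm]
    · have h3 : k.predAbove i ≠ k := fun h => h2 (by rw [← lift_pi k h1, h, lift_k])
      simp [h1, h2, he _ h3]

theorem sliceArg_rotate (k : Fin r) (n : Fin r → Idx K) (x T : Idx K) :
    sliceArg k n x (T - x) = splitArg k (Pi.single k (n k - T)) n x := by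
  rw [splitArg_eq k _ n (fun j hj => Pi.single_eq_of_ne hj _), Pi.single_eq_same]
  congr 1; ring

theorem Adm.finite_slice {ρ : Fin r → ℕ} {k : Fin r} {D : DistN K M (r + 1)}
    (hD : Adm (fun y => ρ (k.predAbove y)) D) (n : Fin r → Idx K) (T : Idx K) :
    (Function.support fun x => slice k n D x (T - x)).Finite := by
  refine (hD.finite_splitArg (Pi.single k (n k - T)) n).subset fun x hx => ?_
  simpa only [Function.mem_support, slice, sliceArg_rotate, Set.mem_ofPred_eq] using hx

theorem diagD_slice (k : Fin r) (n : Fin r → Idx K) (D : DistN K M (r + 1)) (e : ℕ × ℕ) :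
    diagD (nc e) (slice k n D) (n k) = mergeD k e D n := by
  unfold diagD mergeD
  congr 1; funext x
  rw [C2K_nc, splitArg_eq k _ n (fun j hj => Pi.single_eq_of_ne hj _), Pi.single_eq_same, slice]
  congr 3; ring

theorem diagD_of_not {F : Idx K} (h : ∀ e, nc e ≠ F) (c : Dist2 K M) (n : Idx K) :
    diagD F c n = 0 := by
  simp [diagD, C2K_of_not _ h]

theorem zwPow_slice {ρ : Fin (r + 1) → ℕ} (k : Fin r) (hρ : ρ k.castSucc < ρ k.succ)
    (n : Fin r → Idx K) (D : DistN K M (r + 1)) (h x y : Idx K) :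
    zwPow K M h (slice k n D) x y = pairMul ρ (midPair k) h D (sliceArg k n x y) := by
  have hf : flipR ρ (midPair k) = false := by
    show decide (ρ k.succ < ρ k.castSucc) = false
    exact decide_eq_false hρ.le.not_gt
  have h0 := castSucc_ne_succ' k
  unfold zwPow pairMul
  rw [hf]
  congr 1; funext i
  simp only [pairCoef, slice, Bool.false_eq_true, if_false, one_mul]
  congr 2
  funext j
  simp only [sliceArg, leadV, tailV, dirV, midPair, Bool.false_eq_true, if_false, Pi.add_apply,
    Pi.sub_apply]
  by_cases h1 : j = k.castSucc
  · subst h1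
    simp only [if_true, Pi.single_eq_same, Pi.single_eq_of_ne h0, nc]
    ext <;> simp <;> ring
  · by_cases h2 : j = k.succ
    · subst h2
      simp only [if_true, h0.symm, if_false, Pi.single_eq_same, Pi.single_eq_of_ne h0.symm, nc]
      ext <;> simp
    · simp [h1, h2]

/-- the ranks of the variables before merging -/
def splitRank (k : Fin r) (ρ : Fin r → ℕ) (y : Fin (r + 1)) : ℕ :=
  2 * ρ (k.predAbove y) + if y = k.castSucc then 0 else 1

theorem flipR_splitRank (k : Fin r) {ρ : Fin r → ℕ} (hρ : Function.Injective ρ) :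
    flipR (splitRank k ρ) = flipR (fun y => ρ (k.predAbove y)) := by
  funext p
  unfold flipR
  rw [decide_eq_decide]
  simp only [splitRank]
  by_cases hp : p.1 = (k.castSucc, k.succ)
  · simp [hp, (castSucc_ne_succ' k).symm]
  · have h1 : ρ (k.predAbove p.1.1) ≠ ρ (k.predAbove p.1.2) := fun h => (pi_lt hp).ne (hρ h)
    split_ifs <;> omega

theorem splitRank_injective (k : Fin r) {ρ : Fin r → ℕ} (hρ : Function.Injective ρ) :
    Function.Injective (splitRank k ρ) := by
  intro x y h
  have hp : ρ (k.predAbove x) = ρ (k.predAbove y) := by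
    simp only [splitRank] at h; split_ifs at h <;> omega
  have h1 := hρ hp
  simp only [splitRank, h1] at h
  by_cases hx : x = k.castSucc <;> by_cases hy : y = k.castSucc
  · rw [hx, hy]
  · simp [hx, hy] at h
  · simp [hx, hy] at h
  · rw [← lift_pi k hx, h1, lift_pi k hy]

theorem splitRank_lift (k : Fin r) (ρ : Fin r → ℕ) (j : Fin r) :
    splitRank k ρ (k.castSucc.succAbove j) = 2 * ρ j + 1 := by
  simp only [splitRank, pi_lift, if_neg (lift_ne k j)]

theorem splitRank_castSucc (k : Fin r) (ρ : Fin r → ℕ) :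
    splitRank k ρ k.castSucc = 2 * ρ k := by
  simp [splitRank]

theorem permMulR_congr {ρ ρ' : Fin r → ℕ} (h : flipR ρ = flipR ρ') (hs : Pairs r → Idx K)
    (c : DistN K M r) : permMulR ρ hs c = permMulR ρ' hs c := by
  unfold permMulR; rw [h]

theorem permMulR_splitRank (k : Fin r) {ρ : Fin r → ℕ} (hρ : Function.Injective ρ)
    {hs : Pairs (r + 1) → Idx K} (hK : ∀ p, Kbar K (hs p)) {c : DistN K M (r + 1)}
    (hc : InLatN K M c) (n : Fin r → Idx K) (x y : Idx K) :
    permMulR (splitRank k ρ) hs c (sliceArg k n x y) =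
      zwPow K M (hs (midPair k)) (slice k n (permMulR (fun y => ρ (k.predAbove y))
        (Function.update hs (midPair k) 0) c)) x y := by
  have hρ' := splitRank_injective k hρ
  have hlt : splitRank k ρ k.castSucc < splitRank k ρ k.succ := by
    rw [splitRank_castSucc, ← lift_k, splitRank_lift]; omega
  have hp : splitRank k ρ (midPair k).1.1 ≠ splitRank k ρ (midPair k).1.2 := hlt.ne
  have hz : ∀ hs, ZeroEq (K := K) (splitRank k ρ) hs := fun hs p h =>
    absurd (hρ' h) (pairs_ne p)
  have hK' : ∀ q, Kbar K (Function.update hs (midPair k) 0 q) := by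
    intro q
    by_cases hq : q = midPair k
    · subst hq; rw [Function.update_self]; exact Kbar_zero
    · rw [Function.update_of_ne hq]; exact hK q
  rw [zwPow_slice (ρ := splitRank k ρ) k hlt, permMulR_congr (flipR_splitRank k hρ).symm,
    pairMul_permMulR (adm_of_inLatN _ hc) (hz _) hK' hp (hK _)]
  congr 1
  funext q
  by_cases hq : q = midPair k
  · subst hq; simp
  · simp [hq]

/-- merging of fields -/
def mergeE (k : Fin r) (e : ℕ × ℕ) (c : EDistN K E (r + 1)) (hc : ∀ v, InLatN K E (evN K E c v)) :
    EDistN K E r := fun n =>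
  { toFun := fun v => mergeD k e (evN K E c v) n
    map_add' := fun v w => by
      have hf : ∀ v, (Function.support fun m => C2 (-m - 1) e •
          evN K E c v (splitArg k (Pi.single k (nc e + 1)) n m)).Finite := fun v =>
        (Adm.finite_splitArg (ρ := fun _ => 0) (adm_of_inLatN _ (hc v)) _ n).subset fun x => right_ne_zero_of_smul
      unfold mergeD
      rw [← finsum_add_distrib (hf v) (hf w)]
      simp [evN]
    map_smul' := fun x v => by
      simp only [mergeD, smul_finsum, RingHom.id_apply]
      congr 1; funext m
      simp only [evN, map_smul]
      rw [smul_comm] }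

end Slice

section Koszul
variable {K : Type*} [Field K] [CharZero K] {r : ℕ}

/-- the Koszul sign of one pair -/
def signPair (ρ : Fin r → ℕ) (ps : Fin r → ZMod 2) (i j : Fin r) : K :=
  if i < j ∧ ρ j < ρ i ∧ ps i = 1 ∧ ps j = 1 then -1 else 1

/-- the Koszul sign of the reordering given by the ranks `ρ` -/
def koszulR (ps : Fin r → ZMod 2) (ρ : Fin r → ℕ) : K :=
  ∏ i, ∏ j, signPair ρ ps i j

theorem koszulPerm_eq (ps : Fin r → ZMod 2) (σ : Equiv.Perm (Fin r)) :
    koszulPerm K ps σ = koszulR ps (fun i => (σ.symm i : ℕ)) := by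
  unfold koszulPerm koszulR
  rw [← Fintype.prod_prod_type', ← Finset.prod_subset (Finset.subset_univ
    (Finset.univ.filter fun x : Fin r × Fin r => x.1 < x.2))
    (fun x _ hx => by simp only [Finset.mem_filter, Finset.mem_univ, true_and] at hx
                      simp [signPair, hx])]
  rw [Finset.prod_subtype (p := fun x : Fin r × Fin r => x.1 < x.2) _ (by simp)]
  refine Finset.prod_congr rfl fun p _ => ?_
  have hp := p.2
  simp only [signPair, hp, true_and, Fin.val_fin_lt]

/-- the parities after merging -/
def mergePar (k : Fin r) (ps : Fin (r + 1) → ZMod 2) (j : Fin r) : ZMod 2 :=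
  ps (k.castSucc.succAbove j) + if j = k then ps k.castSucc else 0

theorem koszulR_merge (k : Fin r) (ps : Fin (r + 1) → ZMod 2) {ρ : Fin r → ℕ}
    (hρ : Function.Injective ρ) :
    koszulR (K := K) ps (splitRank k ρ) = koszulR (mergePar k ps) ρ := by
  have hb : ∀ x : ZMod 2, x = 0 ∨ x = 1 := by decide
  have h2z : (1 + 1 : ZMod 2) = 0 := by decide
  have key : ∀ i j, signPair (K := K) ρ (mergePar k ps) i j =
      signPair (splitRank k ρ) ps (k.castSucc.succAbove i) (k.castSucc.succAbove j) *
      ((if i = k then signPair (splitRank k ρ) ps k.castSucc (k.castSucc.succAbove j) else 1) *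
      (if j = k then signPair (splitRank k ρ) ps (k.castSucc.succAbove i) k.castSucc else 1)) := by
    intro i j
    have hr : ∀ i j, 2 * ρ j + 1 < 2 * ρ i + 1 ↔ ρ j < ρ i := fun i j => by omega
    have hlt : k.castSucc.succAbove i < k.castSucc.succAbove j ↔ i < j :=
      Fin.succAbove_lt_succAbove_iff
    have h1 : ∀ j, k.castSucc < k.castSucc.succAbove j ↔ k ≤ j := fun j => by
      rw [Fin.lt_succAbove_iff_le_castSucc]; simp
    have h2 : ∀ j, k.castSucc.succAbove j < k.castSucc ↔ j < k := fun j => by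
      rw [Fin.succAbove_lt_iff_castSucc_lt]; simp
    simp only [signPair, splitRank_lift, splitRank_castSucc, hr, hlt, h1, h2, mergePar]
    by_cases hik : i = k
    · subst hik
      by_cases hjk : j = i
      · subst hjk; simp
      · have h3 : ρ j ≠ ρ i := fun h => hjk (hρ h)
        have h4 : 2 * ρ j + 1 < 2 * ρ i ↔ ρ j < ρ i := by omega
        have h5 : i ≤ j ↔ i < j := ⟨fun h => lt_of_le_of_ne h (Ne.symm hjk), le_of_lt⟩
        simp only [hjk, if_true, if_false, h4, h5, add_zero, mul_one]
        generalize ps (i.castSucc.succAbove i) = a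
        generalize ps i.castSucc = b
        by_cases hc : i < j ∧ ρ j < ρ i ∧ ps (i.castSucc.succAbove j) = 1
        · obtain ⟨c1, c2, c3⟩ := hc
          rcases hb a with h | h <;> rcases hb b with h' | h' <;>
            simp [c1, c2, c3, h, h', h2z]
        · have hc1 : ∀ P : Prop, ¬ (i < j ∧ ρ j < ρ i ∧ P ∧ ps (i.castSucc.succAbove j) = 1) :=
            fun P h => hc ⟨h.1, h.2.1, h.2.2.2⟩
          simp only [hc1, if_false, mul_one]
    · by_cases hjk : j = k
      · subst hjk
        have h3 : ρ i ≠ ρ j := fun h => hik (hρ h)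
        have h4 : 2 * ρ j < 2 * ρ i + 1 ↔ ρ j < ρ i := by omega
        simp only [hik, if_true, if_false, h4, add_zero, one_mul]
        generalize ps (j.castSucc.succAbove j) = a
        generalize ps j.castSucc = b
        by_cases hc : i < j ∧ ρ j < ρ i ∧ ps (j.castSucc.succAbove i) = 1
        · obtain ⟨c1, c2, c3⟩ := hc
          rcases hb a with h | h <;> rcases hb b with h' | h' <;>
            simp [c1, c2, c3, h, h', h2z]
        · have hc1 : ∀ P : Prop, ¬ (i < j ∧ ρ j < ρ i ∧ ps (j.castSucc.succAbove i) = 1 ∧ P) :=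
            fun P h => hc ⟨h.1, h.2.1, h.2.2.1⟩
          simp only [hc1, if_false, mul_one]
      · simp [hik, hjk]
  have h0 : signPair (K := K) (splitRank k ρ) ps k.castSucc k.castSucc = 1 := by simp [signPair]
  unfold koszulR
  simp only [key, Finset.prod_mul_distrib]
  rw [Fin.prod_univ_succAbove _ k.castSucc]
  simp only [Fin.prod_univ_succAbove _ k.castSucc, h0, one_mul, Finset.prod_mul_distrib]
  rw [Finset.prod_comm (f := fun i j => if i = k then _ else _)]
  simp only [Finset.prod_ite_eq', Finset.mem_univ, if_true]
  ring

end Koszul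

section ML
variable {K : Type*} [Field K] [CharZero K] {r : ℕ}
variable {E : Type*} [AddCommGroup E] [Module K E]

/-- the composition of the modes `f i (m i)` along a list -/
def comp (f : Fin r → EDist1 K E) (m : Fin r → Idx K) (l : List (Fin r)) : Module.End K E :=
  (l.map fun i => f i (m i)).prod

theorem comp_apply (f : Fin r → EDist1 K E) (m : Fin r → Idx K) (l : List (Fin r)) (v : E) :
    comp f m l v = l.foldr (fun i acc => f i (m i) acc) v := by
  induction l with
  | nil => simp [comp]
  | cons i l ih => rw [List.foldr_cons, ← ih]; simp [comp]

/-- multiple locality with exponents in prescribed sets, in terms of ranks instead of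
permutations; if `pw` holds then the expansion fields are creative -/
def ML (f : Fin r → EDist1 K E) (ps : Fin r → ZMod 2) (H : Fin r → Fin r → Set (Idx K))
    (pw : Prop) (one : E) : Prop :=
  ∃ (B : Type) (_ : Fintype B) (hs : B → Pairs r → Idx K) (c : B → EDistN K E r),
    (∀ β p, hs β p ∈ H p.1.1 p.1.2) ∧ (∀ β p, Kbar K (hs β p)) ∧
    (∀ β v, InLatN K E (evN K E (c β) v)) ∧ (pw → ∀ β, IsPowN K E (evN K E (c β) one)) ∧
    ∀ (ρ : Fin r → ℕ) (l : List (Fin r)), l.Pairwise (fun i j => ρ i < ρ j) → (∀ i, i ∈ l) →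
      ∀ v m, koszulR (K := K) ps ρ • comp f m l v =
        ∑ β, permMulR ρ (-hs β) (evN K E (c β) v) m

theorem ML.mono {f : Fin r → EDist1 K E} {ps : Fin r → ZMod 2}
    {H H' : Fin r → Fin r → Set (Idx K)} {pw : Prop} {one : E} (h : ML f ps H pw one)
    (hH : ∀ i j, i < j → H i j ⊆ H' i j) : ML f ps H' pw one := by
  obtain ⟨B, hB, hs, c, h1, h2⟩ := h
  exact ⟨B, hB, hs, c, fun β p => hH _ _ p.2 (h1 β p), h2⟩

theorem rank_injective {ρ : Fin r → ℕ} {l : List (Fin r)}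
    (hl : l.Pairwise fun i j => ρ i < ρ j) (hm : ∀ i, i ∈ l) : Function.Injective ρ := by
  intro x y hxy
  by_contra hne
  have h := hl.imp (S := fun i j => ρ i ≠ ρ j) (fun h => h.ne)
  have : Std.Symm (fun i j => ρ i ≠ ρ j) := ⟨fun _ _ h => Ne.symm h⟩
  exact h.forall (hm x) (hm y) hne hxy

theorem permMulR_smul (ρ : Fin r → ℕ) (hs : Pairs r → Idx K) (x : K) {M : Type*}
    [AddCommGroup M] [Module K M] (c : DistN K M r) :
    permMulR ρ hs (x • c) = x • permMulR ρ hs c := by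
  funext m
  simp only [permMulR, Pi.smul_apply, smul_finsum]
  congr 1; funext κ
  rw [smul_comm]

theorem permMulR_sum {X : Type*} (s : Finset X) {ρ : Fin r → ℕ} {hs : Pairs r → Idx K}
    {M : Type*} [AddCommGroup M] [Module K M] {D : X → DistN K M r}
    (hD : ∀ x ∈ s, Adm ρ (D x)) (hz : ZeroEq ρ hs) :
    permMulR ρ hs (∑ x ∈ s, D x) = ∑ x ∈ s, permMulR ρ hs (D x) := by
  funext m
  rw [permMulR_apply, Finset.sum_apply]
  simp only [permMulR_apply, Finset.sum_apply, Finset.smul_sum]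
  exact finsum_sum_comm s _ fun x hx => finite_permMulR (hD x hx) hz _

/-- the fields after merging two neighbouring ones into `G` -/
def mergeF (k : Fin r) (g : Fin (r + 1) → EDist1 K E) (G : EDist1 K E) (j : Fin r) : EDist1 K E :=
  if j = k then G else g (k.castSucc.succAbove j)

/-- the possible exponents after merging -/
def mergeS (k : Fin r) (N : Idx K) (H : Fin (r + 1) → Fin (r + 1) → Set (Idx K)) (i j : Fin r) :
    Set (Idx K) :=
  if i = k then {w | ∃ x ∈ H k.castSucc (k.castSucc.succAbove j),
      ∃ y ∈ H k.succ (k.castSucc.succAbove j), ∃ z ∈ H k.castSucc k.succ,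
      ∃ e l : ℕ × ℕ, nc e = z - 1 - N ∧ l ≤ e ∧ w = x + y + nc l}
  else if j = k then {w | ∃ x ∈ H (k.castSucc.succAbove i) k.castSucc,
      ∃ y ∈ H (k.castSucc.succAbove i) k.succ, ∃ z ∈ H k.castSucc k.succ,
      ∃ e l : ℕ × ℕ, nc e = z - 1 - N ∧ l ≤ e ∧ w = x + y + nc l}
  else H (k.castSucc.succAbove i) (k.castSucc.succAbove j)

theorem sliceArg_lift {k j : Fin r} (hj : j ≠ k) (n : Fin r → Idx K) (x y : Idx K) :
    sliceArg k n x y (k.castSucc.succAbove j) = n j := by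
  have h2 : k.castSucc.succAbove j ≠ k.succ := by
    rw [← lift_k]; exact fun h => hj (Fin.succAbove_right_injective h)
  simp only [sliceArg, if_neg (lift_ne k j), if_neg h2, pi_lift]

theorem sliceArg_castSucc (k : Fin r) (n : Fin r → Idx K) (x y : Idx K) :
    sliceArg k n x y k.castSucc = x := by simp [sliceArg]

theorem sliceArg_succ (k : Fin r) (n : Fin r → Idx K) (x y : Idx K) :
    sliceArg k n x y k.succ = y := by simp [sliceArg, (castSucc_ne_succ' k).symm]

theorem exP_kbar {hs : Pairs r → Idx K} (h : ∀ p, Kbar K (hs p)) (i j : Fin r) :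
    Kbar K (exP hs i j) := by
  unfold exP; split_ifs
  exacts [h _, Kbar_zero]

theorem mergeH_kbar {k : Fin r} {hs : Pairs (r + 1) → Idx K} (h : ∀ p, Kbar K (hs p))
    (q : Pairs r) : Kbar K (mergeH k hs q) := by
  unfold mergeH
  refine ((exP_kbar h _ _).add ?_).add ?_ <;> split_ifs <;>
    first | exact exP_kbar h _ _ | exact Kbar_zero

theorem update_kbar {hs : Pairs r → Idx K} (h : ∀ p, Kbar K (hs p)) (p q : Pairs r) :
    Kbar K (Function.update hs p 0 q) := by
  by_cases hq : q = p
  · subst hq; rw [Function.update_self]; exact Kbar_zero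
  · rw [Function.update_of_ne hq]; exact h q

theorem mergeH_mem {k : Fin r} {N : Idx K} {H : Fin (r + 1) → Fin (r + 1) → Set (Idx K)}
    {hs : Pairs (r + 1) → Idx K} (h : ∀ p, hs p ∈ H p.1.1 p.1.2) {e : ℕ × ℕ}
    (he : nc e = hs (midPair k) - 1 - N) {l : Pairs r → ℕ × ℕ} (hl : ∀ q, l q ≤ e)
    (hl0 : ∀ q : Pairs r, q.1.1 ≠ k → q.1.2 ≠ k → l q = 0) (q : Pairs r) :
    mergeH k (Function.update hs (midPair k) 0) q + nc (l q) ∈ mergeS k N H q.1.1 q.1.2 := by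
  have hx : ∀ {i j : Fin (r + 1)} (hij : i < j), (i, j) ≠ (k.castSucc, k.succ) →
      exP (Function.update hs (midPair k) 0) i j ∈ H i j := by
    intro i j hij hne
    rw [exP, dif_pos hij, Function.update_of_ne]
    · exact h ⟨(i, j), hij⟩
    · exact fun h => hne (congrArg Subtype.val h)
  have hlt : k.castSucc.succAbove q.1.1 < k.castSucc.succAbove q.1.2 :=
    Fin.succAbove_lt_succAbove_iff.2 q.2
  have hkk := lift_k k
  unfold mergeS mergeH
  by_cases h1 : q.1.1 = k
  · have h2 : ¬ k = q.1.2 := fun h => absurd q.2 (by rw [h1, ← h]; exact lt_irrefl _)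
    rw [h1] at hlt ⊢
    rw [hkk] at hlt ⊢
    rw [if_pos rfl, if_pos rfl, if_neg h2]
    refine ⟨_, hx ((castSucc_lt_succ' k).trans hlt) ?_, _, hx hlt ?_, _, h (midPair k), e, l q,
      he, hl q, by ring⟩
    · exact fun h => hlt.ne' (Prod.ext_iff.1 h).2
    · exact fun h => castSucc_ne_succ' k (Prod.ext_iff.1 h).1.symm
  · by_cases h2 : q.1.2 = k
    · rw [h2] at hlt ⊢
      rw [hkk] at hlt ⊢
      rw [if_neg h1, if_pos rfl, if_pos rfl, if_neg (fun h => h1 h.symm)]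
      have h3 : k.castSucc.succAbove q.1.1 < k.castSucc := by
        rw [Fin.succAbove_lt_iff_castSucc_lt]
        have := q.2; rw [h2] at this; simpa using this
      refine ⟨_, hx h3 ?_, _, hx hlt ?_, _, h (midPair k), e, l q,
        he, hl q, by ring⟩
      · exact fun h => lift_ne k _ (Prod.ext_iff.1 h).1
      · exact fun h => lift_ne k _ (Prod.ext_iff.1 h).1
    · rw [if_neg h1, if_neg h2, if_neg (fun h => h1 h.symm), if_neg (fun h => h2 h.symm),
        hl0 q h1 h2, nc_zero, add_zero, add_zero, add_zero]
      exact hx hlt fun h => lift_ne k _ (Prod.ext_iff.1 h).1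

/-- expansion of a derivative on the diagonal of two of the variables -/
theorem exists_merge_expansion (k : Fin r) (N : Idx K)
    {H : Fin (r + 1) → Fin (r + 1) → Set (Idx K)} {pw : Prop} {one : E}
    {hs : Pairs (r + 1) → Idx K} {c : EDistN K E (r + 1)} (h1 : ∀ p, hs p ∈ H p.1.1 p.1.2)
    (h2 : ∀ p, Kbar K (hs p)) (h3 : ∀ v, InLatN K E (evN K E c v))
    (h4 : pw → IsPowN K E (evN K E c one)) :
    ∃ (B : Type) (_ : Fintype B) (hs' : B → Pairs r → Idx K) (c' : B → EDistN K E r),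
      (∀ β p, hs' β p ∈ mergeS k N H p.1.1 p.1.2) ∧ (∀ β p, Kbar K (hs' β p)) ∧
      (∀ β v, InLatN K E (evN K E (c' β) v)) ∧ (pw → ∀ β, IsPowN K E (evN K E (c' β) one)) ∧
      ∀ ρ : Fin r → ℕ, Function.Injective ρ → ∀ v n,
        diagD (hs (midPair k) - 1 - N) (slice k n (permMulR (fun y => ρ (k.predAbove y))
          (Function.update (-hs) (midPair k) 0) (evN K E c v))) (n k) =
        ∑ β, permMulR ρ (-hs' β) (evN K E (c' β) v) n := by
  by_cases he : ∃ e : ℕ × ℕ, nc e = hs (midPair k) - 1 - N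
  swap
  · push Not at he
    refine ⟨Empty, inferInstance, Empty.elim, Empty.elim, by rintro ⟨⟩, by rintro ⟨⟩, by rintro ⟨⟩,
      by rintro _ ⟨⟩, fun ρ hρ v n => ?_⟩
    rw [diagD_of_not he]; simp
  obtain ⟨e, he⟩ := he
  have hup : Function.update (-hs) (midPair k) 0 = -Function.update hs (midPair k) 0 := by
    funext q
    by_cases hq : q = midPair k
    · subst hq; simp
    · simp [hq]
  obtain ⟨d, hd⟩ := exists_mergeData E k (Finset.univ.erase (midPair k))
    (fun p hp h => (Finset.mem_erase.1 hp).1 (Subtype.ext h))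
    (Function.update (-hs) (midPair k) 0)
    (fun p hp => by
      have : p = midPair k := by simpa using hp
      subst this; simp)
    (fun p => update_kbar (fun p => (h2 p).neg) _ p) e
  have := d.fin
  have hex : ∀ x, mergeH k (Function.update (-hs) (midPair k) 0) - (fun q => nc (d.l x q)) =
      -(fun q => mergeH k (Function.update hs (midPair k) 0) q + nc (d.l x q)) := by
    intro x
    have hm : mergeH k (Function.update (-hs) (midPair k) 0) =
        -mergeH k (Function.update hs (midPair k) 0) := by rw [hup, mergeH_neg]
    rw [hm]
    funext q
    simp only [Pi.sub_apply, Pi.neg_apply]; ring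
  have hev : ∀ x v, evN K E (d.co x • mergeE k (d.e' x) c h3) v =
      d.co x • mergeD k (d.e' x) (evN K E c v) := fun x v => rfl
  refine ⟨d.X, d.fin, fun x q => mergeH k (Function.update hs (midPair k) 0) q + nc (d.l x q),
    fun x => d.co x • mergeE k (d.e' x) c h3,
    fun x q => mergeH_mem h1 he (d.l_le x) (d.l_zero x) q,
    fun x q => (mergeH_kbar (update_kbar h2 _) q).add (Kbar_nc _), fun x v => ?_, fun hp x => ?_,
    fun ρ hρ v n => ?_⟩
  · rw [hev]
    obtain ⟨s, hs⟩ := inLatN_mergeD (h3 v) k (d.e' x)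
    exact ⟨s, fun n hn => hs n (right_ne_zero_of_smul hn)⟩
  · rw [hev]
    exact fun n hn => isPowN_mergeD (h4 hp) k (d.e' x) n (right_ne_zero_of_smul hn)
  · rw [← he, diagD_slice, hd ρ hρ _ (h3 v), Finset.sum_apply]
    refine Finset.sum_congr rfl fun x _ => ?_
    rw [hev, permMulR_smul, hex x]

theorem ML.merge {g : Fin (r + 1) → EDist1 K E} {ps : Fin (r + 1) → ZMod 2}
    {H : Fin (r + 1) → Fin (r + 1) → Set (Idx K)} {pw : Prop} {one : E}
    (h : ML g ps H pw one) (k : Fin r) {N : Idx K} {G : EDist1 K E}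
    (hG : IsProd (g k.castSucc) (g k.succ) N G) :
    ML (mergeF k g G) (mergePar k ps) (mergeS k N H) pw one := by
  obtain ⟨B, hB, hs, c, h1, h2, h3, h4, h5⟩ := h
  choose B' hB' hs' c' h1' h2' h3' h4' h5' using fun β =>
    exists_merge_expansion k N (one := one) (pw := pw) (h1 β) (h2 β) (h3 β) (fun hp => h4 hp β)
  refine ⟨(β : B) × B' β, inferInstance, fun x => hs' x.1 x.2, fun x => c' x.1 x.2,
    fun x => h1' x.1 x.2, fun x => h2' x.1 x.2, fun x => h3' x.1 x.2,
    fun hp x => h4' x.1 hp x.2, fun ρ l hl hm v n => ?_⟩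
  have hρ := rank_injective hl hm
  obtain ⟨u, w, rfl⟩ := List.append_of_mem (hm k)
  rw [List.pairwise_append, List.pairwise_cons] at hl
  obtain ⟨hu, ⟨hkw, hw⟩, huw⟩ := hl
  have hku : ∀ i ∈ u, ρ i < ρ k := fun i hi => huw i hi k List.mem_cons_self
  have huw' : ∀ i ∈ u, ∀ j ∈ w, ρ i < ρ j := fun i hi j hj => huw i hi j (List.mem_cons_of_mem _ hj)
  have hnu : ∀ i ∈ u, i ≠ k := fun i hi h => absurd (hku i hi) (by rw [h]; exact lt_irrefl _)
  have hnw : ∀ i ∈ w, i ≠ k := fun i hi h => absurd (hkw i hi) (by rw [h]; exact lt_irrefl _)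
  set lf := k.castSucc.succAbove with hlf
  have hrs : splitRank k ρ k.succ = 2 * ρ k + 1 := by rw [← lift_k, splitRank_lift]
  have hrc := splitRank_castSucc k ρ
  have hrl : ∀ j, splitRank k ρ (lf j) = 2 * ρ j + 1 := splitRank_lift k ρ
  have hmap : ∀ (t : List (Fin r)), (∀ i ∈ t, i ≠ k) → ∀ x y,
      comp g (sliceArg k n x y) (t.map lf) = comp (mergeF k g G) n t := by
    intro t ht x y
    unfold comp
    rw [List.map_map]
    congr 1
    refine List.map_congr_left fun i hi => ?_
    simp only [Function.comp, mergeF, if_neg (ht i hi), hlf, sliceArg_lift (ht i hi)]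
  set U : Module.End K E := comp (mergeF k g G) n u with hU
  set W : Module.End K E := comp (mergeF k g G) n w with hW
  have hbig : ∀ x y, koszulR (K := K) (mergePar k ps) ρ •
      U (g k.castSucc x (g k.succ y (W v))) = ∑ β, zwPow K E (-(hs β (midPair k)))
        (slice k n (permMulR (fun y => ρ (k.predAbove y)) (Function.update (-hs β) (midPair k) 0)
          (evN K E (c β) v))) x y := by
    intro x y
    have := h5 (splitRank k ρ) (u.map lf ++ k.castSucc :: k.succ :: w.map lf) ?_ ?_ v
      (sliceArg k n x y)
    · rw [koszulR_merge k ps hρ] at this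
      have hc : comp g (sliceArg k n x y) (u.map lf ++ k.castSucc :: k.succ :: w.map lf) =
          U * (g k.castSucc x * (g k.succ y * W)) := by
        rw [hU, hW, ← hmap u hnu x y, ← hmap w hnw x y]
        simp only [comp, List.map_append, List.map_cons, List.prod_append, List.prod_cons,
          sliceArg_castSucc, sliceArg_succ]
      rw [hc] at this
      refine this.trans (Finset.sum_congr rfl fun β _ => ?_)
      rw [permMulR_splitRank k hρ (hs := -hs β) (fun p => (h2 β p).neg) (h3 β v)]
      rfl
    · simp only [List.pairwise_append, List.pairwise_cons, List.pairwise_map, List.mem_cons,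
        List.mem_map, hrl, forall_eq_or_imp, forall_exists_index, and_imp,
        forall_apply_eq_imp_iff₂, hrs, hrc]
      refine ⟨hu.imp (by omega), ⟨⟨by omega, fun j hj => ?_⟩, fun j hj => ?_, hw.imp (by omega)⟩,
        fun i hi => ⟨?_, ?_, fun j hj => ?_⟩⟩
      · have := hkw j hj; omega
      · have := hkw j hj; omega
      · have := hku i hi; omega
      · have := hku i hi; omega
      · have := huw' i hi j hj; omega
    · intro y
      by_cases hy : y = k.castSucc
      · simp [hy]
      · have hm' := hm (k.predAbove y)
        rw [← lift_pi k hy]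
        simp only [List.mem_append, List.mem_cons] at hm' ⊢
        rcases hm' with h | h | h
        · exact Or.inl (List.mem_map_of_mem h)
        · rw [h, lift_k]; simp
        · exact Or.inr (Or.inr (Or.inr (List.mem_map_of_mem h)))
  obtain ⟨s, cG, hcG, hope, hGe⟩ := hG
  have hz : ∀ β, ZeroEq (fun y => ρ (k.predAbove y)) (Function.update (-hs β) (midPair k) 0) := by
    intro β p hp
    by_cases hpm : p = midPair k
    · subst hpm; simp
    · exact absurd (hρ hp) (pi_lt (fun h => hpm (Subtype.ext h))).ne
  have key := hope.sum_diagD_eq (W v) (koszulR (K := K) (mergePar k ps) ρ • U)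
    (d := fun β => slice k n (permMulR (fun y => ρ (k.predAbove y))
      (Function.update (-hs β) (midPair k) 0) (evN K E (c β) v)))
    (fun β T => Adm.finite_slice ((adm_of_inLatN _ (h3 β v)).permMulR (hz β)) n T)
    (fun β => hs β (midPair k)) N (n k) (fun m => hbig _ _)
  rw [← hGe] at key
  have hcomp : comp (mergeF k g G) n (u ++ k :: w) = U * (G (n k) * W) := by
    simp only [hU, hW, comp, List.map_append, List.map_cons, List.prod_append, List.prod_cons]
    simp [mergeF]
  rw [hcomp, Fintype.sum_sigma]
  refine key.trans (Finset.sum_congr rfl fun β _ => ?_)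
  exact h5' β ρ hρ v n

end ML

section Conv
variable {K : Type*} [Field K] [CharZero K] {r : ℕ}
variable {E : Type*} [AddCommGroup E] [Module K E]

theorem flipR_congr {ρ ρ' : Fin r → ℕ} (h : ∀ i j, ρ i < ρ j ↔ ρ' i < ρ' j) :
    flipR ρ = flipR ρ' := by
  funext p
  unfold flipR
  rw [decide_eq_decide]
  exact h _ _

theorem koszulR_congr {ρ ρ' : Fin r → ℕ} (h : ∀ i j, ρ i < ρ j ↔ ρ' i < ρ' j)
    (ps : Fin r → ZMod 2) : koszulR (K := K) ps ρ = koszulR ps ρ' := by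
  simp only [koszulR, signPair, h]

theorem exists_perm_of_pairwise {ρ : Fin r → ℕ} {l : List (Fin r)}
    (hl : l.Pairwise fun i j => ρ i < ρ j) (hm : ∀ i, i ∈ l) :
    ∃ σ : Equiv.Perm (Fin r), (List.ofFn fun j => σ j) = l ∧
      ∀ i j, ρ i < ρ j ↔ ((σ.symm i : Fin r) : ℕ) < (σ.symm j : Fin r) := by
  have hnd : l.Nodup := hl.imp fun h => by rintro rfl; exact lt_irrefl _ h
  have hlen : l.length = r := by
    have := Fintype.card_congr (hnd.getEquivOfForallMemList l hm)
    simpa using this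
  set e : Fin l.length ≃ Fin r := hnd.getEquivOfForallMemList l hm
  have he : ∀ x, e x = l.get x := fun x => rfl
  have hmono : ∀ a b : Fin l.length, a < b → ρ (e a) < ρ (e b) := fun a b hab =>
    List.pairwise_iff_get.1 hl a b hab
  refine ⟨(finCongr hlen.symm).trans e, ?_, fun i j => ?_⟩
  · refine List.ext_getElem (by simp [hlen]) fun n h1 h2 => ?_
    simp [he]
  · obtain ⟨a, rfl⟩ := e.surjective i
    obtain ⟨b, rfl⟩ := e.surjective j
    simp only [Equiv.symm_trans_apply, Equiv.symm_apply_apply, finCongr_symm, finCongr_apply,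
      Fin.val_cast]
    constructor
    · intro h
      by_contra hc
      rcases (not_lt.1 hc).eq_or_lt with h' | h'
      · rw [Fin.ext h'] at h; exact lt_irrefl _ h
      · exact lt_asymm h (hmono b a h')
    · exact hmono a b

theorem IsMultOPE.ml {a : Fin r → EDist1 K E} {ps : Fin r → ZMod 2} {rij : Fin r → Fin r → ℕ}
    {hs : ∀ i j : Fin r, Fin (rij i j) → Idx K}
    {c : ((p : Pairs r) → Fin (rij p.1.1 p.1.2)) → EDistN K E r}
    (h : IsMultOPE K E a ps rij hs c) {H : Fin r → Fin r → Set (Idx K)} {pw : Prop} {one : E}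
    (hH : ∀ (p : Pairs r) x, hs p.1.1 p.1.2 x ∈ H p.1.1 p.1.2)
    (hpw : pw → ∀ α, IsPowN K E (evN K E (c α) one)) : ML a ps H pw one := by
  obtain ⟨h1, h2, h3⟩ := h
  refine ⟨_, inferInstance, fun α p => hs p.1.1 p.1.2 (α p), c, fun α p => hH p _,
    fun α p => h1 _ _ _, h2, hpw, fun ρ l hl hm v m => ?_⟩
  obtain ⟨σ, rfl, hσ⟩ := exists_perm_of_pairwise hl hm
  rw [koszulR_congr hσ, ← koszulPerm_eq, comp_apply]
  refine (h3 σ v m).trans (Finset.sum_congr rfl fun α _ => ?_)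
  rw [permMul_eq_permMulR, permMulR_congr (flipR_congr hσ)]
  rfl

theorem MultiplyLocal.ml {a : Fin r → EDist1 K E} {ps : Fin r → ZMod 2}
    (h : MultiplyLocal K E a ps) (one : E) :
    ML a ps (fun _ _ => {x | Kbar K x}) False one := by
  obtain ⟨rij, hs, c, h⟩ := h
  exact h.ml (fun p x => h.1 _ _ x) False.elim

theorem ML.isMultOPE {f : Fin r → EDist1 K E} {ps : Fin r → ZMod 2}
    {H : Fin r → Fin r → Set (Idx K)} {pw : Prop} {one : E} (h : ML f ps H pw one)
    {rij : Fin r → Fin r → ℕ} {hh : ∀ i j : Fin r, Fin (rij i j) → Idx K}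
    (hH : ∀ p : Pairs r, H p.1.1 p.1.2 ⊆ Set.range (hh p.1.1 p.1.2))
    (hK : ∀ i j k, Kbar K (hh i j k)) :
    ∃ c, IsMultOPE K E f ps rij hh c ∧ (pw → ∀ α, IsPowN K E (evN K E (c α) one)) := by
  obtain ⟨B, hB, hs, c, h1, h2, h3, h4, h5⟩ := h
  choose α hα using fun β p => hH p (h1 β p)
  have hev : ∀ α' v, evN K E (∑ β ∈ Finset.univ.filter (fun β => α β = α'), c β) v =
      ∑ β ∈ Finset.univ.filter (fun β => α β = α'), evN K E (c β) v := by
    intro α' v; funext n; simp [evN]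
  refine ⟨fun α' => ∑ β ∈ Finset.univ.filter (fun β => α β = α'), c β,
    ⟨hK, fun α' v => ?_, fun σ v m => ?_⟩, fun hp α' n hn i => ?_⟩
  · rw [hev]
    choose S hS using fun β => h3 β v
    refine ⟨Finset.univ.biUnion S, fun n hn => ?_⟩
    rw [Finset.sum_apply] at hn
    obtain ⟨β, -, hβ⟩ := Finset.exists_ne_zero_of_sum_ne_zero hn
    obtain ⟨m, hm, hm'⟩ := hS β n hβ
    exact ⟨m, Finset.mem_biUnion.2 ⟨β, Finset.mem_univ _, hm⟩, hm'⟩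
  · have := h5 (fun i => ((σ.symm i : Fin r) : ℕ)) (List.ofFn fun j => σ j) (by
      rw [List.pairwise_ofFn]; intro i j hij; simpa using hij) (by
      intro i; rw [List.mem_ofFn]; exact ⟨σ.symm i, by simp⟩) v m
    rw [← koszulPerm_eq, comp_apply] at this
    refine this.trans ?_
    rw [← Finset.sum_fiberwise Finset.univ α]
    refine Finset.sum_congr rfl fun α' _ => ?_
    rw [hev, permMul_eq_permMulR, permMulR_sum _ (fun β _ => adm_of_inLatN _ (h3 β v))
      (fun p hp => absurd (σ.symm.injective (Fin.ext hp)) (pairs_ne p)), Finset.sum_apply]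
    refine Finset.sum_congr rfl fun β hβ => ?_
    obtain rfl : α β = α' := (Finset.mem_filter.1 hβ).2
    congr 1
    funext p
    simp [hα]
  · rw [hev, Finset.sum_apply] at hn
    obtain ⟨β, -, hβ⟩ := Finset.exists_ne_zero_of_sum_ne_zero hn
    exact h4 hp β n hβ i

theorem ML.multiplyLocal {f : Fin r → EDist1 K E} {ps : Fin r → ZMod 2}
    {H : Fin r → Fin r → Set (Idx K)} {pw : Prop} {one : E} (h : ML f ps H pw one) :
    MultiplyLocal K E f ps := by
  obtain ⟨B, hB, hs, c, h1, h2, h3, h4, h5⟩ := h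
  have h' : ML f ps (fun i j => Set.range fun β => exP (hs β) i j) pw one :=
    ⟨B, hB, hs, c, fun β p => ⟨β, exP_pair _ _⟩, h2, h3, h4, h5⟩
  obtain ⟨c', hc', -⟩ := h'.isMultOPE (rij := fun _ _ => Fintype.card B)
    (hh := fun i j x => exP (hs ((Fintype.equivFin B).symm x)) i j)
    (by rintro p _ ⟨β, rfl⟩; exact ⟨Fintype.equivFin B β, by simp⟩)
    (fun i j x => exP_kbar (h2 _) i j)
  exact ⟨_, _, _, hc'⟩

theorem zwPowW_slice {ρ : Fin (r + 1) → ℕ} (k : Fin r) (hρ : ρ k.succ < ρ k.castSucc)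
    (n : Fin r → Idx K) {M : Type*} [AddCommGroup M] [Module K M]
    (D : DistN K M (r + 1)) (h x y : Idx K) :
    zwPowW K M h (slice k n D) x y = pairMul ρ (midPair k) h D (sliceArg k n x y) := by
  have hf : flipR ρ (midPair k) = true := by
    show decide (ρ k.succ < ρ k.castSucc) = true
    exact decide_eq_true hρ
  have h0 := castSucc_ne_succ' k
  unfold zwPowW pairMul
  rw [hf]
  congr 1; funext i
  simp only [pairCoef, slice, if_true]
  congr 2
  funext j
  simp only [sliceArg, leadV, tailV, dirV, midPair, if_true, Pi.add_apply,
    Pi.sub_apply]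
  by_cases h1 : j = k.castSucc
  · subst h1
    simp only [if_true, Pi.single_eq_same, Pi.single_eq_of_ne h0, nc]
    ext <;> simp
  · by_cases h2 : j = k.succ
    · subst h2
      simp only [if_true, h0.symm, if_false, Pi.single_eq_same, Pi.single_eq_of_ne h0.symm, nc]
      ext <;> simp <;> ring
    · simp [h1, h2]

theorem pairs_two (p : Pairs 2) : p = midPair 0 := by
  obtain ⟨⟨a, b⟩, h⟩ := p
  have h' : (a : ℕ) < b := h
  have ha : (a : ℕ) = 0 ∧ (b : ℕ) = 1 := by omega
  exact Subtype.ext (Prod.ext (Fin.ext ha.1) (Fin.ext ha.2))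

theorem permMulR_two {M : Type*} [AddCommGroup M] [Module K M] {ρ : Fin 2 → ℕ} (hρ : ρ 0 ≠ ρ 1)
    {hs : Pairs 2 → Idx K} (hK : ∀ p, Kbar K (hs p)) {D : DistN K M 2} (hD : InLatN K M D) :
    permMulR ρ hs D = pairMul ρ (midPair 0) (hs (midPair 0)) D := by
  have h1 : hs = 0 + Pi.single (midPair 0) (hs (midPair 0)) := by
    funext p; rw [pairs_two p]; simp
  conv_lhs => rw [h1]
  rw [← pairMul_permMulR (hs := (0 : Pairs 2 → Idx K)) (adm_of_inLatN ρ hD) (fun p _ => rfl) (fun q => Kbar_zero) (by exact hρ)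
    (hK _), permMulR_zero]

theorem ML.isLocal {f : Fin 2 → EDist1 K E} {ps : Fin 2 → ZMod 2}
    {H : Fin 2 → Fin 2 → Set (Idx K)} {pw : Prop} {one : E} (h : ML f ps H pw one) :
    IsLocal K E (ps 0) (ps 1) (f 0) (f 1) := by
  obtain ⟨B, hB, hs, c, h1, h2, h3, h4, h5⟩ := h
  have hK : ∀ β p, Kbar K ((-hs β) p) := fun β p => (h2 β p).neg
  refine isLocal_of_fintype (fun β x y => c β (sliceArg 0 0 x y)) (fun β => hs β (midPair 0))
    (fun β => h2 β _) (fun β v => ?_) (fun v m k => ?_) (fun v m k => ?_)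
  · obtain ⟨S, hS⟩ := h3 β v
    refine ⟨S.image fun s => (s 0, s 1), fun n k hn => ?_⟩
    obtain ⟨s, hs, hs'⟩ := hS _ hn
    exact ⟨_, Finset.mem_image_of_mem _ hs, hs' 0, hs' 1⟩
  · have := h5 (fun i => (i : ℕ)) [0, 1] (by simp) (by simp [Fin.forall_fin_two]) v
      (sliceArg 0 0 m k)
    have hk : koszulR (K := K) ps (fun i : Fin 2 => (i : ℕ)) = 1 := by
      simp [koszulR, signPair, Fin.prod_univ_two]
    rw [hk, one_smul, comp_apply] at this
    refine Eq.trans ?_ (this.trans (Finset.sum_congr rfl fun β _ => ?_))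
    · simp [sliceArg]
    · rw [permMulR_two (by simp) (hK β) (h3 β v), ← zwPow_slice 0 (by simp)]
      rfl
  · have := h5 (fun i => 1 - (i : ℕ)) [1, 0] (by simp) (by simp [Fin.forall_fin_two]) v
      (sliceArg 0 0 m k)
    have hk : koszulR (K := K) ps (fun i : Fin 2 => 1 - (i : ℕ)) = koszul K (ps 0) (ps 1) := by
      simp [koszulR, signPair, Fin.prod_univ_two, koszul]
    rw [hk, comp_apply] at this
    refine Eq.trans ?_ (this.trans (Finset.sum_congr rfl fun β _ => ?_))
    · simp [sliceArg]
    · rw [permMulR_two (by simp) (hK β) (h3 β v), ← zwPowW_slice 0 (by simp)]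
      rfl

theorem comp_update {f : Fin r → EDist1 K E} {m : Fin r → Idx K} {u w : List (Fin r)} {k : Fin r}
    (hu : k ∉ u) (hw : k ∉ w) (x : EDist1 K E) :
    comp (Function.update f k x) m (u ++ k :: w) = comp f m u * (x (m k) * comp f m w) := by
  have h : ∀ t : List (Fin r), k ∉ t → comp (Function.update f k x) m t = comp f m t := by
    intro t ht
    unfold comp
    congr 1
    refine List.map_congr_left fun i hi => ?_
    rw [Function.update_of_ne]; rintro rfl; exact ht hi
  rw [← h u hu, ← h w hw]
  simp [comp]

theorem exists_split {ρ : Fin r → ℕ} {l : List (Fin r)}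
    (hl : l.Pairwise fun i j => ρ i < ρ j) {k : Fin r} (hm : k ∈ l) :
    ∃ u w, l = u ++ k :: w ∧ k ∉ u ∧ k ∉ w := by
  obtain ⟨u, w, rfl⟩ := List.append_of_mem hm
  rw [List.pairwise_append, List.pairwise_cons] at hl
  exact ⟨u, w, rfl, fun h => lt_irrefl _ (hl.2.2 k h k List.mem_cons_self),
    fun h => lt_irrefl _ (hl.2.1.1 k h)⟩

/-- the fields which can be inserted at position `k` -/
def mlSubmodule (f : Fin r → EDist1 K E) (ps : Fin r → ZMod 2) (H : Fin r → Fin r → Set (Idx K))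
    (pw : Prop) (one : E) (k : Fin r) : Submodule K (EDist1 K E) where
  carrier := {x | ML (Function.update f k x) ps H pw one}
  zero_mem' := by
    refine ⟨Empty, inferInstance, Empty.elim, Empty.elim, by rintro ⟨⟩, by rintro ⟨⟩, by rintro ⟨⟩,
      by rintro _ ⟨⟩, fun ρ l hl hm v m => ?_⟩
    obtain ⟨u, w, rfl, hu, hw⟩ := exists_split hl (hm k)
    rw [comp_update hu hw]; simp
  add_mem' := by
    rintro x y ⟨B, hB, hs, c, h1, h2, h3, h4, h5⟩ ⟨B', hB', hs', c', h1', h2', h3', h4', h5'⟩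
    refine ⟨B ⊕ B', inferInstance, Sum.elim hs hs', Sum.elim c c', ?_, ?_, ?_, ?_,
      fun ρ l hl hm v m => ?_⟩
    · rintro (β | β) p; exacts [h1 β p, h1' β p]
    · rintro (β | β) p; exacts [h2 β p, h2' β p]
    · rintro (β | β) v; exacts [h3 β v, h3' β v]
    · rintro hp (β | β); exacts [h4 hp β, h4' hp β]
    · have e1 := h5 ρ l hl hm v m
      have e2 := h5' ρ l hl hm v m
      obtain ⟨u, w, rfl, hu, hw⟩ := exists_split hl (hm k)
      rw [comp_update hu hw] at e1 e2 ⊢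
      rw [Fintype.sum_sum_type]
      simp only [Sum.elim_inl, Sum.elim_inr]
      rw [← e1, ← e2]
      simp
  smul_mem' := by
    rintro a x ⟨B, hB, hs, c, h1, h2, h3, h4, h5⟩
    have hev : ∀ β v, evN K E (a • c β) v = a • evN K E (c β) v := fun _ _ => rfl
    refine ⟨B, hB, hs, fun β => a • c β, h1, h2, fun β v => ?_, fun hp β n hn => ?_,
      fun ρ l hl hm v m => ?_⟩
    · obtain ⟨S, hS⟩ := h3 β v
      exact ⟨S, fun n hn => hS n (right_ne_zero_of_smul hn)⟩
    · exact h4 hp β n (right_ne_zero_of_smul hn)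
    · have e1 := h5 ρ l hl hm v m
      obtain ⟨u, w, rfl, hu, hw⟩ := exists_split hl (hm k)
      rw [comp_update hu hw] at e1 ⊢
      simp only [hev, permMulR_smul, Pi.smul_apply]
      rw [← Finset.smul_sum, ← e1]
      simp [smul_comm a]

theorem ML.span {ps : Fin r → ZMod 2} {H : Fin r → Fin r → Set (Idx K)} {pw : Prop} {one : E}
    {X : Fin r → Set (EDist1 K E)} (h : ∀ f, (∀ i, f i ∈ X i) → ML f ps H pw one)
    {f : Fin r → EDist1 K E} (hf : ∀ i, f i ∈ Submodule.span K (X i)) : ML f ps H pw one := by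
  suffices hs : ∀ (s : Finset (Fin r)) (f : Fin r → EDist1 K E),
      (∀ i ∈ s, f i ∈ Submodule.span K (X i)) → (∀ i ∉ s, f i ∈ X i) → ML f ps H pw one from
    hs Finset.univ f (fun i _ => hf i) (fun i hi => absurd (Finset.mem_univ i) hi)
  intro s
  induction s using Finset.induction_on with
  | empty => exact fun f _ h0 => h f fun i => h0 i (Finset.notMem_empty i)
  | insert k s hk ih =>
    intro f h1 h2
    have hle : Submodule.span K (X k) ≤ mlSubmodule f ps H pw one k := by
      refine Submodule.span_le.2 fun x hx => ih _ (fun i hi => ?_) fun i hi => ?_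
      · rw [Function.update_of_ne (by rintro rfl; exact hk hi)]
        exact h1 i (Finset.mem_insert_of_mem hi)
      · by_cases hik : i = k
        · subst hik; rwa [Function.update_self]
        · rw [Function.update_of_ne hik]
          exact h2 i (by simp [hik, hi])
    have := hle (h1 k (Finset.mem_insert_self k s))
    change ML (Function.update f k (f k)) ps H pw one at this
    rwa [Function.update_eq_self] at this

end Conv

section Insertion
variable {K : Type*} [Field K] [CharZero K] {E : Type*} [AddCommGroup E] [Module K E]
  {M : Type*} [AddCommGroup M] [Module K M] {r : ℕ}

/-- the pairs not involving `k` -/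
def insP (k : Fin (r + 1)) (p : Pairs r) : Pairs (r + 1) :=
  ⟨(k.succAbove p.1.1, k.succAbove p.1.2), Fin.strictMono_succAbove k p.2⟩

theorem insP_injective (k : Fin (r + 1)) : Function.Injective (insP k) := by
  intro p q h
  have h' := congrArg Subtype.val h
  simp only [insP, Prod.mk.injEq, Fin.succAbove_right_inj] at h'
  exact Subtype.ext (Prod.ext h'.1 h'.2)

theorem mem_range_insP {k : Fin (r + 1)} {p : Pairs (r + 1)} (h1 : p.1.1 ≠ k) (h2 : p.1.2 ≠ k) :
    p ∈ Set.range (insP k) := by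
  obtain ⟨a, ha⟩ := Fin.exists_succAbove_eq h1
  obtain ⟨b, hb⟩ := Fin.exists_succAbove_eq h2
  have hab : a < b := by
    have := p.2
    rw [← ha, ← hb] at this
    exact (Fin.strictMono_succAbove k).lt_iff_lt.1 this
  exact ⟨⟨(a, b), hab⟩, Subtype.ext (Prod.ext ha hb)⟩

theorem pairShift_insP (k : Fin (r + 1)) (p : Pairs r) (h : Idx K) (f : Bool) (e : ℕ × ℕ)
    (j : Fin r) : pairShift K (insP k p) h f e (k.succAbove j) = pairShift K p h f e j := by
  simp only [pairShift, insP, Fin.succAbove_right_inj]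

theorem pairShift_insP_self (k : Fin (r + 1)) (p : Pairs r) (h : Idx K) (f : Bool) (e : ℕ × ℕ) :
    pairShift K (insP k p) h f e k = 0 := by
  simp [pairShift, insP, (Fin.succAbove_ne k _).symm]

theorem pairShift_zero_zero (p : Pairs r) (f : Bool) (i : Fin r) :
    pairShift K p 0 f 0 i = 0 := by
  simp [pairShift_eq, dirV, nc_zero]

/-- insertion of the delta-like coefficient of the identity field at position `k` -/
def insD (k : Fin (r + 1)) (D : DistN K M r) : DistN K M (r + 1) :=
  fun n => if n k = (-1, -1) then D (fun j => n (k.succAbove j)) else 0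

theorem permMulR_insD (k : Fin (r + 1)) (ρ : Fin (r + 1) → ℕ) (hs : Pairs r → Idx K)
    (D : DistN K M r) :
    permMulR ρ (Function.extend (insP k) hs 0) (insD k D) =
      insD k (permMulR (fun j => ρ (k.succAbove j)) hs D) := by
  have hi := insP_injective k
  funext m
  have hfi : Function.Injective
      fun κ : Pairs r → ℕ × ℕ => Function.extend (insP k) κ (0 : Pairs (r + 1) → ℕ × ℕ) :=
    fun x y h => by
      funext p
      have := congrFun h (insP k p)
      simpa only [hi.extend_apply] using this
  unfold permMulR
  rw [finsum_of_injective hfi]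
  · simp only [insD]
    have hk : ∀ κ : Pairs r → ℕ × ℕ, ∑ p : Pairs (r + 1), pairShift K p
        (Function.extend (insP k) hs 0 p) (flipR ρ p) (Function.extend (insP k) κ 0 p) k = 0 := by
      refine fun κ => Finset.sum_eq_zero fun p _ => ?_
      by_cases hp : p ∈ Set.range (insP k)
      · obtain ⟨q, rfl⟩ := hp
        exact pairShift_insP_self ..
      · rw [Function.extend_apply' _ _ _ hp, Function.extend_apply' _ _ _ hp]
        exact pairShift_zero_zero ..
    have hj : ∀ (κ : Pairs r → ℕ × ℕ) (j : Fin r), ∑ p : Pairs (r + 1), pairShift K p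
        (Function.extend (insP k) hs 0 p) (flipR ρ p) (Function.extend (insP k) κ 0 p)
          (k.succAbove j) =
        ∑ p, pairShift K p (hs p) (flipR (fun j => ρ (k.succAbove j)) p) (κ p) j := by
      refine fun κ j => (Fintype.sum_of_injective (insP k) hi _ _ (fun p hp => ?_)
        fun p => ?_).symm
      · rw [Function.extend_apply' _ _ _ hp, Function.extend_apply' _ _ _ hp]
        exact pairShift_zero_zero ..
      · rw [hi.extend_apply, hi.extend_apply, pairShift_insP]
        rfl
    have hc : ∀ κ : Pairs r → ℕ × ℕ, ∏ p : Pairs (r + 1), pairCoef K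
        (Function.extend (insP k) hs 0 p) (flipR ρ p) (Function.extend (insP k) κ 0 p) =
        ∏ p, pairCoef K (hs p) (flipR (fun j => ρ (k.succAbove j)) p) (κ p) := by
      refine fun κ => (Fintype.prod_of_injective (insP k) hi _ _ (fun p hp => ?_)
        fun p => ?_).symm
      · rw [Function.extend_apply' _ _ _ hp, Function.extend_apply' _ _ _ hp]
        simp [pairCoef_zero]
      · rw [hi.extend_apply, hi.extend_apply]
        rfl
    by_cases hm : m k = (-1, -1)
    · simp only [hk, hj, hc, add_zero, hm, if_true]
    · simp only [hk, add_zero, hm, if_false, smul_zero, finsum_zero]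
  · intro κ hκ
    have : ∃ p, p ∉ Set.range (insP k) ∧ κ p ≠ 0 := by
      by_contra! hcon
      refine hκ ⟨fun q => κ (insP k q), ?_⟩
      funext p
      by_cases hp : p ∈ Set.range (insP k)
      · obtain ⟨q, rfl⟩ := hp
        exact hi.extend_apply _ _ _
      · exact (Function.extend_apply' _ _ _ hp).trans (hcon p hp).symm
    obtain ⟨p, hp, hp'⟩ := this
    rw [Finset.prod_eq_zero (Finset.mem_univ p), zero_smul]
    rw [Function.extend_apply' _ _ _ hp]
    simp [pairCoef_zero, hp']

theorem inLatN_insD (k : Fin (r + 1)) {D : DistN K M r} (h : InLatN K M D) :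
    InLatN K M (insD k D) := by
  rw [inLatN_iff] at h ⊢
  obtain ⟨S, hS⟩ := h
  refine ⟨S.image fun s => k.insertNth (-1, -1) s, fun n hn => ?_⟩
  have hk : n k = (-1, -1) := by
    by_contra hk
    exact hn (if_neg hk)
  rw [insD, if_pos hk] at hn
  obtain ⟨s, hs, e, he⟩ := hS _ hn
  refine ⟨_, Finset.mem_image_of_mem _ hs, k.insertNth 0 e, fun i => ?_⟩
  rcases Fin.eq_self_or_eq_succAbove k i with rfl | ⟨j, rfl⟩
  · simp [hk, nc_zero]
  · simpa using he j

theorem isPowN_insD (k : Fin (r + 1)) {D : DistN K M r} (h : IsPowN K M D) :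
    IsPowN K M (insD k D) := by
  intro n hn i
  have hk : n k = (-1, -1) := by
    by_contra hk
    exact hn (if_neg hk)
  rw [insD, if_pos hk] at hn
  rcases Fin.eq_self_or_eq_succAbove k i with rfl | ⟨j, rfl⟩
  · rw [hk]
    exact ⟨⟨-1, by simp⟩, ⟨-1, by simp⟩⟩
  · exact h _ hn j

theorem koszulR_ins (k : Fin (r + 1)) {ps : Fin (r + 1) → ZMod 2} (h : ps k = 0)
    (ρ : Fin (r + 1) → ℕ) :
    koszulR (K := K) ps ρ =
      koszulR (fun j => ps (k.succAbove j)) (fun j => ρ (k.succAbove j)) := by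
  simp only [koszulR]
  rw [Fin.prod_univ_succAbove _ k]
  have h1 : ∀ j, signPair (K := K) ρ ps k j = 1 := fun j => by simp [signPair, h]
  have h2 : ∀ i, signPair (K := K) ρ ps i k = 1 := fun j => by simp [signPair, h]
  simp only [Fin.prod_univ_succAbove _ k, h1, h2, one_mul, Finset.prod_const_one]
  refine Finset.prod_congr rfl fun i _ => Finset.prod_congr rfl fun j _ => ?_
  simp only [signPair, (Fin.strictMono_succAbove k).lt_iff_lt]

theorem ML.insert_idField {f : Fin (r + 1) → EDist1 K E} {ps : Fin (r + 1) → ZMod 2}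
    {H : Fin (r + 1) → Fin (r + 1) → Set (Idx K)} {pw : Prop} {one : E} (k : Fin (r + 1))
    (hf : f k = idField K E) (hps : ps k = 0) (hH : ∀ j, 0 ∈ H k j ∧ 0 ∈ H j k)
    (h : ML (fun j => f (k.succAbove j)) (fun j => ps (k.succAbove j))
      (fun i j => H (k.succAbove i) (k.succAbove j)) pw one) : ML f ps H pw one := by
  have hi := insP_injective k
  obtain ⟨B, hB, hs, c, h1, h2, h3, h4, h5⟩ := h
  have hev : ∀ β v, evN K E (insD k (c β)) v = insD k (evN K E (c β) v) := by
    intro β v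
    funext n
    simp only [evN, insD]
    split_ifs <;> rfl
  refine ⟨B, hB, fun β => Function.extend (insP k) (hs β) 0, fun β => insD k (c β),
    fun β p => ?_, fun β p => ?_, fun β v => ?_, fun hp β => ?_, fun ρ l hl hm v m => ?_⟩
  · dsimp only
    by_cases hp : p ∈ Set.range (insP k)
    · obtain ⟨q, rfl⟩ := hp
      rw [hi.extend_apply]
      exact h1 β q
    · rw [Function.extend_apply' _ _ _ hp]
      by_cases hp1 : p.1.1 = k
      · rw [hp1]; exact (hH _).1
      · by_cases hp2 : p.1.2 = k
        · rw [hp2]; exact (hH _).2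
        · exact absurd (mem_range_insP hp1 hp2) hp
  · dsimp only
    by_cases hp : p ∈ Set.range (insP k)
    · obtain ⟨q, rfl⟩ := hp
      rw [hi.extend_apply]
      exact h2 β q
    · rw [Function.extend_apply' _ _ _ hp]
      exact Kbar_zero
  · rw [hev]; exact inLatN_insD k (h3 β v)
  · rw [hev]; exact isPowN_insD k (h4 hp β)
  · obtain ⟨u, w, rfl, hu, hw⟩ := exists_split hl (hm k)
    have hr : ∀ x ∈ u ++ w, x ∈ Set.range k.succAbove := by
      intro x hx
      refine Fin.exists_succAbove_eq ?_
      rintro rfl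
      exact (List.mem_append.1 hx).elim hu hw
    obtain ⟨l', hl'⟩ : ∃ l', List.map k.succAbove l' = u ++ w := by
      have : u ++ w ∈ Set.range (List.map k.succAbove) := by
        rw [Set.range_list_map]
        exact hr
      exact this
    have hpw : l'.Pairwise fun i j => ρ (k.succAbove i) < ρ (k.succAbove j) := by
      have h' : (u ++ w).Pairwise fun i j => ρ i < ρ j :=
        hl.sublist ((List.Sublist.refl u).append (List.sublist_cons_self k w))
      rwa [← hl', List.pairwise_map] at h'
    have hm' : ∀ i, i ∈ l' := by
      intro i
      have h' : k.succAbove i ∈ u ++ w := by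
        have := hm (k.succAbove i)
        simp only [List.mem_append, List.mem_cons, Fin.succAbove_ne, false_or] at this ⊢
        exact this
      rw [← hl', List.mem_map] at h'
      obtain ⟨y, hy, hy'⟩ := h'
      rwa [← Fin.succAbove_right_injective hy']
    have hcomp : comp f m (u ++ k :: w) v =
        if m k = (-1, -1) then
          comp (fun j => f (k.succAbove j)) (fun j => m (k.succAbove j)) l' v else 0 := by
      have h' : comp (fun j => f (k.succAbove j)) (fun j => m (k.succAbove j)) l' =
          comp f m u * comp f m w := by
        have : comp f m (u ++ w) = comp f m u * comp f m w := by
          simp [comp]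
        rw [← this, ← hl']
        simp [comp, Function.comp_def]
      have h'' : comp f m (u ++ k :: w) = comp f m u * (f k (m k) * comp f m w) := by
        simp [comp]
      rw [h', h'', hf, idField]
      split_ifs <;> simp
    have hneg : ∀ β, -Function.extend (insP k) (hs β) 0 = Function.extend (insP k) (-hs β) 0 := by
      intro β
      funext p
      by_cases hp : p ∈ Set.range (insP k)
      · obtain ⟨q, rfl⟩ := hp
        rw [Pi.neg_apply, hi.extend_apply, hi.extend_apply]
        rfl
      · rw [Pi.neg_apply, Function.extend_apply' _ _ _ hp, Function.extend_apply' _ _ _ hp]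
        simp
    simp only [hcomp, hneg, hev, permMulR_insD, koszulR_ins k hps]
    simp only [insD]
    split_ifs
    · exact h5 _ l' hpw hm' v _
    · simp

end Insertion

section Monomials
variable {K : Type*} [Field K] [CharZero K] {E : Type*} [AddCommGroup E] [Module K E] {ι : Type*}

/-- the nested product fields `S i₁ ₍ₙ₁₎ (S i₂ ₍ₙ₂₎ (⋯ 1(z)))` -/
def monField (S : ι → EDist1 K E) : List (ι × Idx K) → EDist1 K E
  | [] => idField K E
  | t :: l => if h : ∃ g, IsProd (S t.1) (monField S l) t.2 g then h.choose else 0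

def monPar (ps : ι → ZMod 2) : List (ι × Idx K) → ZMod 2
  | [] => 0
  | t :: l => ps t.1 + monPar ps l

/-- generators together with nested products -/
def genF (S : ι → EDist1 K E) : ι ⊕ List (ι × Idx K) → EDist1 K E := Sum.elim S (monField S)

def genPar (ps : ι → ZMod 2) : ι ⊕ List (ι × Idx K) → ZMod 2 := Sum.elim ps (monPar ps)

def genSize : ι ⊕ List (ι × Idx K) → ℕ := Sum.elim (fun _ => 0) (fun l => l.length + 1)

/-- a system of exponent sets stable under the formation of nested products -/
structure ExpClosed (H : ι ⊕ List (ι × Idx K) → ι ⊕ List (ι × Idx K) → Set (Idx K)) : Prop where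
  nil_left : ∀ X, 0 ∈ H (.inr []) X
  nil_right : ∀ X, 0 ∈ H X (.inr [])
  cons_left : ∀ i n l X, ∀ x ∈ H (.inl i) X, ∀ y ∈ H (.inr l) X, ∀ z ∈ H (.inl i) (.inr l),
    ∀ e d : ℕ × ℕ, nc e = z - 1 - n → d ≤ e → x + y + nc d ∈ H (.inr ((i, n) :: l)) X
  cons_right : ∀ i n l X, ∀ x ∈ H X (.inl i), ∀ y ∈ H X (.inr l), ∀ z ∈ H (.inl i) (.inr l),
    ∀ e d : ℕ × ℕ, nc e = z - 1 - n → d ≤ e → x + y + nc d ∈ H X (.inr ((i, n) :: l))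

theorem exists_isProd_of_isLocal {p q : ZMod 2} {a b : EDist1 K E} (h : IsLocal K E p q a b)
    (n : Idx K) : ∃ g, IsProd a b n g := by
  obtain ⟨r, c, hs, -, h1, h2, -⟩ := h
  exact exists_isProd n (⟨h1, h2⟩ : HalfOPE a b c hs)

theorem isProd_monField {S : ι → EDist1 K E} {p q : ZMod 2} {i : ι} {l : List (ι × Idx K)}
    (h : IsLocal K E p q (S i) (monField S l)) (n : Idx K) :
    IsProd (S i) (monField S l) n (monField S ((i, n) :: l)) := by
  have h' : ∃ g, IsProd (S (i, n).1) (monField S l) (i, n).2 g := exists_isProd_of_isLocal h n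
  rw [monField, dif_pos h']
  exact h'.choose_spec

theorem ML.of_generators {S : ι → EDist1 K E} {ps : ι → ZMod 2}
    {H : ι ⊕ List (ι × Idx K) → ι ⊕ List (ι × Idx K) → Set (Idx K)} {pw : Prop} {one : E}
    (hH : ExpClosed H)
    (hS : ∀ (r : ℕ) (f : Fin r → ι), ML (fun j => S (f j)) (fun j => ps (f j))
      (fun i j => H (.inl (f i)) (.inl (f j))) pw one) (r : ℕ)
    (f : Fin r → ι ⊕ List (ι × Idx K)) :
    ML (fun j => genF S (f j)) (fun j => genPar ps (f j)) (fun i j => H (f i) (f j)) pw one := by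
  induction hN : ∑ j, genSize (f j) using Nat.strong_induction_on generalizing r f with
  | _ N ih =>
  subst hN
  by_cases hf : ∀ j, ∃ i, f j = .inl i
  · choose g hg using hf
    obtain rfl : f = fun j => .inl (g j) := funext hg
    exact hS r g
  push Not at hf
  obtain ⟨k, hk⟩ := hf
  obtain ⟨t, ht⟩ : ∃ t, f k = .inr t := by
    rcases hfk : f k with i | t
    · exact absurd hfk (hk i)
    · exact ⟨t, rfl⟩
  rcases t with _ | ⟨⟨i, n⟩, l⟩
  · obtain ⟨r, rfl⟩ : ∃ r', r = r' + 1 := ⟨r - 1, by have := k.2; omega⟩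
    refine ML.insert_idField k ?_ ?_ ?_ (ih _ ?_ r (fun j => f (k.succAbove j)) rfl)
    · rw [ht]; rfl
    · rw [ht]; rfl
    · intro j
      rw [ht]
      exact ⟨hH.nil_left _, hH.nil_right _⟩
    · rw [Fin.sum_univ_succAbove _ k, ht]
      simp [genSize]
  · have hsum : ∑ j, genSize (f j) = (l.length + 2) +
        ∑ j, genSize (Function.update f k (.inl i) j) := by
      rw [← Finset.add_sum_erase _ _ (Finset.mem_univ k),
        ← Finset.add_sum_erase (a := k) _ (fun j => genSize (Function.update f k (.inl i) j))
          (Finset.mem_univ k), ht]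
      simp only [Function.update_self]
      have : ∀ j ∈ Finset.univ.erase k, genSize (Function.update f k (.inl i) j) =
          genSize (f j) := fun j hj => by
        rw [Function.update_of_ne (Finset.ne_of_mem_erase hj)]
      rw [Finset.sum_congr rfl this]
      simp [genSize]
    have hsum' : ∑ j, genSize (Function.update f k (.inr l) j) = (l.length + 1) +
        ∑ j, genSize (Function.update f k (.inl i) j) := by
      rw [← Finset.add_sum_erase (a := k) _ (fun j => genSize (Function.update f k (.inr l) j))
          (Finset.mem_univ k),
        ← Finset.add_sum_erase (a := k) _ (fun j => genSize (Function.update f k (.inl i) j))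
          (Finset.mem_univ k)]
      simp only [Function.update_self]
      have : ∀ j ∈ Finset.univ.erase k, genSize (Function.update f k (.inr l) j) =
          genSize (Function.update f k (.inl i) j) := fun j hj => by
        rw [Function.update_of_ne (Finset.ne_of_mem_erase hj),
          Function.update_of_ne (Finset.ne_of_mem_erase hj)]
      rw [Finset.sum_congr rfl this]
      simp [genSize]
    have hloc : IsLocal K E (ps i) (monPar ps l) (S i) (monField S l) :=
      (ih _ (by rw [hsum]; simp [genSize, Fin.sum_univ_two]; omega) 2
        ![.inl i, .inr l] rfl).isLocal
    set g : Fin (r + 1) → ι ⊕ List (ι × Idx K) :=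
      (k.castSucc).insertNth (.inl i) (Function.update f k (.inr l)) with hg
    have g1 : g k.castSucc = .inl i := by
      rw [hg, Fin.insertNth_apply_same]
    have g3 : ∀ j, g (k.castSucc.succAbove j) = Function.update f k (.inr l) j := fun j => by
      rw [hg, Fin.insertNth_apply_succAbove]
    have hks : k.succ = k.castSucc.succAbove k := (Fin.succAbove_castSucc_self k).symm
    have g2 : g k.succ = .inr l := by rw [hks, g3, Function.update_self]
    have g4 : ∀ j, j ≠ k → g (k.castSucc.succAbove j) = f j := fun j hj => by
      rw [g3, Function.update_of_ne hj]
    have hIH := ih (∑ j, genSize (g j)) (by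
      rw [Fin.sum_univ_succAbove _ k.castSucc, g1, Finset.sum_congr rfl fun j _ => by rw [g3],
        hsum', hsum]
      simp [genSize]) (r + 1) g rfl
    have hm := hIH.merge k (N := n) (G := monField S ((i, n) :: l)) (by
      rw [g1, g2]; exact isProd_monField hloc n)
    have e1 : mergeF k (fun j => genF S (g j)) (monField S ((i, n) :: l)) =
        fun j => genF S (f j) := by
      funext j
      by_cases hj : j = k
      · subst hj; rw [mergeF, if_pos rfl, ht]; rfl
      · rw [mergeF, if_neg hj, g4 j hj]
    have e2 : mergePar k (fun j => genPar ps (g j)) = fun j => genPar ps (f j) := by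
      funext j
      by_cases hj : j = k
      · subst hj
        rw [mergePar, if_pos rfl, ← hks, g1, g2, ht]
        simp [genPar, monPar, add_comm]
      · rw [mergePar, if_neg hj, g4 j hj, add_zero]
    rw [e1, e2] at hm
    refine hm.mono fun a b hab => ?_
    dsimp only [mergeS]
    split_ifs with ha hb
    · subst ha
      rintro w ⟨x, hx, y, hy, z, hz, e, d, he, hd, rfl⟩
      rw [g4 b hab.ne'] at hx hy
      rw [g1] at hx hz
      rw [g2] at hy hz
      rw [ht]
      exact hH.cons_left i n l _ x hx y hy z hz e d he hd
    · subst hb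
      rintro w ⟨x, hx, y, hy, z, hz, e, d, he, hd, rfl⟩
      rw [g4 a hab.ne] at hx hy
      rw [g1] at hx hz
      rw [g2] at hy hz
      rw [ht]
      exact hH.cons_right i n l _ x hx y hy z hz e d he hd
    · rw [g4 a ha, g4 b hb]

theorem expClosed_kbar :
    ExpClosed (fun _ _ : ι ⊕ List (ι × Idx K) => {x : Idx K | Kbar K x}) where
  nil_left _ := Kbar_zero
  nil_right _ := Kbar_zero
  cons_left _ _ _ _ _ hx _ hy _ _ _ d _ _ := (Kbar.add (Kbar.add hx hy) (Kbar_nc d))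
  cons_right _ _ _ _ _ hx _ hy _ _ _ d _ _ := (Kbar.add (Kbar.add hx hy) (Kbar_nc d))

/-- the smallest exponent sets stable under nested products -/
inductive GenExp (H : ι → ι → Set (Idx K)) :
    ι ⊕ List (ι × Idx K) → ι ⊕ List (ι × Idx K) → Idx K → Prop
  | base (i j : ι) (x : Idx K) (hx : x ∈ H i j) : GenExp H (.inl i) (.inl j) x
  | nil_left (X) : GenExp H (.inr []) X 0
  | nil_right (X) : GenExp H X (.inr []) 0
  | cons_left (i n l X x y z) (e d : ℕ × ℕ) (hx : GenExp H (.inl i) X x)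
      (hy : GenExp H (.inr l) X y) (hz : GenExp H (.inl i) (.inr l) z)
      (he : nc e = z - 1 - n) (hd : d ≤ e) : GenExp H (.inr ((i, n) :: l)) X (x + y + nc d)
  | cons_right (i n l X x y z) (e d : ℕ × ℕ) (hx : GenExp H X (.inl i) x)
      (hy : GenExp H X (.inr l) y) (hz : GenExp H (.inl i) (.inr l) z)
      (he : nc e = z - 1 - n) (hd : d ≤ e) : GenExp H X (.inr ((i, n) :: l)) (x + y + nc d)

theorem expClosed_genExp (H : ι → ι → Set (Idx K)) :
    ExpClosed (fun X Y => {x | GenExp H X Y x}) where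
  nil_left X := .nil_left X
  nil_right X := .nil_right X
  cons_left i n l X x hx y hy z hz e d he hd := .cons_left i n l X x y z e d hx hy hz he hd
  cons_right i n l X x hx y hy z hz e d he hd := .cons_right i n l X x y z e d hx hy hz he hd

theorem finite_mergeExp {A B C : Set (Idx K)} (hA : A.Finite) (hB : B.Finite) (hC : C.Finite)
    (n : Idx K) : {w | ∃ x ∈ A, ∃ y ∈ B, ∃ z ∈ C, ∃ e d : ℕ × ℕ, nc e = z - 1 - n ∧ d ≤ e ∧
      w = x + y + nc d}.Finite := by
  have hD : {d : ℕ × ℕ | ∃ z ∈ C, ∃ e : ℕ × ℕ, nc e = z - 1 - n ∧ d ≤ e}.Finite := by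
    have : {e : ℕ × ℕ | ∃ z ∈ C, nc e = z - 1 - n}.Finite :=
      (Set.Finite.preimage (f := (nc : ℕ × ℕ → Idx K)) (fun a _ b _ h => nc_injective h)
        (hC.image fun z => z - 1 - n)).subset fun e ⟨z, hz, he⟩ => ⟨z, hz, he.symm⟩
    refine (this.biUnion fun e _ => Set.finite_Iic e).subset ?_
    rintro d ⟨z, hz, e, he, hd⟩
    exact Set.mem_biUnion (⟨z, hz, he⟩ : e ∈ {e : ℕ × ℕ | ∃ z ∈ C, nc e = z - 1 - n}) hd
  refine ((hA.prod (hB.prod hD)).image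
    fun t : Idx K × Idx K × (ℕ × ℕ) => t.1 + t.2.1 + nc t.2.2).subset ?_
  rintro w ⟨x, hx, y, hy, z, hz, e, d, he, hd, rfl⟩
  exact ⟨(x, y, d), ⟨hx, hy, z, hz, e, he, hd⟩, rfl⟩

theorem finite_genExp {H : ι → ι → Set (Idx K)} (hH : ∀ i j, (H i j).Finite)
    (X Y : ι ⊕ List (ι × Idx K)) : {x | GenExp H X Y x}.Finite := by
  induction hN : genSize X + genSize Y using Nat.strong_induction_on generalizing X Y with
  | _ N ih =>
  subst hN
  have hleft : ∀ i n l, X = .inr ((i, n) :: l) →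
      {w | ∃ x ∈ {x | GenExp H (.inl i) Y x}, ∃ y ∈ {x | GenExp H (.inr l) Y x},
        ∃ z ∈ {x | GenExp H (.inl i) (.inr l) x}, ∃ e d : ℕ × ℕ, nc e = z - 1 - n ∧ d ≤ e ∧
        w = x + y + nc d}.Finite := by
    rintro i n l rfl
    refine finite_mergeExp (ih _ ?_ _ _ rfl) (ih _ ?_ _ _ rfl) (ih _ ?_ _ _ rfl) n <;>
    (simp only [genSize, Sum.elim_inl, Sum.elim_inr, List.length_cons]; omega)
  have hright : ∀ i n l, Y = .inr ((i, n) :: l) →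
      {w | ∃ x ∈ {x | GenExp H X (.inl i) x}, ∃ y ∈ {x | GenExp H X (.inr l) x},
        ∃ z ∈ {x | GenExp H (.inl i) (.inr l) x}, ∃ e d : ℕ × ℕ, nc e = z - 1 - n ∧ d ≤ e ∧
        w = x + y + nc d}.Finite := by
    rintro i n l rfl
    refine finite_mergeExp (ih _ ?_ _ _ rfl) (ih _ ?_ _ _ rfl) (ih _ ?_ _ _ rfl) n <;>
    (simp only [genSize, Sum.elim_inl, Sum.elim_inr, List.length_cons]; omega)
  have hbase : (⋃ i, ⋃ j, ⋃ (_ : X = .inl i ∧ Y = .inl j), H i j).Finite := by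
    rcases X with i | t
    · rcases Y with j | t
      · refine (hH i j).subset ?_
        simp only [Set.iUnion_subset_iff]
        rintro _ _ ⟨⟨⟩, ⟨⟩⟩
        exact subset_rfl
      · simp
    · simp
  have hl : ∃ A : Set (Idx K), A.Finite ∧ ∀ i n l, X = .inr ((i, n) :: l) →
      {w | ∃ x ∈ {x | GenExp H (.inl i) Y x}, ∃ y ∈ {x | GenExp H (.inr l) Y x},
        ∃ z ∈ {x | GenExp H (.inl i) (.inr l) x}, ∃ e d : ℕ × ℕ, nc e = z - 1 - n ∧ d ≤ e ∧
        w = x + y + nc d} ⊆ A := by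
    by_cases h : ∃ i n l, X = .inr ((i, n) :: l)
    · obtain ⟨i, n, l, h⟩ := h
      refine ⟨_, hleft i n l h, fun i' n' l' h' => ?_⟩
      rw [h] at h'
      cases h'
      exact subset_rfl
    · exact ⟨∅, Set.finite_empty, fun i n l h' => absurd ⟨i, n, l, h'⟩ h⟩
  have hr : ∃ A : Set (Idx K), A.Finite ∧ ∀ i n l, Y = .inr ((i, n) :: l) →
      {w | ∃ x ∈ {x | GenExp H X (.inl i) x}, ∃ y ∈ {x | GenExp H X (.inr l) x},
        ∃ z ∈ {x | GenExp H (.inl i) (.inr l) x}, ∃ e d : ℕ × ℕ, nc e = z - 1 - n ∧ d ≤ e ∧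
        w = x + y + nc d} ⊆ A := by
    by_cases h : ∃ i n l, Y = .inr ((i, n) :: l)
    · obtain ⟨i, n, l, h⟩ := h
      refine ⟨_, hright i n l h, fun i' n' l' h' => ?_⟩
      rw [h] at h'
      cases h'
      exact subset_rfl
    · exact ⟨∅, Set.finite_empty, fun i n l h' => absurd ⟨i, n, l, h'⟩ h⟩
  obtain ⟨A, hA, hA'⟩ := hl
  obtain ⟨B, hB, hB'⟩ := hr
  refine (((hbase.union (Set.finite_singleton 0)).union hA).union hB).subset fun w hw => ?_
  cases hw with
  | base i j x hx =>
    refine .inl (.inl (.inl ?_))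
    simp only [Set.mem_iUnion]
    exact ⟨i, j, ⟨rfl, rfl⟩, hx⟩
  | nil_left => exact .inl (.inl (.inr rfl))
  | nil_right => exact .inl (.inl (.inr rfl))
  | cons_left i n l _ x y z e d hx hy hz he hd =>
    exact .inl (.inr (hA' i n l rfl ⟨x, hx, y, hy, z, hz, e, d, he, hd, rfl⟩))
  | cons_right i n l _ x y z e d hx hy hz he hd =>
    exact .inr (hB' i n l rfl ⟨x, hx, y, hy, z, hz, e, d, he, hd, rfl⟩)

end Monomials

section Gen
variable {K : Type*} [Field K] [CharZero K] {V : Type*} [AddCommGroup V] [Module K V]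

/-- the homogeneous component of parity `p` -/
def parSub (ev od : Submodule K V) (p : ZMod 2) : Submodule K V := if p = 0 then ev else od

theorem zmod_two_cases (p : ZMod 2) : p = 0 ∨ p = 1 := by
  revert p; decide

theorem memPar_iff {ev od : Submodule K V} {a : V} {p : ZMod 2} :
    memPar K ev od a p ↔ a ∈ parSub ev od p := by
  rcases zmod_two_cases p with rfl | rfl <;> simp [memPar, parSub]

theorem endPar_iff {ev od : Submodule K V} {f : Module.End K V} {p : ZMod 2} :
    EndPar K ev od f p ↔ ∀ q, ∀ v ∈ parSub ev od q, f v ∈ parSub ev od (p + q) := by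
  have h2 : (1 : ZMod 2) + 1 = 0 := by decide
  constructor
  · intro h q v hv
    rcases zmod_two_cases p with rfl | rfl <;> rcases zmod_two_cases q with rfl | rfl <;>
      simp only [EndPar, parSub, h2, one_ne_zero, if_true, if_false, add_zero, zero_add]
        at h hv ⊢ <;> first | exact h.1 v hv | exact h.2 v hv
  · intro h
    rcases zmod_two_cases p with rfl | rfl
    · exact ⟨fun v hv => by simpa [parSub] using h 0 v (by simpa [parSub] using hv),
        fun v hv => by simpa [parSub] using h 1 v (by simpa [parSub] using hv)⟩
    · simp only [EndPar, one_ne_zero, if_false]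
      exact ⟨fun v hv => by simpa [parSub] using h 0 v (by simpa [parSub] using hv),
        fun v hv => by simpa [parSub, h2] using h 1 v (by simpa [parSub] using hv)⟩

theorem EDistPar.mem {ev od : Submodule K V} {a : EDist1 K V} {p q : ZMod 2}
    (h : EDistPar K ev od a p) (n : Idx K) {v : V} (hv : v ∈ parSub ev od q) :
    a n v ∈ parSub ev od (p + q) :=
  endPar_iff.1 (h n) q v hv

theorem IsPow1.inLat1 {M : Type*} [AddCommGroup M] [Module K M] {d : Dist1 K M}
    (h : IsPow1 K M d) : InLat1 K M d :=
  ⟨{0}, fun n hn => ⟨0, by simp, by simpa using h n hn⟩⟩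

theorem isPow1_idField (v : V) : IsPow1 K V (ev1 K V (idField K V) v) := by
  intro n hn
  by_cases h : n = (-1, -1)
  · subst h
    exact ⟨⟨-1, by simp⟩, ⟨-1, by simp⟩⟩
  · simp [ev1, idField, h] at hn

theorem transCov_idField (T Tb : Module.End K V) : TransCov K V T Tb (idField K V) := by
  constructor <;> intro n <;> simp only [idField, Prod.ext_iff]
  · by_cases h : n.1 - 1 = -1 ∧ n.2 = -1
    · have h1 : n.1 = 0 := by linear_combination h.1
      simp [h1]
    · rw [if_neg h]
      split_ifs <;> simp
  · by_cases h : n.1 = -1 ∧ n.2 - 1 = -1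
    · have h1 : n.2 = 0 := by linear_combination h.2
      simp [h1]
    · rw [if_neg h]
      split_ifs <;> simp

theorem eDistPar_idField (ev od : Submodule K V) : EDistPar K ev od (idField K V) 0 := by
  intro n
  simp only [idField, EndPar, if_true]
  split_ifs
  · exact ⟨fun v hv => hv, fun v hv => hv⟩
  · exact ⟨fun v _ => ev.zero_mem, fun v _ => od.zero_mem⟩

variable {τ : Type*} [Fintype τ]

theorem IsProd.of_fintype {a b g : EDist1 K V} {n : Idx K} {c : τ → EDist2 K V} {h : τ → Idx K}
    (H : HalfOPE a b c h) (e : ∀ v m, g m v = ∑ i, diagD (h i - 1 - n) (ev2 K V (c i) v) m) :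
    IsProd a b n g := by
  let φ := Fintype.equivFin τ
  refine ⟨Fintype.card τ, fun i => c (φ.symm i), fun i => h (φ.symm i),
    ⟨fun i => H.1 _, fun v m k => ?_⟩, fun v m => ?_⟩
  · rw [H.2]
    exact (Equiv.sum_comp φ.symm fun i => zwPow K V (-(h i)) (ev2 K V (c i) v) m k).symm
  · rw [e]
    exact (Equiv.sum_comp φ.symm fun i => diagD (h i - 1 - n) (ev2 K V (c i) v) m).symm

theorem IsProd.add_left {a a' b g g' : EDist1 K V} {n : Idx K} (h : IsProd a b n g)
    (h' : IsProd a' b n g') : IsProd (a + a') b n (g + g') := by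
  obtain ⟨r, c, e, H, hg⟩ := h
  obtain ⟨r', c', e', H', hg'⟩ := h'
  refine IsProd.of_fintype (c := Sum.elim c c') (h := Sum.elim e e')
    ⟨by rintro (i | i); exacts [H.1 i, H'.1 i], fun v m k => ?_⟩ fun v m => ?_
  · simp [H.2, H'.2]
  · simp [hg, hg']

theorem IsProd.add_right {a b b' g g' : EDist1 K V} {n : Idx K} (h : IsProd a b n g)
    (h' : IsProd a b' n g') : IsProd a (b + b') n (g + g') := by
  obtain ⟨r, c, e, H, hg⟩ := h
  obtain ⟨r', c', e', H', hg'⟩ := h'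
  refine IsProd.of_fintype (c := Sum.elim c c') (h := Sum.elim e e')
    ⟨by rintro (i | i); exacts [H.1 i, H'.1 i], fun v m k => ?_⟩ fun v m => ?_
  · simp [H.2, H'.2]
  · simp [hg, hg']

/-- a system of generating fields -/
structure GenData {ι : Type*} (ev od : Submodule K V) (S : ι → EDist1 K V) (ps : ι → ZMod 2)
    (one : V) (T Tb : Module.End K V) : Prop where
  compl : IsCompl ev od
  one_mem : one ∈ ev
  T_one : T one = 0
  Tb_one : Tb one = 0
  hom : ∀ i, EDistPar K ev od (S i) (ps i)
  fld : ∀ i, IsFieldD K V (S i)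
  pow : ∀ i, IsPow1 K V (ev1 K V (S i) one)
  tc : ∀ i, TransCov K V T Tb (S i)
  ml : ∀ (r : ℕ) (f : Fin r → ι), MultiplyLocal K V (fun j => S (f j)) (fun j => ps (f j))
  span : Submodule.span K (Set.range (wordState S one)) = ⊤

variable {ι : Type*} {ev od : Submodule K V} {S : ι → EDist1 K V} {ps : ι → ZMod 2}
  {one : V} {T Tb : Module.End K V}

theorem IsProd.par {a b g : EDist1 K V} {p q : ZMod 2} {n : Idx K} (hg : IsProd a b n g)
    (ha : EDistPar K ev od a p) (hb : EDistPar K ev od b q) : EDistPar K ev od g (p + q) := by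
  refine fun m => endPar_iff.2 fun s v hv => hg.mem _ v (fun m' k => ?_) m
  rw [add_assoc]
  exact ha.mem m' (hb.mem k hv)

namespace GenData

theorem ml_genF (h : GenData ev od S ps one T Tb) (r : ℕ) (f : Fin r → ι ⊕ List (ι × Idx K)) :
    ML (fun j => genF S (f j)) (fun j => genPar ps (f j)) (fun _ _ => {x | Kbar K x})
      False one :=
  ML.of_generators (H := fun _ _ => {x | Kbar K x}) expClosed_kbar
    (fun r f => (h.ml r f).ml one) r f

theorem isLocal_genF (h : GenData ev od S ps one T Tb) (X Y : ι ⊕ List (ι × Idx K)) :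
    IsLocal K V (genPar ps X) (genPar ps Y) (genF S X) (genF S Y) :=
  (h.ml_genF 2 ![X, Y]).isLocal

theorem isProd (h : GenData ev od S ps one T Tb) (i : ι) (n : Idx K) (l : List (ι × Idx K)) :
    IsProd (S i) (monField S l) n (monField S ((i, n) :: l)) :=
  isProd_monField (h.isLocal_genF (.inl i) (.inr l)) n

theorem isField_monField (h : GenData ev od S ps one T Tb)
    (l : List (ι × Idx K)) : IsFieldD K V (monField S l) := by
  rcases l with _ | ⟨⟨i, n⟩, l⟩
  · exact fun v => (isPow1_idField v).inLat1
  · exact (h.isProd i n l).isField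

theorem transCov_monField (h : GenData ev od S ps one T Tb)
    (l : List (ι × Idx K)) : TransCov K V T Tb (monField S l) := by
  induction l with
  | nil => exact transCov_idField T Tb
  | cons t l ih => exact (h.isProd t.1 t.2 l).transCov (h.tc _) ih

theorem state_monField (h : GenData ev od S ps one T Tb)
    (l : List (ι × Idx K)) : monField S l (-1) one = wordState S one l := by
  induction l with
  | nil =>
    have : (-1 : Idx K) = (-1, -1) := rfl
    simp [monField, idField, this, wordState]
  | cons t l ih =>
    rw [(h.isProd t.1 t.2 l).state (h.tc _) (h.transCov_monField l) (h.fld _)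
      (h.isField_monField l) h.T_one h.Tb_one, ih]
    rfl

theorem par_monField (h : GenData ev od S ps one T Tb)
    (l : List (ι × Idx K)) : EDistPar K ev od (monField S l) (monPar ps l) := by
  induction l with
  | nil => exact eDistPar_idField ev od
  | cons t l ih => exact (h.isProd t.1 t.2 l).par (h.hom _) ih

theorem nice_monField (h : GenData ev od S ps one T Tb)
    (l : List (ι × Idx K)) : Nice S ps one T Tb (monPar ps l) (monField S l) where
  tc := h.transCov_monField l
  pow := (h.transCov_monField l).isPow1 (h.isField_monField l one) h.T_one h.Tb_one
  loc i := h.isLocal_genF (.inl i) (.inr l)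

theorem wordState_mem (h : GenData ev od S ps one T Tb)
    (l : List (ι × Idx K)) : wordState S one l ∈ parSub ev od (monPar ps l) := by
  rw [← h.state_monField, ← add_zero (monPar ps l)]
  exact (h.par_monField l).mem _ (by simpa [parSub] using h.one_mem)

end GenData

/-- the fields of parity `p` generated by `S` -/
def fldSub (S : ι → EDist1 K V) (ps : ι → ZMod 2) (p : ZMod 2) : Submodule K (EDist1 K V) :=
  Submodule.span K (monField S '' {l | monPar ps l = p})

/-- the fields generated by `S` -/
def fldTop (S : ι → EDist1 K V) : Submodule K (EDist1 K V) :=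
  Submodule.span K (Set.range (monField S))

theorem fldTop_eq : fldTop S = fldSub S ps 0 ⊔ fldSub S ps 1 := by
  rw [fldSub, fldSub, ← Submodule.span_union, ← Set.image_union, fldTop, ← Set.image_univ]
  congr 2
  ext l
  simpa using zmod_two_cases (monPar ps l)

theorem fldSub_le (p : ZMod 2) : fldSub S ps p ≤ fldTop S :=
  Submodule.span_mono (Set.image_subset_range _ _)

/-- the state of a field -/
def stateMap (one : V) : EDist1 K V →ₗ[K] V where
  toFun x := x (-1) one
  map_add' _ _ := rfl
  map_smul' _ _ := rfl

namespace GenData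

theorem nice (h : GenData ev od S ps one T Tb)
    {p : ZMod 2} {x : EDist1 K V} (hx : x ∈ fldSub S ps p) :
    Nice S ps one T Tb p x := by
  induction hx using Submodule.span_induction with
  | mem x hx =>
    obtain ⟨l, rfl, rfl⟩ := hx
    exact h.nice_monField l
  | zero => exact Nice.zero
  | add x y _ _ hx hy => exact hx.add hy
  | smul a x _ hx => exact hx.smul a

theorem par (h : GenData ev od S ps one T Tb)
    {p : ZMod 2} {x : EDist1 K V} (hx : x ∈ fldSub S ps p) :
    EDistPar K ev od x p := by
  intro n
  rw [endPar_iff]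
  intro q v hv
  induction hx using Submodule.span_induction with
  | mem x hx =>
    obtain ⟨l, rfl, rfl⟩ := hx
    exact (h.par_monField l).mem n hv
  | zero => exact Submodule.zero_mem _
  | add x y _ _ hx hy => exact Submodule.add_mem _ hx hy
  | smul a x _ hx => exact Submodule.smul_mem _ a hx

theorem stateMap_mem (h : GenData ev od S ps one T Tb)
    {p : ZMod 2} {x : EDist1 K V} (hx : x ∈ fldSub S ps p) :
    stateMap one x ∈ parSub ev od p := by
  have := (h.par hx).mem (-1) (q := 0) (by simpa [parSub] using h.one_mem)
  rwa [add_zero] at this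

theorem eq_zero (h : GenData ev od S ps one T Tb)
    {p : ZMod 2} {x : EDist1 K V} (hx : x ∈ fldSub S ps p)
    (h0 : stateMap one x = 0) : x = 0 :=
  (h.nice hx).eq_zero h.T_one h.Tb_one h.span h0

theorem mem_fldSub (h : GenData ev od S ps one T Tb)
    {p : ZMod 2} {x : EDist1 K V} (hx : x ∈ fldTop S)
    (hs : stateMap one x ∈ parSub ev od p) : x ∈ fldSub S ps p := by
  rw [fldTop_eq (ps := ps), Submodule.mem_sup] at hx
  obtain ⟨y, hy, z, hz, rfl⟩ := hx
  rw [map_add] at hs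
  have hy' := h.stateMap_mem hy
  have hz' := h.stateMap_mem hz
  have hd := Submodule.disjoint_def.1 h.compl.disjoint
  simp only [parSub, if_true, one_ne_zero, if_false] at hy' hz'
  rcases zmod_two_cases p with rfl | rfl
  · simp only [parSub, if_true] at hs
    have h0 := hd _ ((Submodule.add_mem_iff_right _ hy').1 hs) hz'
    rw [h.eq_zero hz h0, add_zero]
    exact hy
  · simp only [parSub, one_ne_zero, if_false] at hs
    have h0 := hd _ hy' ((Submodule.add_mem_iff_left _ hz').1 hs)
    rw [h.eq_zero hy h0, zero_add]
    exact hz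

theorem bijective (h : GenData ev od S ps one T Tb)
    : Function.Bijective ((stateMap one).domRestrict (fldTop S)) := by
  constructor
  · rw [← LinearMap.ker_eq_bot, LinearMap.ker_eq_bot']
    rintro ⟨x, hx⟩ h0
    rw [LinearMap.domRestrict_apply] at h0
    refine Subtype.ext (h.eq_zero (h.mem_fldSub (p := 0) hx ?_) h0)
    rw [h0]
    exact Submodule.zero_mem _
  · rw [← LinearMap.range_eq_top, eq_top_iff, ← h.span, Submodule.span_le]
    rintro _ ⟨l, rfl⟩
    exact ⟨⟨monField S l, Submodule.subset_span ⟨l, rfl⟩⟩, h.state_monField l⟩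

/-- the state-field correspondence -/
def stateEquiv (h : GenData ev od S ps one T Tb)
    : fldTop S ≃ₗ[K] V := LinearEquiv.ofBijective _ h.bijective

/-- the field of a state -/
def Yfld (h : GenData ev od S ps one T Tb)
    : V →ₗ[K] EDist1 K V := (fldTop S).subtype ∘ₗ h.stateEquiv.symm.toLinearMap

theorem Yfld_mem (h : GenData ev od S ps one T Tb)
    (v : V) : h.Yfld v ∈ fldTop S := (h.stateEquiv.symm v).2

theorem stateMap_Yfld (h : GenData ev od S ps one T Tb) (v : V) : stateMap one (h.Yfld v) = v :=
  h.stateEquiv.apply_symm_apply v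

theorem Yfld_stateMap (h : GenData ev od S ps one T Tb)
    {x : EDist1 K V} (hx : x ∈ fldTop S) : h.Yfld (stateMap one x) = x :=
  congrArg Subtype.val (h.stateEquiv.symm_apply_apply ⟨x, hx⟩)

theorem range_Yfld (h : GenData ev od S ps one T Tb)
    : Set.range (fun a => h.Yfld a) = fldTop S := by
  ext x
  exact ⟨fun ⟨v, hv⟩ => hv ▸ h.Yfld_mem v, fun hx => ⟨_, h.Yfld_stateMap hx⟩⟩

theorem Yfld_mem_fldSub (h : GenData ev od S ps one T Tb)
    {p : ZMod 2} {v : V} (hv : v ∈ parSub ev od p) :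
    h.Yfld v ∈ fldSub S ps p :=
  h.mem_fldSub (h.Yfld_mem v) (by rwa [h.stateMap_Yfld])

theorem mem_fldSub_of_nice (h : GenData ev od S ps one T Tb)
    {p : ZMod 2} {x : EDist1 K V} (hx : Nice S ps one T Tb p x)
    (hs : stateMap one x ∈ parSub ev od p) : x ∈ fldSub S ps p := by
  have hY := h.Yfld_mem_fldSub hs
  rwa [(h.nice hY).eq hx h.T_one h.Tb_one h.span (h.stateMap_Yfld _)] at hY

theorem gen_mem (h : GenData ev od S ps one T Tb) (i : ι) : S i ∈ fldSub S ps (ps i) := by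
  refine h.mem_fldSub_of_nice ⟨h.tc i, h.pow i, fun j => h.isLocal_genF (.inl j) (.inl i)⟩ ?_
  have := (h.hom i).mem (-1) (q := 0) (by simpa [parSub] using h.one_mem)
  rwa [add_zero] at this

theorem ml_fldSub (h : GenData ev od S ps one T Tb)
    (r : ℕ) {f : Fin r → EDist1 K V} {pf : Fin r → ZMod 2}
    (hf : ∀ j, f j ∈ fldSub S ps (pf j)) : ML f pf (fun _ _ => {x | Kbar K x}) False one := by
  refine ML.span (X := fun j => monField S '' {l | monPar ps l = pf j}) (fun f hf => ?_) hf
  choose l hl hl' using hf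
  have := h.ml_genF r fun j => .inr (l j)
  rwa [show (fun j => genF S (.inr (l j))) = f from funext hl',
    show (fun j => genPar ps (.inr (l j))) = pf from funext hl] at this

theorem isProd_mem (h : GenData ev od S ps one T Tb)
    {p q : ZMod 2} {a b g : EDist1 K V} (ha : a ∈ fldSub S ps p)
    (hb : b ∈ fldSub S ps q) {n : Idx K} (hg : IsProd a b n g) : g ∈ fldSub S ps (p + q) := by
  have htc := hg.transCov (h.nice ha).tc (h.nice hb).tc
  refine h.mem_fldSub_of_nice ⟨htc, htc.isPow1 (hg.isField one) h.T_one h.Tb_one,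
    fun i => ?_⟩ ?_
  · have hm := (h.ml_fldSub 3 (f := ![S i, a, b]) (pf := ![ps i, p, q]) (by
      intro j
      fin_cases j
      exacts [h.gen_mem i, ha, hb])).merge 1 (N := n) (G := g) hg
    have hl := hm.isLocal
    have e : mergePar 1 ![ps i, p, q] 1 = p + q := by
      rw [add_comm]; rfl
    have e0 : mergePar 1 ![ps i, p, q] 0 = ps i := add_zero _
    rw [e, e0] at hl
    exact hl
  · have := (hg.par (h.par ha) (h.par hb)).mem (-1) (q := 0)
      (by simpa [parSub] using h.one_mem)
    rwa [add_zero] at this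

theorem exists_isProd_fldTop (h : GenData ev od S ps one T Tb)
    {a b : EDist1 K V} (ha : a ∈ fldTop S) (hb : b ∈ fldTop S)
    (n : Idx K) : ∃ g ∈ fldTop S, IsProd a b n g := by
  have key : ∀ p q, ∀ x ∈ fldSub S ps p, ∀ y ∈ fldSub S ps q, ∃ g ∈ fldTop S, IsProd x y n g := by
    intro p q x hx y hy
    have hl : IsLocal K V p q x y := (h.ml_fldSub 2 (f := ![x, y]) (pf := ![p, q]) (by
      intro j
      fin_cases j
      exacts [hx, hy])).isLocal
    obtain ⟨g, hg⟩ := exists_isProd_of_isLocal hl n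
    exact ⟨g, fldSub_le _ (h.isProd_mem hx hy hg), hg⟩
  rw [fldTop_eq (ps := ps), Submodule.mem_sup] at ha hb
  obtain ⟨x, hx, y, hy, rfl⟩ := ha
  obtain ⟨x', hx', y', hy', rfl⟩ := hb
  obtain ⟨g1, m1, p1⟩ := key 0 0 x hx x' hx'
  obtain ⟨g2, m2, p2⟩ := key 0 1 x hx y' hy'
  obtain ⟨g3, m3, p3⟩ := key 1 0 y hy x' hx'
  obtain ⟨g4, m4, p4⟩ := key 1 1 y hy y' hy'
  exact ⟨_, add_mem (add_mem m1 m2) (add_mem m3 m4),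
    (p1.add_right p2).add_left (p3.add_right p4)⟩

end GenData

end Gen

section Existence
variable {K : Type*} [Field K] [CharZero K] {V : Type*} [AddCommGroup V] [Module K V]
  {ι : Type*} {ev od : Submodule K V} {S : ι → EDist1 K V} {ps : ι → ZMod 2}
  {one : V} {T Tb : Module.End K V}

theorem foldr_finRange_eq_wordState (r : ℕ) (f : Fin r → ι) (ns : Fin r → Idx K) :
    (List.finRange r).foldr (fun j acc => S (f j) (ns j) acc) one =
      wordState S one (List.ofFn fun j => (f j, ns j)) := by
  rw [wordState, List.ofFn_eq_map, List.foldr_map]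

/-- enumeration of a finite set -/
theorem exists_range_eq_of_finite {α : Type*} {X : Set α} (hX : X.Finite) :
    ∃ (n : ℕ) (e : Fin n → α), Set.range e = X := by
  obtain ⟨n, e, he⟩ := hX.fin_param
  exact ⟨n, e, he.2⟩

namespace GenData

theorem tc_pow_fldTop (h : GenData ev od S ps one T Tb) {x : EDist1 K V} (hx : x ∈ fldTop S) :
    TransCov K V T Tb x ∧ IsPow1 K V (ev1 K V x one) := by
  rw [fldTop_eq (ps := ps), Submodule.mem_sup] at hx
  obtain ⟨y, hy, z, hz, rfl⟩ := hx
  have hy := h.nice hy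
  have hz := h.nice hz
  refine ⟨hy.tc.add hz.tc, fun n hn => ?_⟩
  by_cases h0 : ev1 K V y one n = 0
  · exact hz.pow n fun h' => hn (by simp only [ev1] at *; simp [h0, h'])
  · exact hy.pow n h0

theorem isLocal_fldSub (h : GenData ev od S ps one T Tb)
    {p q : ZMod 2} {x y : EDist1 K V} (hx : x ∈ fldSub S ps p)
    (hy : y ∈ fldSub S ps q) : IsLocal K V p q x y :=
  (h.ml_fldSub 2 (f := ![x, y]) (pf := ![p, q]) (by
    intro j
    fin_cases j
    exacts [hx, hy])).isLocal

/-- the OPE-algebra generated by a system of fields -/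
def alg (h : GenData ev od S ps one T Tb)
    (hT : EndPar K ev od T 0) (hTb : EndPar K ev od Tb 0) (hc : T * Tb = Tb * T) :
    OPEAlg K V where
  ev := ev
  od := od
  compl := h.compl
  Y := h.Yfld
  Y_par _ _ ha n _ _ hb :=
    memPar_iff.2 ((h.par (h.Yfld_mem_fldSub (memPar_iff.1 ha))).mem n (memPar_iff.1 hb))
  one := one
  one_ev := h.one_mem
  T := T
  Tb := Tb
  T_ev := hT
  Tb_ev := hTb
  commTTb := hc
  T_one := h.T_one
  Tb_one := h.Tb_one
  wcre a := (h.tc_pow_fldTop (h.Yfld_mem a)).2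
  rid a := h.stateMap_Yfld a
  tcov a := (h.tc_pow_fldTop (h.Yfld_mem a)).1
  loc _ _ _ _ ha hb := h.isLocal_fldSub (h.Yfld_mem_fldSub (memPar_iff.1 ha))
    (h.Yfld_mem_fldSub (memPar_iff.1 hb))

theorem exists_finset_monField (h : GenData ev od S ps one T Tb)
    (v : V) (p : ZMod 2) : ∃ s : Finset (List (ι × Idx K)),
    (∀ l ∈ s, monPar ps l = p) ∧
      (v ∈ parSub ev od p → h.Yfld v ∈ Submodule.span K (monField S '' (s : Set _))) := by
  by_cases hv : v ∈ parSub ev od p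
  · obtain ⟨t, ht, hm⟩ := Submodule.mem_span_finite_of_mem_span (h.Yfld_mem_fldSub hv)
    obtain ⟨s, hs, rfl⟩ := Finset.subset_set_image_iff.1 ht
    exact ⟨s, hs, fun _ => by simpa using hm⟩
  · exact ⟨∅, by simp, fun h' => absurd h' hv⟩

theorem unifLocal (h : GenData ev od S ps one T Tb)
    {rr : ι → ι → ℕ} {hh : ∀ i j : ι, Fin (rr i j) → Idx K}
    (hu : ∀ (r : ℕ) (f : Fin r → ι),
      ∃ c, IsMultOPE K V (fun j => S (f j)) (fun j => ps (f j))
        (fun i j => rr (f i) (f j)) (fun i j => hh (f i) (f j)) c ∧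
        ∀ α, IsPowN K V (evN K V (c α) one)) :
    ∃ (rr : V → V → ℕ) (hh : ∀ a b : V, Fin (rr a b) → Idx K),
      ∀ (r : ℕ) (f : Fin r → V) (pf : Fin r → ZMod 2), (∀ i, memPar K ev od (f i) (pf i)) →
        ∃ c, IsMultOPE K V (fun i => h.Yfld (f i)) pf (fun i j => rr (f i) (f j))
            (fun i j => hh (f i) (f j)) c ∧
          ∀ α, IsPowN K V (evN K V (c α) one) := by
  choose s hs hs' using h.exists_finset_monField
  set G := GenExp fun i j => Set.range (hh i j) with hG
  have hml : ∀ (r : ℕ) (f : Fin r → ι ⊕ List (ι × Idx K)),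
      ML (fun j => genF S (f j)) (fun j => genPar ps (f j))
        (fun i j => {x | G (f i) (f j) x}) True one :=
    ML.of_generators (expClosed_genExp _) fun r f => by
      obtain ⟨c, hc, hc'⟩ := hu r f
      exact hc.ml (fun p x => .base _ _ _ ⟨x, rfl⟩) fun _ => hc'
  let H : V → V → Set (Idx K) := fun v w =>
    {x | (∃ l ∈ s v 0 ∪ s v 1, ∃ l' ∈ s w 0 ∪ s w 1, G (.inr l) (.inr l') x) ∧ Kbar K x}
  have hfin : ∀ v w, (H v w).Finite := fun v w => by
    refine ((s v 0 ∪ s v 1).finite_toSet.biUnion fun l _ =>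
      (s w 0 ∪ s w 1).finite_toSet.biUnion fun l' _ =>
        finite_genExp (fun i j => Set.finite_range (hh i j)) (.inr l) (.inr l')).subset ?_
    rintro x ⟨⟨l, hl, l', hl', hx⟩, -⟩
    exact Set.mem_biUnion hl (Set.mem_biUnion hl' hx)
  choose rr' hh' hrange using fun v w => exists_range_eq_of_finite (hfin v w)
  refine ⟨rr', hh', fun r f pf hf => ?_⟩
  have hsub : ∀ (v : V) (p : ZMod 2), s v p ⊆ s v 0 ∪ s v 1 := fun v p => by
    rcases zmod_two_cases p with rfl | rfl
    exacts [Finset.subset_union_left, Finset.subset_union_right]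
  have hM : ML (fun i => h.Yfld (f i)) pf (fun i j => H (f i) (f j)) True one := by
    have hY : ∀ i, h.Yfld (f i) ∈
        Submodule.span K (monField S '' (s (f i) (pf i) : Set (List (ι × Idx K)))) :=
      fun i => hs' (f i) (pf i) (memPar_iff.1 (hf i))
    refine ML.span (fun g hg => ?_) hY
    choose l hl hl' using hg
    obtain rfl : (fun j => genF S (.inr (l j))) = g := funext hl'
    obtain rfl : (fun j => genPar ps (.inr (l j))) = pf := funext fun j => hs _ _ _ (hl j)
    obtain ⟨B, hB, e, c, h1, h2, h3⟩ := hml r fun j => .inr (l j)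
    refine ⟨B, hB, e, c, fun β p => ?_, h2, h3⟩
    exact ⟨⟨_, hsub _ _ (hl _), _, hsub _ _ (hl _), h1 β p⟩, h2 β p⟩
  obtain ⟨c, hc, hc'⟩ := hM.isMultOPE (rij := fun i j => rr' (f i) (f j))
    (hh := fun i j => hh' (f i) (f j)) (fun p => (hrange _ _).ge) fun i j k =>
      ((hrange (f i) (f j)).le ⟨k, rfl⟩).2
  exact ⟨c, hc, hc' trivial⟩

theorem ext_span (h : GenData ev od S ps one T Tb)
    {f g : V →ₗ[K] V} (e : ∀ l, f (wordState S one l) = g (wordState S one l)) :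
    f = g :=
  LinearMap.ext_on_range h.span e

theorem transGen_unique (h : GenData ev od S ps one T Tb)
    {T' Tb' : Module.End K V} (htc : ∀ i, TransCov K V T' Tb' (S i))
    (hT : T' one = 0) (hTb : Tb' one = 0) : T' = T ∧ Tb' = Tb := by
  constructor
  · refine h.ext_span fun l => ?_
    induction l with
    | nil => exact hT.trans h.T_one.symm
    | cons t l ih =>
      have e1 := DFunLike.congr_fun ((htc t.1).1 t.2) (wordState S one l)
      have e2 := DFunLike.congr_fun ((h.tc t.1).1 t.2) (wordState S one l)
      rw [← e2] at e1
      simp only [LinearMap.sub_apply, Module.End.mul_apply, ih] at e1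
      exact sub_left_injective e1
  · refine h.ext_span fun l => ?_
    induction l with
    | nil => exact hTb.trans h.Tb_one.symm
    | cons t l ih =>
      have e1 := DFunLike.congr_fun ((htc t.1).2 t.2) (wordState S one l)
      have e2 := DFunLike.congr_fun ((h.tc t.1).2 t.2) (wordState S one l)
      rw [← e2] at e1
      simp only [LinearMap.sub_apply, Module.End.mul_apply, ih] at e1
      exact sub_left_injective e1

theorem s1_mem (h : GenData ev od S ps one T Tb) (i : ι) : s1 K V one (S i) ∈ parSub ev od (ps i) :=
  h.stateMap_mem (h.gen_mem i)

theorem Yfld_s1 (h : GenData ev od S ps one T Tb) (i : ι) : h.Yfld (s1 K V one (S i)) = S i :=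
  h.Yfld_stateMap (fldSub_le _ (h.gen_mem i))

theorem Y_unique (h : GenData ev od S ps one T Tb)
    (A : OPEAlg K V) (hev : A.ev = ev) (hod : A.od = od) (hone : A.one = one)
    (hS : ∀ i, A.Y (s1 K V one (S i)) = S i) : A.Y = h.Yfld := by
  have htc : ∀ i, TransCov K V A.T A.Tb (S i) := fun i => hS i ▸ A.tcov (s1 K V one (S i))
  obtain ⟨hT, hTb⟩ := h.transGen_unique htc (hone ▸ A.T_one) (hone ▸ A.Tb_one)
  have hw : ∀ l, A.Y (wordState S one l) = monField S l := fun l => by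
    have hn : Nice S ps one T Tb (monPar ps l) (A.Y (wordState S one l)) := by
      refine ⟨hT ▸ hTb ▸ A.tcov _, hone ▸ A.wcre _, fun i => ?_⟩
      have := A.loc (s1 K V one (S i)) (wordState S one l) (ps i) (monPar ps l)
        (by rw [hev, hod]; exact memPar_iff.2 (h.s1_mem i))
        (by rw [hev, hod]; exact memPar_iff.2 (h.wordState_mem l))
      rwa [hS] at this
    refine hn.eq (h.nice_monField l) h.T_one h.Tb_one h.span ?_
    rw [h.state_monField]
    have := A.rid (wordState S one l)
    rwa [hone] at this
  refine LinearMap.ext_on_range h.span fun l => ?_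
  rw [hw, ← h.state_monField l]
  exact (h.Yfld_stateMap (Submodule.subset_span ⟨l, rfl⟩)).symm

theorem exists_prodAt (h : GenData ev od S ps one T Tb)
    {d e : EDist1 K V} (hd : d ∈ fldTop S) (he : e ∈ fldTop S)
    {pd pe : ZMod 2} {r : ℕ} {c : Fin r → EDist2 K V} {hs : Fin r → Idx K}
    (ho : IsOPE K V pd pe d e c hs) (n : Idx K) :
    ∃ g ∈ fldTop S, ∀ (v : V) (m : Idx K), ev1 K V g v m = prodAt K V c hs n v m := by
  obtain ⟨g, hg, hp⟩ := h.exists_isProd_fldTop hd he n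
  refine ⟨g, hg, fun v m => ?_⟩
  rw [prodAt_eq]
  exact hp.unique ⟨ho.2.1, ho.2.2.1⟩ v m

theorem fldTop_le (h : GenData ev od S ps one T Tb)
    {G : Submodule K (EDist1 K V)} (hS : ∀ i, S i ∈ G) (hid : idField K V ∈ G)
    (hG : ∀ d ∈ G, ∀ e ∈ G, ∀ (pd pe : ZMod 2) {r : ℕ} (c : Fin r → EDist2 K V)
      (hs : Fin r → Idx K), IsOPE K V pd pe d e c hs → ∀ n : Idx K,
        ∃ g ∈ G, ∀ (v : V) (m : Idx K), ev1 K V g v m = prodAt K V c hs n v m) :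
    fldTop S ≤ G := by
  refine Submodule.span_le.2 ?_
  rintro _ ⟨l, rfl⟩
  induction l with
  | nil => exact hid
  | cons t l ih =>
    obtain ⟨r, c, e, ho⟩ := h.isLocal_genF (.inl t.1) (.inr l)
    obtain ⟨g, hg, hp⟩ := hG _ (hS t.1) _ ih _ _ c e ho t.2
    have : monField S ((t.1, t.2) :: l) = g := by
      ext m v
      have e1 := (h.isProd t.1 t.2 l).unique (c := c) (h := e) ⟨ho.2.1, ho.2.2.1⟩ v m
      rw [e1, ← prodAt_eq, ← hp]
      rfl
    exact this ▸ hg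

end GenData

end Existence

/-- Existence theorem: a weakly creative, translation covariant,
multiply (resp. uniformly) local generating set S of homogeneous fields gives a unique
multiply (resp. uniformly) local OPE-algebra structure on V with weak right
identity 1 and Y(s₁ a(𝐳)) = a(𝐳) for a(𝐳) ∈ S; moreover F_Y = ⌊S⌋. -/
theorem stmt_10 (K : Type*) [Field K] [CharZero K]
    (V : Type*) [AddCommGroup V] [Module K V]
    (evV odV : Submodule K V) (hgr : IsCompl evV odV)
    (one : V) (hone : one ∈ evV)
    (T Tb : Module.End K V) (hT : EndPar K evV odV T 0) (hTb : EndPar K evV odV Tb 0)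
    (hcomm : T * Tb = Tb * T) (hT1 : T one = 0) (hTb1 : Tb one = 0)
    {ι : Type*} (S : ι → EDist1 K V) (ps : ι → ZMod 2)
    (hhom : ∀ i, EDistPar K evV odV (S i) (ps i))
    (hfld : ∀ i, IsFieldD K V (S i))
    (hwc : ∀ i, IsPow1 K V (ev1 K V (S i) one))
    (htc : ∀ i, TransCov K V T Tb (S i))
    (hml : ∀ (r : ℕ) (f : Fin r → ι),
      MultiplyLocal K V (fun j => S (f j)) (fun j => ps (f j)))
    (hspan : ∀ v : V, v ∈ Submodule.span K
      {w : V | ∃ (r : ℕ) (f : Fin r → ι) (ns : Fin r → Idx K),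
        w = (List.finRange r).foldr (fun j acc => S (f j) (ns j) acc) one}) :
    ∃ A : OPEAlg K V,
      A.ev = evV ∧ A.od = odV ∧ A.one = one ∧ A.T = T ∧ A.Tb = Tb ∧
      (∀ i, A.Y (s1 K V one (S i)) = S i) ∧
      MultLocalAlg K V A ∧
      ((∃ (rr : ι → ι → ℕ) (hh : ∀ i j : ι, Fin (rr i j) → Idx K),
          ∀ (r : ℕ) (f : Fin r → ι),
            ∃ c, IsMultOPE K V (fun j => S (f j)) (fun j => ps (f j))
                (fun i j => rr (f i) (f j)) (fun i j => hh (f i) (f j)) c ∧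
              ∀ α, IsPowN K V (evN K V (c α) one)) →
        UnifLocalAlg K V A) ∧
      (∀ A' : OPEAlg K V, A'.ev = evV → A'.od = odV → A'.one = one →
        (∀ i, A'.Y (s1 K V one (S i)) = S i) → ∀ a : V, A'.Y a = A.Y a) ∧
      (∀ i, S i ∈ Set.range (fun a : V => A.Y a)) ∧
      idField K V ∈ Set.range (fun a : V => A.Y a) ∧
      (∀ d e : EDist1 K V, d ∈ Set.range (fun a : V => A.Y a) →
        e ∈ Set.range (fun a : V => A.Y a) →
        ∀ (pd pe : ZMod 2) {r' : ℕ} (c : Fin r' → EDist2 K V) (h : Fin r' → Idx K),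
          IsOPE K V pd pe d e c h → ∀ n : Idx K,
            ∃ g ∈ Set.range (fun a : V => A.Y a),
              ∀ (v : V) (m : Idx K), ev1 K V g v m = prodAt K V c h n v m) ∧
      (∀ G : Submodule K (EDist1 K V), (∀ i, S i ∈ G) → idField K V ∈ G →
        (∀ d ∈ G, ∀ e ∈ G, ∀ (pd pe : ZMod 2) {r' : ℕ} (c : Fin r' → EDist2 K V)
            (h : Fin r' → Idx K),
          IsOPE K V pd pe d e c h → ∀ n : Idx K,
            ∃ g ∈ G, ∀ (v : V) (m : Idx K), ev1 K V g v m = prodAt K V c h n v m) →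
        Set.range (fun a : V => A.Y a) ⊆ (G : Set (EDist1 K V))) := by
  have h : GenData evV odV S ps one T Tb :=
    { compl := hgr
      one_mem := hone
      T_one := hT1
      Tb_one := hTb1
      hom := hhom
      fld := hfld
      pow := hwc
      tc := htc
      ml := hml
      span := by
        refine eq_top_iff.2 fun v _ => Submodule.span_mono ?_ (hspan v)
        rintro w ⟨r, f, ns, rfl⟩
        exact ⟨_, (foldr_finRange_eq_wordState r f ns).symm⟩ }
  have hr : Set.range (fun a : V => h.Yfld a) = (fldTop S : Set (EDist1 K V)) := h.range_Yfld
  refine ⟨h.alg hT hTb hcomm, rfl, rfl, rfl, rfl, rfl, h.Yfld_s1, ?_, ?_, ?_, ?_, ?_, ?_, ?_⟩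
  · exact fun r f pf hf =>
      (h.ml_fldSub r fun i => h.Yfld_mem_fldSub (memPar_iff.1 (hf i))).multiplyLocal
  · rintro ⟨rr, hh, hu⟩
    exact h.unifLocal hu
  · exact fun A' hev hod hone' hS' a => DFunLike.congr_fun (h.Y_unique A' hev hod hone' hS') a
  · exact fun i => ⟨_, h.Yfld_s1 i⟩
  · exact hr.ge (Submodule.subset_span ⟨[], rfl⟩)
  · intro d e hd he pd pe r' c hs ho n
    obtain ⟨g, hg, hp⟩ := h.exists_prodAt (hr.le hd) (hr.le he) ho n
    exact ⟨g, hr.ge hg, hp⟩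
  · exact fun G hS hid hG => hr.le.trans (h.fldTop_le hS hid hG)

end OPEA
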